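/- arXiv:1511.03081 — 3 statements merged into one kernel-verified Lean document; each statement's English description precedes it below -/
import Mathlib

section
/- The Sierpiński carpet S admits a topologically mixing homeomorphism, and yet S is 1/n-indecomposable for no n: for every n ∈ ℕ there exist n pairwise disjoint closed connected subsets of S each having nonempty interior in S. (This answers in the negative the question whether every one-dimensional continuum admitting a mixing homeomorphism must be 1/n-indecomposable for some n.) -/
/-- The Sierpiński carpet: points of `[0,1]²` admitting ternary expansions with no index at
which both digits equal `1`. -/
def sierpinskiCarpet : Set (ℝ × ℝ) :=
  {p | ∃ a b : ℕ → Fin 3, (∀ i, ¬(a i = 1 ∧ b i = 1)) ∧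
    p.1 = ∑' i : ℕ, (a i : ℝ) / 3 ^ (i + 1) ∧ p.2 = ∑' i : ℕ, (b i : ℝ) / 3 ^ (i + 1)}

/-- A map is topologically mixing if for all nonempty open `U, V` there is `N` with
`T^n(U) ∩ V ≠ ∅` for all `n ≥ N`. -/
def TopologicallyMixing {X : Type*} [TopologicalSpace X] (T : X → X) : Prop :=
  ∀ U V : Set X, IsOpen U → IsOpen V → U.Nonempty → V.Nonempty →
    ∃ N : ℕ, ∀ n : ℕ, N ≤ n → (T^[n] '' U ∩ V).Nonempty

/-- Bowen's specification property. -/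
def BowenSpecification {X : Type*} [MetricSpace X] (T : X → X) : Prop :=
  ∀ ε : ℝ, 0 < ε → ∃ N : ℕ, 0 < N ∧
    ∀ s : ℕ, 2 ≤ s → ∀ y : ℕ → X, ∀ j k : ℕ → ℕ,
      j 0 = 0 → (∀ m, m < s → j m ≤ k m) →
      (∀ m, m + 1 < s → k m < j (m + 1) ∧ N ≤ j (m + 1) - k m) →
      ∃ x : X, ∀ m, m < s → ∀ i, j m ≤ i → i ≤ k m →
        dist (T^[i] x) (T^[i] (y m)) < ε

open Set Filter Topology

namespace Carpet

/-- The plane with the maximum norm. -/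
abbrev Plane : Type := ℝ × ℝ

/-- The closed unit square. -/
def unitSquare : Set Plane := Icc 0 1 ×ˢ Icc 0 1

/-- The open unit square. -/
def openSquare : Set Plane := Ioo 0 1 ×ˢ Ioo 0 1

/-- Pairs of ternary digits other than the pair `(1, 1)`. -/
abbrev Digit : Type := {d : Fin 3 × Fin 3 // d ≠ (1, 1)}

instance : Inhabited Digit := ⟨⟨(0, 0), by decide⟩⟩

/-- The similarity of ratio `1/3` mapping the unit square onto the subsquare at position `d`. -/
noncomputable def tile (d : Digit) (q : Plane) : Plane :=
  ((q.1 + d.1.1) / 3, (q.2 + d.1.2) / 3)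

theorem digit_fst_le (d : Digit) : ((d.1.1 : ℕ) : ℝ) ≤ 2 := by
  exact_mod_cast Nat.le_of_lt_succ d.1.1.isLt

theorem digit_snd_le (d : Digit) : ((d.1.2 : ℕ) : ℝ) ≤ 2 := by
  exact_mod_cast Nat.le_of_lt_succ d.1.2.isLt

theorem tile_injective (d : Digit) : Function.Injective (tile d) := by
  intro p q h
  simp only [tile, Prod.mk.injEq] at h
  ext <;> linarith [h.1, h.2]

theorem continuous_tile (d : Digit) : Continuous (tile d) := by
  unfold tile; fun_prop

theorem dist_tile (d : Digit) (p q : Plane) : dist (tile d p) (tile d q) = dist p q / 3 := by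
  have h : tile d p - tile d q = (3⁻¹ : ℝ) • (p - q) := by
    ext <;> simp [tile] <;> ring
  rw [dist_eq_norm, h, norm_smul, dist_eq_norm]
  norm_num
  ring

theorem tile_mem_unitSquare (d : Digit) {q : Plane} (hq : q ∈ unitSquare) :
    tile d q ∈ unitSquare := by
  obtain ⟨⟨h1, h2⟩, h3, h4⟩ := hq
  have := digit_fst_le d
  have := digit_snd_le d
  have : (0 : ℝ) ≤ ((d.1.1 : ℕ) : ℝ) := Nat.cast_nonneg _
  have : (0 : ℝ) ≤ ((d.1.2 : ℕ) : ℝ) := Nat.cast_nonneg _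
  refine ⟨⟨?_, ?_⟩, ?_, ?_⟩ <;> simp only [tile] <;> linarith

theorem tile_mem_openSquare (d : Digit) {q : Plane} (hq : q ∈ openSquare) :
    tile d q ∈ openSquare := by
  obtain ⟨⟨h1, h2⟩, h3, h4⟩ := hq
  have := digit_fst_le d
  have := digit_snd_le d
  have : (0 : ℝ) ≤ ((d.1.1 : ℕ) : ℝ) := Nat.cast_nonneg _
  have : (0 : ℝ) ≤ ((d.1.2 : ℕ) : ℝ) := Nat.cast_nonneg _
  refine ⟨⟨?_, ?_⟩, ?_, ?_⟩ <;> simp only [tile] <;> linarith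

theorem openSquare_subset : openSquare ⊆ unitSquare := fun _ h =>
  ⟨⟨h.1.1.le, h.1.2.le⟩, h.2.1.le, h.2.2.le⟩

theorem isCompact_unitSquare : IsCompact unitSquare := isCompact_Icc.prod isCompact_Icc

theorem isOpen_openSquare : IsOpen openSquare := isOpen_Ioo.prod isOpen_Ioo

theorem summable_ternary (a : ℕ → Fin 3) :
    Summable fun i : ℕ => ((a i : ℕ) : ℝ) / 3 ^ (i + 1) := by
  have h : Summable fun i : ℕ => (2 : ℝ) * (1 / 3) ^ (i + 1) :=
    ((summable_nat_add_iff 1).2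
      (summable_geometric_of_lt_one (by norm_num) (by norm_num : (1 / 3 : ℝ) < 1))).mul_left 2
  refine Summable.of_nonneg_of_le (fun i => by positivity) (fun i => ?_) h
  have h2 : ((a i : ℕ) : ℝ) ≤ 2 := by exact_mod_cast Nat.le_of_lt_succ (a i).isLt
  rw [div_eq_mul_inv, one_div, inv_pow]
  gcongr

theorem tsum_ternary_succ (a : ℕ → Fin 3) :
    ∑' i : ℕ, ((a i : ℕ) : ℝ) / 3 ^ (i + 1) =
      ((∑' i : ℕ, ((a (i + 1) : ℕ) : ℝ) / 3 ^ (i + 1)) + ((a 0 : ℕ) : ℝ)) / 3 := by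
  rw [(summable_ternary a).tsum_eq_zero_add, add_div, ← tsum_div_const, add_comm]
  congr 1
  · congr 1; ext i; rw [pow_succ _ (i + 1)]; field_simp
  · simp

theorem tsum_ternary_mem (a : ℕ → Fin 3) :
    ∑' i : ℕ, ((a i : ℕ) : ℝ) / 3 ^ (i + 1) ∈ Icc (0 : ℝ) 1 := by
  refine ⟨tsum_nonneg fun i => by positivity, ?_⟩
  have h : HasSum (fun i : ℕ => (2 / 3 : ℝ) * (1 / 3) ^ i) 1 := by
    have := (hasSum_geometric_of_lt_one (by norm_num) (by norm_num : (1 / 3 : ℝ) < 1)).mul_left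
      (2 / 3 : ℝ)
    norm_num at this ⊢
    exact this
  rw [← h.tsum_eq]
  refine (summable_ternary a).tsum_le_tsum (fun i => ?_) h.summable
  have h2 : ((a i : ℕ) : ℝ) ≤ 2 := by exact_mod_cast Nat.le_of_lt_succ (a i).isLt
  rw [pow_succ, one_div, inv_pow, div_le_iff₀ (by positivity)]
  field_simp
  linarith

theorem carpet_subset_unitSquare : sierpinskiCarpet ⊆ unitSquare := by
  rintro p ⟨a, b, -, h1, h2⟩
  exact ⟨h1 ▸ tsum_ternary_mem a, h2 ▸ tsum_ternary_mem b⟩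

theorem exists_tile_of_mem_carpet {p : Plane} (hp : p ∈ sierpinskiCarpet) :
    ∃ d : Digit, ∃ q ∈ sierpinskiCarpet, p = tile d q := by
  obtain ⟨a, b, hab, h1, h2⟩ := hp
  refine ⟨⟨(a 0, b 0), fun h => hab 0 (by simpa using h)⟩,
    (∑' i : ℕ, ((a (i + 1) : ℕ) : ℝ) / 3 ^ (i + 1), ∑' i : ℕ, ((b (i + 1) : ℕ) : ℝ) / 3 ^ (i + 1)),
    ⟨fun i => a (i + 1), fun i => b (i + 1), fun i => hab _, rfl, rfl⟩, ?_⟩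
  exact Prod.ext (h1.trans (tsum_ternary_succ a)) (h2.trans (tsum_ternary_succ b))

theorem eq_tsum_of_step (x : ℕ → ℝ) (a : ℕ → Fin 3) (hx : ∀ n, x n ∈ Icc (0 : ℝ) 1)
    (h : ∀ n, x n = (x (n + 1) + ((a n : ℕ) : ℝ)) / 3) :
    x 0 = ∑' i : ℕ, ((a i : ℕ) : ℝ) / 3 ^ (i + 1) := by
  have key : ∀ n, ∑ i ∈ Finset.range n, ((a i : ℕ) : ℝ) / 3 ^ (i + 1) = x 0 - x n / 3 ^ n := by
    intro n
    induction n with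
    | zero => simp
    | succ n ih =>
      rw [Finset.sum_range_succ, ih, h n, pow_succ]
      field_simp
      ring
  refine (HasSum.tsum_eq ?_).symm
  rw [hasSum_iff_tendsto_nat_of_nonneg (fun i => by positivity)]
  simp_rw [key]
  have h0 : Tendsto (fun n => x n / 3 ^ n) atTop (𝓝 0) := by
    refine squeeze_zero (fun n => div_nonneg (hx n).1 (by positivity)) (fun n => ?_)
      (tendsto_pow_atTop_nhds_zero_of_lt_one (by norm_num) (by norm_num : (1 / 3 : ℝ) < 1))
    rw [one_div, inv_pow, div_eq_mul_inv]
    exact mul_le_of_le_one_left (by positivity) (hx n).2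
  simpa using tendsto_const_nhds.sub h0

/-- The carpet is the largest subset of the unit square covered by its own eight tiles. -/
theorem subset_carpet {B : Set Plane} (hB : B ⊆ unitSquare)
    (h : ∀ p ∈ B, ∃ d : Digit, ∃ q ∈ B, p = tile d q) : B ⊆ sierpinskiCarpet := by
  intro p hp
  choose! dig nxt hnxt heq using h
  have hmem : ∀ n, nxt^[n] p ∈ B := by
    intro n
    induction n with
    | zero => exact hp
    | succ n ih => rw [Function.iterate_succ_apply']; exact hnxt _ ih
  have hstep : ∀ n, nxt^[n] p = tile (dig (nxt^[n] p)) (nxt^[n + 1] p) := by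
    intro n
    rw [Function.iterate_succ_apply']
    exact heq _ (hmem n)
  refine ⟨fun n => (dig (nxt^[n] p)).1.1, fun n => (dig (nxt^[n] p)).1.2, fun n hn => ?_, ?_, ?_⟩
  · exact (dig (nxt^[n] p)).2 (Prod.ext hn.1 hn.2)
  · exact eq_tsum_of_step (fun n => (nxt^[n] p).1) _ (fun n => (hB (hmem n)).1)
      fun n => congrArg Prod.fst (hstep n)
  · exact eq_tsum_of_step (fun n => (nxt^[n] p).2) _ (fun n => (hB (hmem n)).2)
      fun n => congrArg Prod.snd (hstep n)

theorem tile_mem_carpet (d : Digit) {q : Plane} (hq : q ∈ sierpinskiCarpet) :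
    tile d q ∈ sierpinskiCarpet := by
  refine subset_carpet (B := insert (tile d q) sierpinskiCarpet) ?_ ?_ (mem_insert _ _)
  · exact insert_subset (tile_mem_unitSquare d (carpet_subset_unitSquare hq))
      carpet_subset_unitSquare
  · rintro p (rfl | hp)
    · exact ⟨d, q, Or.inr hq, rfl⟩
    · obtain ⟨e, r, hr, rfl⟩ := exists_tile_of_mem_carpet hp
      exact ⟨e, r, Or.inr hr, rfl⟩

theorem isClosed_carpet : IsClosed sierpinskiCarpet := by
  refine isClosed_of_closure_subset (subset_carpet ?_ ?_)
  · exact closure_minimal carpet_subset_unitSquare isCompact_unitSquare.isClosed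
  · have hc : IsCompact (closure sierpinskiCarpet) :=
      isCompact_unitSquare.of_isClosed_subset isClosed_closure
        (closure_minimal carpet_subset_unitSquare isCompact_unitSquare.isClosed)
    have : closure sierpinskiCarpet ⊆ ⋃ d : Digit, tile d '' closure sierpinskiCarpet := by
      refine closure_minimal ?_ (isClosed_iUnion_of_finite fun d =>
        (hc.image (continuous_tile d)).isClosed)
      intro p hp
      obtain ⟨d, q, hq, rfl⟩ := exists_tile_of_mem_carpet hp
      exact mem_iUnion.2 ⟨d, mem_image_of_mem _ (subset_closure hq)⟩
    intro p hp
    obtain ⟨d, q, hq, rfl⟩ := mem_iUnion.1 (this hp)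
    exact ⟨d, q, hq, rfl⟩

theorem isCompact_carpet : IsCompact sierpinskiCarpet :=
  isCompact_unitSquare.of_isClosed_subset isClosed_carpet carpet_subset_unitSquare

theorem exists_ternary_digit {x : ℝ} (hx : x ∈ Icc (0 : ℝ) 1) :
    ∃ i : Fin 3, ∃ y ∈ Icc (0 : ℝ) 1, x = (y + ((i : ℕ) : ℝ)) / 3 := by
  obtain ⟨h0, h1⟩ := hx
  rcases le_total x (1 / 3) with h | h
  · exact ⟨0, 3 * x, ⟨by linarith, by linarith⟩, by simp⟩
  rcases le_total x (2 / 3) with h' | h'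
  · exact ⟨1, 3 * x - 1, ⟨by linarith, by linarith⟩, by simp⟩
  · exact ⟨2, 3 * x - 2, ⟨by linarith, by linarith⟩, by simp⟩

theorem boundary_subset_carpet : unitSquare \ openSquare ⊆ sierpinskiCarpet := by
  have h0 : ∀ e : Fin 3, e ≠ 1 → ∀ t : ℝ, t = (t + ((e : ℕ) : ℝ)) / 3 → t ∈ Icc (0 : ℝ) 1 →
      (Icc (0 : ℝ) 1 ×ˢ {t} ⊆ sierpinskiCarpet ∧ {t} ×ˢ Icc (0 : ℝ) 1 ⊆ sierpinskiCarpet) := by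
    intro e he t ht htm
    constructor
    · refine subset_carpet (fun p hp => ⟨hp.1, by rw [hp.2]; exact htm⟩) ?_
      rintro ⟨x, y⟩ ⟨hx, rfl⟩
      obtain ⟨i, x', hx', hxx⟩ := exists_ternary_digit hx
      exact ⟨⟨(i, e), fun h => he (congrArg Prod.snd h)⟩, (x', y), ⟨hx', rfl⟩, Prod.ext hxx ht⟩
    · refine subset_carpet (fun p hp => ⟨by rw [hp.1]; exact htm, hp.2⟩) ?_
      rintro ⟨x, y⟩ ⟨rfl, hy⟩
      obtain ⟨i, y', hy', hyy⟩ := exists_ternary_digit hy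
      exact ⟨⟨(e, i), fun h => he (congrArg Prod.fst h)⟩, (x, y'), ⟨rfl, hy'⟩, Prod.ext ht hyy⟩
  have hz := h0 0 (by decide) 0 (by simp) (by simp)
  have ho := h0 2 (by decide) 1 (by norm_num) (by simp)
  rintro ⟨x, y⟩ ⟨⟨hx, hy⟩, hn⟩
  simp only [mem_Icc] at hx hy
  simp only [openSquare, mem_prod, mem_Ioo, not_and_or, not_lt] at hn
  rcases hn with (h | h) | (h | h)
  · exact hz.2 ⟨le_antisymm h hx.1, hy⟩
  · exact ho.2 ⟨le_antisymm hx.2 h, hy⟩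
  · exact hz.1 ⟨hx, le_antisymm h hy.1⟩
  · exact ho.1 ⟨hx, le_antisymm hy.2 h⟩

/-- The direction of a vector, normalised for the maximum norm. -/
noncomputable def dir (v : Plane) : Plane := ‖v‖⁻¹ • v

theorem norm_dir {v : Plane} (hv : v ≠ 0) : ‖dir v‖ = 1 := by
  rw [dir, norm_smul, norm_inv, norm_norm, inv_mul_cancel₀ (norm_ne_zero_iff.2 hv)]

theorem norm_smul_dir (v : Plane) : ‖v‖ • dir v = v := by
  rcases eq_or_ne v 0 with rfl | hv
  · simp
  · rw [dir, smul_smul, mul_inv_cancel₀ (norm_ne_zero_iff.2 hv), one_smul]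

theorem dir_smul {s : ℝ} (hs : 0 < s) (v : Plane) : dir (s • v) = dir v := by
  rw [dir, dir, norm_smul, Real.norm_of_nonneg hs.le, smul_smul, mul_inv, mul_comm s⁻¹, mul_assoc,
    inv_mul_cancel₀ hs.ne', mul_one]

theorem continuousAt_dir {v : Plane} (hv : v ≠ 0) : ContinuousAt dir v :=
  (continuousAt_id.norm.inv₀ (norm_ne_zero_iff.2 hv)).smul continuousAt_id

/-- The filter of points approaching `a` along the direction `u`. -/
noncomputable def approach (a u : Plane) : Filter Plane :=
  𝓝[≠] a ⊓ comap (fun z => dir (z - a)) (𝓝 u)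

theorem tendsto_approach {X : Type*} {l : Filter X} {f : X → Plane} {a u : Plane} :
    Tendsto f l (approach a u) ↔
      Tendsto f l (𝓝 a) ∧ (∀ᶠ x in l, f x ≠ a) ∧ Tendsto (fun x => dir (f x - a)) l (𝓝 u) := by
  rw [approach, tendsto_inf, tendsto_nhdsWithin_iff, tendsto_comap_iff, and_assoc]
  rfl

theorem approach_le_nhds (a u : Plane) : approach a u ≤ 𝓝 a :=
  inf_le_left.trans nhdsWithin_le_nhds

theorem tendsto_dir_approach (a u : Plane) :
    Tendsto (fun z => dir (z - a)) (approach a u) (𝓝 u) :=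
  (tendsto_approach.1 tendsto_id).2.2

theorem eventually_ne_approach (a u : Plane) : ∀ᶠ z in approach a u, z ≠ a :=
  (tendsto_approach.1 tendsto_id).2.1

/-- `g` acts injectively on the directions at `a`. -/
def DirAt (g : Plane → Plane) (a : Plane) : Prop :=
  ∃ l : Plane → Plane, InjOn l (Metric.sphere 0 1) ∧
    MapsTo l (Metric.sphere 0 1) (Metric.sphere 0 1) ∧
    ∀ u ∈ Metric.sphere (0 : Plane) 1, Tendsto g (approach a u) (approach (g a) (l u))

theorem DirAt.comp {g f : Plane → Plane} {a : Plane} (hg : DirAt g (f a)) (hf : DirAt f a) :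
    DirAt (g ∘ f) a := by
  obtain ⟨l, hl, hm, ht⟩ := hg
  obtain ⟨k, hk, km, kt⟩ := hf
  exact ⟨l ∘ k, hl.comp hk km, hm.comp km, fun u hu => (ht _ (km hu)).comp (kt u hu)⟩

theorem DirAt.congr {g f : Plane → Plane} {a : Plane} (hg : DirAt g a) (h : f =ᶠ[𝓝 a] g) :
    DirAt f a := by
  obtain ⟨l, hl, hm, ht⟩ := hg
  refine ⟨l, hl, hm, fun u hu => ?_⟩
  rw [h.eq_of_nhds]
  exact (ht u hu).congr' ((h.filter_mono (approach_le_nhds a u)).mono fun x hx => hx.symm)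

/-- Criterion in terms of a positively homogeneous directional derivative. -/
theorem dirAt_of_tendsto {g L : Plane → Plane} {a : Plane} (hg : ContinuousAt g a)
    (hL : ∀ s : ℝ, 0 < s → ∀ v, L (s • v) = s • L v) (hinj : Function.Injective L)
    (hlim : ∀ u ∈ Metric.sphere (0 : Plane) 1,
      Tendsto (fun z => ‖z - a‖⁻¹ • (g z - g a)) (approach a u) (𝓝 (L u))) :
    DirAt g a := by
  have hL0 : L 0 = 0 := by
    have := hL 2 two_pos 0
    rw [smul_zero, two_smul] at this
    simpa using this
  have hne : ∀ u ∈ Metric.sphere (0 : Plane) 1, L u ≠ 0 := by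
    intro u hu h
    have : u = 0 := hinj (h.trans hL0.symm)
    simp [this] at hu
  refine ⟨fun u => dir (L u), ?_, ?_, ?_⟩
  · intro u hu v hv h
    have hu' := norm_pos_iff.2 (hne u hu)
    have hv' := norm_pos_iff.2 (hne v hv)
    have h1 : L (‖L v‖ • u) = L (‖L u‖ • v) := by
      rw [hL _ hv', hL _ hu']
      calc ‖L v‖ • L u = ‖L v‖ • ‖L u‖ • dir (L u) := by rw [norm_smul_dir]
        _ = ‖L u‖ • ‖L v‖ • dir (L v) := by rw [show dir (L u) = dir (L v) from h, smul_comm]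
        _ = ‖L u‖ • L v := by rw [norm_smul_dir]
    have h2 := hinj h1
    have h3 : ‖L v‖ = ‖L u‖ := by
      have := congrArg norm h2
      rwa [norm_smul, norm_smul, norm_norm, norm_norm, mem_sphere_zero_iff_norm.1 hu,
        mem_sphere_zero_iff_norm.1 hv, mul_one, mul_one] at this
    rw [h3] at h2
    exact smul_right_injective Plane hu'.ne' h2
  · intro u hu
    exact mem_sphere_zero_iff_norm.2 (norm_dir (hne u hu))
  · intro u hu
    refine tendsto_approach.2 ⟨hg.mono_left (approach_le_nhds a u), ?_, ?_⟩
    · filter_upwards [(hlim u hu).eventually_ne (hne u hu)] with z hz h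
      rw [h, sub_self, smul_zero] at hz
      exact hz rfl
    · refine ((continuousAt_dir (hne u hu)).tendsto.comp (hlim u hu)).congr' ?_
      filter_upwards [eventually_ne_approach a u] with z hz
      exact dir_smul (inv_pos.2 (norm_pos_iff.2 (sub_ne_zero.2 hz))) _

theorem dirAt_of_hasFDerivAt {g : Plane → Plane} {L : Plane →L[ℝ] Plane} {a : Plane}
    (hg : HasFDerivAt g L a) (hL : Function.Injective L) : DirAt g a := by
  refine dirAt_of_tendsto hg.continuousAt (L := L) (fun s _ v => map_smul L s v) hL fun u _ => ?_
  have h1 : Tendsto (fun z => ‖z - a‖⁻¹ • (g z - g a - L (z - a))) (approach a u) (𝓝 0) := by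
    have := (hasFDerivAt_iff_tendsto.1 hg).mono_left (approach_le_nhds a u)
    rw [tendsto_zero_iff_norm_tendsto_zero]
    simpa [norm_smul] using this
  have h2 := (L.continuous.tendsto u).comp (tendsto_dir_approach a u)
  have h3 := h1.add h2
  rw [zero_add] at h3
  refine h3.congr fun z => ?_
  simp [dir, smul_sub]

theorem abs_add_eventually {x : ℝ} (hx : x ≠ 0) :
    ∀ᶠ v : ℝ in 𝓝 0, |x + v| = |x| + SignType.sign x * v := by
  rcases lt_or_gt_of_ne hx with h | h
  · filter_upwards [gt_mem_nhds (neg_pos.2 h)] with v hv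
    rw [abs_of_neg h, abs_of_neg (by linarith), sign_neg h]
    simp
    ring
  · filter_upwards [lt_mem_nhds (neg_lt_zero.2 h)] with v hv
    rw [abs_of_pos h, abs_of_pos (by linarith), sign_pos h]
    simp

theorem sign_mul_self_eq (x : ℝ) : (SignType.sign x : ℝ) * x = |x| := by
  rw [mul_comm]; exact self_mul_sign x

/-- One-sided directional derivative of the maximum norm. -/
theorem exists_norm_derivative {a : Plane} (ha : a ≠ 0) :
    ∃ N : Plane → ℝ, Continuous N ∧ (∀ s : ℝ, 0 < s → ∀ v, N (s • v) = s * N v) ∧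
      (∀ v (m : ℝ), N (v + m • a) = N v + m * ‖a‖) ∧
      ∀ᶠ v in 𝓝 (0 : Plane), ‖a + v‖ = ‖a‖ + N v := by
  obtain ⟨x, y⟩ := a
  have f1 : Tendsto (fun v : Plane => v.1) (𝓝 0) (𝓝 0) := continuous_fst.tendsto' _ _ rfl
  have f2 : Tendsto (fun v : Plane => v.2) (𝓝 0) (𝓝 0) := continuous_snd.tendsto' _ _ rfl
  have hn : ‖((x, y) : Plane)‖ = max |x| |y| := rfl
  rcases lt_trichotomy |x| |y| with h | h | h
  · have hy : y ≠ 0 := abs_pos.1 ((abs_nonneg x).trans_lt h)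
    refine ⟨fun v => SignType.sign y * v.2, by fun_prop, fun s _ v => ?_, fun v m => ?_, ?_⟩
    · simp; ring
    · rw [hn, max_eq_right h.le, ← sign_mul_self_eq]
      simp only [Prod.snd_add, Prod.smul_snd, smul_eq_mul]
      ring
    · have hlt : ∀ᶠ v : Plane in 𝓝 0, |x + v.1| < |y + v.2| := by
        refine Tendsto.eventually_lt (y := |x|) (z := |y|) ?_ ?_ h
        · simpa using (f1.const_add x).abs
        · simpa using (f2.const_add y).abs
      filter_upwards [f2.eventually (abs_add_eventually hy), hlt] with v hv hl
      rw [hn, max_eq_right h.le, ← hv]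
      exact max_eq_right hl.le
  · have hx : x ≠ 0 := by
      rintro rfl
      rw [abs_zero] at h
      exact ha (Prod.ext rfl (abs_eq_zero.1 h.symm))
    have hy : y ≠ 0 := abs_pos.1 (h ▸ abs_pos.2 hx)
    refine ⟨fun v => max (SignType.sign x * v.1) (SignType.sign y * v.2), by fun_prop,
      fun s hs v => ?_, fun v m => ?_, ?_⟩
    · rw [mul_max_of_nonneg _ _ hs.le]
      simp only [Prod.smul_fst, Prod.smul_snd, smul_eq_mul]
      congr 1 <;> ring
    · rw [hn, ← h, max_self, ← max_add_add_right]
      nth_rewrite 2 [h]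
      rw [← sign_mul_self_eq, ← sign_mul_self_eq]
      simp only [Prod.smul_fst, Prod.smul_snd, smul_eq_mul, Prod.fst_add, Prod.snd_add]
      congr 1 <;> ring
    · filter_upwards [f1.eventually (abs_add_eventually hx),
        f2.eventually (abs_add_eventually hy)] with v h1 h2
      have : ‖((x, y) : Plane) + v‖ = max |x + v.1| |y + v.2| := rfl
      rw [this, hn, h1, h2, h, max_self, max_add_add_left]
  · have hx : x ≠ 0 := abs_pos.1 ((abs_nonneg y).trans_lt h)
    refine ⟨fun v => SignType.sign x * v.1, by fun_prop, fun s _ v => ?_, fun v m => ?_, ?_⟩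
    · simp; ring
    · rw [hn, max_eq_left h.le, ← sign_mul_self_eq]
      simp only [Prod.fst_add, Prod.smul_fst, smul_eq_mul]
      ring
    · have hlt : ∀ᶠ v : Plane in 𝓝 0, |y + v.2| < |x + v.1| := by
        refine Tendsto.eventually_lt (y := |y|) (z := |x|) ?_ ?_ h
        · simpa using (f2.const_add y).abs
        · simpa using (f1.const_add x).abs
      filter_upwards [f1.eventually (abs_add_eventually hx), hlt] with v hv hl
      rw [hn, max_eq_left h.le, ← hv]
      exact max_eq_left hl.le

/-- Radial maps act injectively on the directions at points where the radial profile
`t ↦ t * k t` is nondegenerate. -/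
theorem dirAt_radial {k : ℝ → ℝ} {k' : ℝ} {a : Plane} (ha : a ≠ 0) (hk : HasDerivAt k k' ‖a‖)
    (h0 : k ‖a‖ ≠ 0) (h1 : k ‖a‖ + k' * ‖a‖ ≠ 0) : DirAt (fun z => k ‖z‖ • z) a := by
  obtain ⟨N, hNc, hNs, hNa, hN⟩ := exists_norm_derivative ha
  have hkc : ContinuousAt (fun z : Plane => k ‖z‖) a :=
    ContinuousAt.comp (f := fun z : Plane => ‖z‖) hk.continuousAt continuous_norm.continuousAt
  refine dirAt_of_tendsto (L := fun v => k ‖a‖ • v + (k' * N v) • a) (hkc.smul continuousAt_id)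
    ?_ ?_ ?_
  · intro s hs v
    simp only [hNs s hs, smul_add, smul_smul]
    congr 2 <;> ring
  · intro v w hvw
    simp only at hvw
    have e1 : v = w + (-(k' * (N v - N w) / k ‖a‖)) • a := by
      have : k ‖a‖ • v = k ‖a‖ • (w + (-(k' * (N v - N w) / k ‖a‖)) • a) := by
        rw [smul_add, smul_smul, eq_sub_of_add_eq hvw, add_sub_assoc, ← sub_smul]
        congr 2
        field_simp
        ring
      exact smul_right_injective Plane h0 this
    set m := -(k' * (N v - N w) / k ‖a‖) with hm
    have e2 : N v - N w = m * ‖a‖ := by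
      have := hNa w m
      rw [← e1] at this
      linarith
    rw [e2] at hm
    have e3 : m * (k ‖a‖ + k' * ‖a‖) = 0 := by
      field_simp at hm
      linarith
    have e4 : m = 0 := (mul_eq_zero.1 e3).resolve_right h1
    rw [e4, zero_smul, add_zero] at e1
    exact e1
  · intro u _
    have hsub : Tendsto (fun z => z - a) (approach a u) (𝓝 0) := by
      have : Tendsto (fun z => z - a) (𝓝 a) (𝓝 (a - a)) := (continuous_sub_right a).tendsto a
      rw [sub_self] at this
      exact this.mono_left (approach_le_nhds a u)
    have hq : Tendsto (fun z => ‖z - a‖⁻¹ * (‖z‖ - ‖a‖)) (approach a u) (𝓝 (N u)) := by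
      refine ((hNc.tendsto u).comp (tendsto_dir_approach a u)).congr' ?_
      filter_upwards [hsub.eventually hN, eventually_ne_approach a u] with z hz hza
      rw [Function.comp_apply, dir, hNs _ (inv_pos.2 (norm_pos_iff.2 (sub_ne_zero.2 hza))),
        eq_sub_of_add_eq' hz.symm, add_sub_cancel]
    have hlo : Tendsto (fun z : Plane => ‖z - a‖⁻¹ * (k ‖z‖ - k ‖a‖ - k' * (‖z‖ - ‖a‖)))
        (approach a u) (𝓝 0) := by
      have h3 : (fun z : Plane => k ‖z‖ - k ‖a‖ - (‖z‖ - ‖a‖) * k') =o[𝓝 a]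
          fun z => ‖z‖ - ‖a‖ :=
        (hasDerivAt_iff_isLittleO.1 hk).comp_tendsto (continuous_norm.tendsto a)
      have h4 : (fun z : Plane => ‖z‖ - ‖a‖) =O[𝓝 a] fun z => z - a :=
        Asymptotics.isBigO_of_le _ fun z => by
          rw [Real.norm_eq_abs]; exact abs_norm_sub_norm_le z a
      have h5 := (h3.trans_isBigO h4).norm_right.tendsto_div_nhds_zero
      refine (h5.mono_left (approach_le_nhds a u)).congr fun z => ?_
      rw [div_eq_inv_mul, mul_comm k']
    have hk2 : Tendsto (fun z : Plane => k ‖z‖) (approach a u) (𝓝 (k ‖a‖)) :=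
      hkc.tendsto.mono_left (approach_le_nhds a u)
    have hs := hlo.add (hq.const_mul k')
    rw [zero_add] at hs
    have hfin := (hk2.smul (tendsto_dir_approach a u)).add (hs.smul_const a)
    refine hfin.congr fun z => ?_
    simp only [dir, smul_smul]
    ext <;> simp <;> ring

/-- The centre of the unit square. -/
noncomputable def centre : Plane := (1 / 2, 1 / 2)

/-- Radial profile of the map shrinking the central hole to a point. -/
noncomputable def profile (t : ℝ) : ℝ := max 0 (min t (3 / 2 * t - 1 / 4))

theorem profile_nonneg (t : ℝ) : 0 ≤ profile t := le_max_left _ _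

theorem profile_le {t : ℝ} (ht : 0 ≤ t) : profile t ≤ t := max_le ht (min_le_left _ _)

theorem profile_sub_le {s t : ℝ} (h : s ≤ t) : profile t - profile s ≤ 3 / 2 * (t - s) := by
  simp only [profile, max_def, min_def]
  split_ifs <;> linarith

theorem profile_mul_le {s t : ℝ} (hs : 0 < s) (h : s ≤ t) : profile s * t ≤ profile t * s := by
  simp only [profile, max_def, min_def]
  split_ifs <;> nlinarith

theorem profile_of_le {t : ℝ} (h : t ≤ 1 / 6) : profile t = 0 :=
  max_eq_left ((min_le_right _ _).trans (by linarith))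

theorem profile_of_ge {t : ℝ} (h : 1 / 2 ≤ t) : profile t = t := by
  rw [profile, min_eq_left (by linarith), max_eq_right (by linarith)]

theorem profile_of_mem {t : ℝ} (h : t ∈ Icc (1 / 6 : ℝ) (1 / 2)) :
    profile t = 3 / 2 * t - 1 / 4 := by
  obtain ⟨h1, h2⟩ := h
  rw [profile, min_eq_right (by linarith), max_eq_right (by linarith)]

theorem profile_pos {t : ℝ} (h : 1 / 6 < t) : 0 < profile t := by
  rcases le_total t (1 / 2) with h' | h'
  · rw [profile_of_mem ⟨h.le, h'⟩]; linarith
  · rw [profile_of_ge h']; linarith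

theorem le_profile (t : ℝ) : t - 1 / 6 ≤ profile t := by
  rcases le_total t (1 / 6) with h | h
  · rw [profile_of_le h]; linarith
  rcases le_total t (1 / 2) with h' | h'
  · rw [profile_of_mem ⟨h, h'⟩]; linarith
  · rw [profile_of_ge h']; linarith

theorem profile_injOn {s t : ℝ} (h : profile s = profile t) (hs : 1 / 6 < s) : s = t := by
  have ht : 1 / 6 < t := by
    by_contra! h'
    rw [profile_of_le h'] at h
    exact (profile_pos hs).ne' h
  rcases le_total s (1 / 2) with h1 | h1 <;> rcases le_total t (1 / 2) with h2 | h2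
  · rw [profile_of_mem ⟨hs.le, h1⟩, profile_of_mem ⟨ht.le, h2⟩] at h; linarith
  · rw [profile_of_mem ⟨hs.le, h1⟩, profile_of_ge h2] at h; linarith
  · rw [profile_of_ge h1, profile_of_mem ⟨ht.le, h2⟩] at h; linarith
  · rwa [profile_of_ge h1, profile_of_ge h2] at h

/-- The radial map collapsing the ball of radius `1/6` and fixing all points of norm at least
`1/2`. -/
noncomputable def shrink (y : Plane) : Plane := (profile ‖y‖ / ‖y‖) • y

theorem norm_shrink (y : Plane) : ‖shrink y‖ = profile ‖y‖ := by
  rcases eq_or_ne y 0 with rfl | hy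
  · simp [shrink, profile]
  · have := norm_ne_zero_iff.2 hy
    rw [shrink, norm_smul, Real.norm_of_nonneg (div_nonneg (profile_nonneg _) (norm_nonneg _)),
      div_mul_cancel₀ _ this]

theorem shrink_of_le {y : Plane} (h : ‖y‖ ≤ 1 / 6) : shrink y = 0 := by
  rw [← norm_eq_zero, norm_shrink, profile_of_le h]

theorem shrink_of_ge {y : Plane} (h : 1 / 2 ≤ ‖y‖) : shrink y = y := by
  rw [shrink, profile_of_ge h, div_self (by linarith), one_smul]

theorem dir_shrink {y : Plane} (h : 1 / 6 < ‖y‖) : dir (shrink y) = dir y :=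
  dir_smul (div_pos (profile_pos h) (by linarith)) y

theorem norm_le_of_shrink_eq_zero {y : Plane} (h : shrink y = 0) : ‖y‖ ≤ 1 / 6 := by
  by_contra! h'
  have := norm_shrink y
  rw [h, norm_zero] at this
  exact (profile_pos h').ne this

theorem eq_of_shrink_eq {y z : Plane} (h : shrink y = shrink z) (hy : 1 / 6 < ‖y‖) : y = z := by
  have hn : ‖y‖ = ‖z‖ := profile_injOn (by rw [← norm_shrink, ← norm_shrink, h]) hy
  have hz : 1 / 6 < ‖z‖ := hn ▸ hy
  rw [← norm_smul_dir y, ← norm_smul_dir z, ← dir_shrink hy, ← dir_shrink hz, h, hn]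

theorem norm_sub_shrink_le (y : Plane) : ‖shrink y - y‖ ≤ 1 / 6 := by
  rcases eq_or_ne y 0 with rfl | hy
  · simp [shrink]
  have h0 := norm_pos_iff.2 hy
  have : shrink y - y = (profile ‖y‖ / ‖y‖ - 1) • y := by rw [shrink, sub_smul, one_smul]
  rw [this, norm_smul, Real.norm_eq_abs, ← abs_of_pos h0, ← abs_mul, abs_of_pos h0, sub_mul,
    div_mul_cancel₀ _ h0.ne', one_mul, abs_le]
  constructor <;> linarith [le_profile ‖y‖, profile_le h0.le]

theorem dist_shrink_aux {y z : Plane} (h : ‖z‖ ≤ ‖y‖) :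
    dist (shrink y) (shrink z) ≤ 3 / 2 * dist y z := by
  rw [dist_eq_norm, dist_eq_norm]
  rcases eq_or_ne z 0 with rfl | hz
  · rw [shrink_of_le (y := 0) (by simp), sub_zero, sub_zero, norm_shrink]
    linarith [profile_le (norm_nonneg y), norm_nonneg y]
  have hz0 := norm_pos_iff.2 hz
  have hy0 := hz0.trans_le h
  have e : shrink y - shrink z = (profile ‖z‖ / ‖z‖) • (y - z) +
      (profile ‖y‖ / ‖y‖ - profile ‖z‖ / ‖z‖) • y := by
    simp only [shrink]
    module
  have k0 : 0 ≤ profile ‖z‖ / ‖z‖ := div_nonneg (profile_nonneg _) hz0.le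
  have k1 : profile ‖z‖ / ‖z‖ ≤ 1 := div_le_one_of_le₀ (profile_le hz0.le) hz0.le
  have k2 : 0 ≤ profile ‖y‖ / ‖y‖ - profile ‖z‖ / ‖z‖ := by
    rw [sub_nonneg, div_le_div_iff₀ hz0 hy0]
    exact profile_mul_le hz0 h
  have k3 : (profile ‖y‖ / ‖y‖ - profile ‖z‖ / ‖z‖) * ‖y‖ =
      profile ‖y‖ - profile ‖z‖ - profile ‖z‖ / ‖z‖ * (‖y‖ - ‖z‖) := by
    field_simp
    ring
  have k4 := norm_sub_norm_le y z
  rw [e]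
  refine (norm_add_le _ _).trans ?_
  rw [norm_smul, norm_smul, Real.norm_of_nonneg k0, Real.norm_of_nonneg k2, k3]
  nlinarith [profile_sub_le h]

theorem dist_shrink_le (y z : Plane) : dist (shrink y) (shrink z) ≤ 3 / 2 * dist y z := by
  rcases le_total ‖z‖ ‖y‖ with h | h
  · exact dist_shrink_aux h
  · rw [dist_comm, dist_comm y]
    exact dist_shrink_aux h

theorem exists_shrink_eq {z : Plane} (hz : ‖z‖ ≤ 1 / 2) :
    ∃ y, ‖y‖ ∈ Icc (1 / 6 : ℝ) (1 / 2) ∧ shrink y = z := by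
  rcases eq_or_ne z 0 with rfl | h0
  · refine ⟨(1 / 6, 1 / 6), ?_, ?_⟩
    · norm_num [Prod.norm_def]
    · exact shrink_of_le (by norm_num [Prod.norm_def])
  · have hz0 := norm_pos_iff.2 h0
    have hn : ‖((2 / 3 * ‖z‖ + 1 / 6) / ‖z‖) • z‖ = 2 / 3 * ‖z‖ + 1 / 6 := by
      rw [norm_smul, Real.norm_of_nonneg (by positivity), div_mul_cancel₀ _ hz0.ne']
    refine ⟨((2 / 3 * ‖z‖ + 1 / 6) / ‖z‖) • z, ?_, ?_⟩
    · rw [hn]; constructor <;> linarith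
    · rw [shrink, hn, profile_of_mem (by constructor <;> linarith), smul_smul]
      have : (3 / 2 * (2 / 3 * ‖z‖ + 1 / 6) - 1 / 4) / (2 / 3 * ‖z‖ + 1 / 6) *
          ((2 / 3 * ‖z‖ + 1 / 6) / ‖z‖) = 1 := by
        have : (2 / 3 * ‖z‖ + 1 / 6) ≠ 0 := by positivity
        field_simp
        ring
      rw [this, one_smul]

theorem dirAt_shrink {a : Plane} (h : ‖a‖ ∈ Ioo (1 / 6 : ℝ) (1 / 2)) : DirAt shrink a := by
  have ha : a ≠ 0 := by
    rintro rfl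
    rw [norm_zero] at h
    linarith [h.1]
  have h0 : 0 < ‖a‖ := norm_pos_iff.2 ha
  have hk : HasDerivAt (fun t : ℝ => 3 / 2 - (1 / 4) * t⁻¹) (-((1 / 4) * -(‖a‖ ^ 2)⁻¹)) ‖a‖ :=
    ((hasDerivAt_inv h0.ne').const_mul (1 / 4)).const_sub (3 / 2)
  refine (dirAt_radial ha hk ?_ ?_).congr ?_
  · have := h.1
    intro h'
    field_simp at h'
    linarith
  · field_simp
    norm_num
    exact ha
  · filter_upwards [(continuous_norm.tendsto a).eventually (Ioo_mem_nhds h.1 h.2)] with z hz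
    have : ‖z‖ ≠ 0 := by linarith [hz.1]
    rw [shrink, profile_of_mem ⟨hz.1.le, hz.2.le⟩]
    congr 1
    field_simp

/-- The map of the unit square collapsing the central hole. -/
noncomputable def punch (z : Plane) : Plane := centre + shrink (z - centre)

theorem norm_sub_centre_lt {z : Plane} : ‖z - centre‖ < 1 / 2 ↔ z ∈ openSquare := by
  simp only [Prod.norm_def, openSquare, mem_prod, mem_Ioo, max_lt_iff, centre, Prod.fst_sub,
    Prod.snd_sub, Real.norm_eq_abs, abs_lt]
  constructor
  · rintro ⟨⟨h1, h2⟩, h3, h4⟩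
    refine ⟨⟨?_, ?_⟩, ?_, ?_⟩ <;> linarith
  · rintro ⟨⟨h1, h2⟩, h3, h4⟩
    refine ⟨⟨?_, ?_⟩, ?_, ?_⟩ <;> linarith

theorem norm_sub_centre_le {z : Plane} : ‖z - centre‖ ≤ 1 / 2 ↔ z ∈ unitSquare := by
  simp only [Prod.norm_def, unitSquare, mem_prod, mem_Icc, max_le_iff, centre, Prod.fst_sub,
    Prod.snd_sub, Real.norm_eq_abs, abs_le]
  constructor
  · rintro ⟨⟨h1, h2⟩, h3, h4⟩
    refine ⟨⟨?_, ?_⟩, ?_, ?_⟩ <;> linarith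
  · rintro ⟨⟨h1, h2⟩, h3, h4⟩
    refine ⟨⟨?_, ?_⟩, ?_, ?_⟩ <;> linarith

theorem centre_mem : centre ∈ openSquare := norm_sub_centre_lt.1 (by simp)

theorem dist_punch_le (y z : Plane) : dist (punch y) (punch z) ≤ 3 / 2 * dist y z := by
  have := dist_shrink_le (y - centre) (z - centre)
  rw [dist_sub_right] at this
  rw [punch, punch, dist_add_left]
  exact this

theorem continuous_punch : Continuous punch :=
  (LipschitzWith.of_dist_le_mul (K := 3 / 2) fun y z => by
    simpa using dist_punch_le y z).continuous

theorem punch_of_notMem {z : Plane} (h : z ∉ openSquare) : punch z = z := by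
  rw [← norm_sub_centre_lt, not_lt] at h
  rw [punch, shrink_of_ge h, add_sub_cancel]

theorem punch_of_le {z : Plane} (h : ‖z - centre‖ ≤ 1 / 6) : punch z = centre := by
  rw [punch, shrink_of_le h, add_zero]

theorem norm_punch_sub (z : Plane) : ‖punch z - centre‖ = profile ‖z - centre‖ := by
  rw [punch, add_sub_cancel_left, norm_shrink]

theorem punch_mem_openSquare {z : Plane} (h : z ∈ openSquare) : punch z ∈ openSquare := by
  rw [← norm_sub_centre_lt] at h ⊢
  rw [norm_punch_sub]
  exact (profile_le (norm_nonneg _)).trans_lt h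

theorem punch_mem_unitSquare {z : Plane} (h : z ∈ unitSquare) : punch z ∈ unitSquare := by
  rw [← norm_sub_centre_le] at h ⊢
  rw [norm_punch_sub]
  exact (profile_le (norm_nonneg _)).trans h

theorem eq_of_punch_eq {y z : Plane} (h : punch y = punch z) (hy : 1 / 6 < ‖y - centre‖) :
    y = z :=
  sub_left_injective (eq_of_shrink_eq (add_right_injective _ h) hy)

theorem norm_le_of_punch_eq {z : Plane} (h : punch z = centre) : ‖z - centre‖ ≤ 1 / 6 :=
  norm_le_of_shrink_eq_zero (by simpa [punch] using h)

/-- The inverse of `tile d`. -/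
noncomputable def untile (d : Digit) (x : Plane) : Plane :=
  (3 * x.1 - d.1.1, 3 * x.2 - d.1.2)

theorem untile_tile (d : Digit) (q : Plane) : untile d (tile d q) = q := by
  ext <;> simp [untile, tile] <;> ring

theorem tile_untile (d : Digit) (x : Plane) : tile d (untile d x) = x := by
  ext <;> simp [untile, tile]

theorem continuous_untile (d : Digit) : Continuous (untile d) := by
  unfold untile; fun_prop

theorem fin_eq_of_cast_lt {i j : Fin 3} {s : ℝ} (hs : s ∈ Icc (0 : ℝ) 1)
    (h : s + ((i : ℕ) : ℝ) - ((j : ℕ) : ℝ) ∈ Ioo (0 : ℝ) 1) : i = j := by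
  obtain ⟨h1, h2⟩ := hs
  obtain ⟨h3, h4⟩ := h
  have a : ((i : ℕ) : ℝ) < ((j : ℕ) : ℝ) + 1 := by linarith
  have b : ((j : ℕ) : ℝ) < ((i : ℕ) : ℝ) + 1 := by linarith
  norm_cast at a b
  ext
  omega

theorem untile_tile_notMem {d e : Digit} (h : d ≠ e) {q : Plane} (hq : q ∈ unitSquare) :
    untile e (tile d q) ∉ openSquare := by
  rintro ⟨h1, h2⟩
  refine h (Subtype.ext (Prod.ext (fin_eq_of_cast_lt hq.1 ?_) (fin_eq_of_cast_lt hq.2 ?_)))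
  · convert h1 using 1; simp [untile, tile]; ring
  · convert h2 using 1; simp [untile, tile]; ring

/-- The points at distance at most `1/6` from the centre, i.e. the closed central hole. -/
theorem untile_notMem_of_hole {x : Plane} (hx : ‖x - centre‖ ≤ 1 / 6) (d : Digit) :
    untile d x ∉ openSquare := by
  rintro ⟨h1, h2⟩
  simp only [Prod.norm_def, max_le_iff, centre, Prod.fst_sub, Prod.snd_sub, Real.norm_eq_abs,
    abs_le] at hx
  obtain ⟨⟨a1, a2⟩, a3, a4⟩ := hx
  refine d.2 (Prod.ext
    (fin_eq_of_cast_lt (i := 1) (j := d.1.1) (s := 3 * x.1 - 1) ?_ ?_).symm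
    (fin_eq_of_cast_lt (i := 1) (j := d.1.2) (s := 3 * x.2 - 1) ?_ ?_).symm)
  · constructor <;> linarith
  · simpa [untile] using h1
  · constructor <;> linarith
  · simpa [untile] using h2

/-- The defining properties of the map collapsing all holes of the carpet. -/
structure IsCollapse (ψ ψ₁ : Plane → Plane) : Prop where
  cont : Continuous ψ
  cont₁ : Continuous ψ₁
  eq_punch : ∀ x, ψ x = punch (ψ₁ x)
  eq_self : ∀ x, x ∉ openSquare → ψ x = x
  mapsTo : MapsTo ψ unitSquare unitSquare
  apply_tile : ∀ d, ∀ q ∈ unitSquare, ψ₁ (tile d q) = tile d (ψ q)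
  eq_of_hole : ∀ x, ‖x - centre‖ ≤ 1 / 6 → ψ₁ x = x

section FixedPoint

variable {V : Type*} [AddCommMonoid V]

/-- Sum of the rescaled copies of `η`. -/
noncomputable def copies (η : Plane → V) (x : Plane) : V := ∑ d : Digit, η (untile d x)

theorem copies_tile {η : Plane → V} (hη : ∀ x, x ∉ openSquare → η x = 0) (d : Digit) {q : Plane}
    (hq : q ∈ unitSquare) : copies η (tile d q) = η q := by
  rw [copies, Finset.sum_eq_single d]
  · rw [untile_tile]
  · intro e _ he
    exact hη _ (untile_tile_notMem he.symm hq)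
  · simp

theorem copies_eq_zero {η : Plane → V} (hη : ∀ x, x ∉ openSquare → η x = 0) {x : Plane}
    (hx : ∀ d, untile d x ∉ openSquare) : copies η x = 0 :=
  Finset.sum_eq_zero fun d _ => hη _ (hx d)

theorem copies_cases {η : Plane → V} (hη : ∀ x, x ∉ openSquare → η x = 0) (x : Plane) :
    (∃ d, ∃ q ∈ openSquare, x = tile d q ∧ copies η x = η q) ∨
      ((∀ d, untile d x ∉ openSquare) ∧ copies η x = 0) := by
  by_cases h : ∀ d, untile d x ∉ openSquare
  · exact Or.inr ⟨h, copies_eq_zero hη h⟩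
  · push Not at h
    obtain ⟨d, hd⟩ := h
    refine Or.inl ⟨d, _, hd, (tile_untile d x).symm, ?_⟩
    conv_lhs => rw [← tile_untile d x]
    exact copies_tile hη d (openSquare_subset hd)

end FixedPoint

theorem exists_isCollapse : ∃ ψ ψ₁, IsCollapse ψ ψ₁ := by
  let pre (η : Plane → Plane) (x : Plane) : Plane := x + (3⁻¹ : ℝ) • copies η x
  have pre_tile : ∀ η : Plane → Plane, (∀ x, x ∉ openSquare → η x = 0) → ∀ d, ∀ q ∈ unitSquare,
      pre η (tile d q) = tile d (q + η q) := by
    intro η hη d q hq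
    simp only [pre, copies_tile hη d hq]
    ext <;> simp [tile] <;> ring
  have pre_cont : ∀ η : Plane → Plane, Continuous η → Continuous (pre η) := by
    intro η hη
    simp only [pre, copies]
    have := continuous_untile
    fun_prop
  let E := BoundedContinuousFunction Plane Plane
  have bd : ∀ η : E, ∀ x, ‖punch (pre η x) - x‖ ≤ 1 / 6 + 3 / 2 * (1 / 3 * (8 * ‖η‖)) := by
    intro η x
    have h1 : ‖punch x - x‖ ≤ 1 / 6 := by
      have := norm_sub_shrink_le (x - centre)
      rwa [show shrink (x - centre) - (x - centre) = punch x - x by rw [punch]; abel] at this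
    have h2 := dist_punch_le (pre η x) x
    have h3 : dist (pre η x) x ≤ 1 / 3 * (8 * ‖η‖) := by
      rw [dist_eq_norm, show pre η x - x = (3⁻¹ : ℝ) • copies η x by simp [pre], norm_smul]
      have : ‖copies η x‖ ≤ 8 * ‖η‖ := by
        refine (norm_sum_le _ _).trans ?_
        refine (Finset.sum_le_card_nsmul _ _ ‖η‖ fun d _ => η.norm_coe_le_norm _).trans ?_
        rw [nsmul_eq_mul]
        have : (Finset.univ : Finset Digit).card = 8 := by decide
        rw [this]
        norm_num
      norm_num
      linarith
    rw [dist_eq_norm] at h2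
    calc ‖punch (pre η x) - x‖ = ‖(punch (pre η x) - punch x) + (punch x - x)‖ := by
          rw [sub_add_sub_cancel]
      _ ≤ _ := norm_add_le _ _
      _ ≤ _ := by linarith
  let Φ : E → E := fun η => BoundedContinuousFunction.ofNormedAddCommGroup
    (fun x => punch (pre η x) - x)
    ((continuous_punch.comp (pre_cont η η.continuous)).sub continuous_id) _ (bd η)
  have Φ_apply : ∀ η x, Φ η x = punch (pre η x) - x := fun η x => rfl
  let K : Set E := {η | ∀ x, (x ∉ openSquare → η x = 0) ∧ (x ∈ unitSquare → x + η x ∈ unitSquare)}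
  have hKc : IsClosed K := by
    have : K = ⋂ x, ({η | x ∉ openSquare → η x = 0} ∩
        {η | x ∈ unitSquare → x + η x ∈ unitSquare}) := by
      ext η; simp [K]
    rw [this]
    refine isClosed_iInter fun x => IsClosed.inter ?_ ?_
    · by_cases h : x ∈ openSquare
      · simp [h]
      · simp only [h, not_false_eq_true, true_imp_iff]
        exact isClosed_eq (continuous_eval_const x) continuous_const
    · by_cases h : x ∈ unitSquare
      · simp only [h, true_imp_iff]
        exact isCompact_unitSquare.isClosed.preimage
          (continuous_const.add (continuous_eval_const x))
      · simp [h]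
  have hmaps : MapsTo Φ K K := by
    intro η hη x
    have h0 := fun x => (hη x).1
    rw [Φ_apply]
    rcases copies_cases h0 x with ⟨d, q, hq, rfl, -⟩ | ⟨-, hz⟩
    · have ho := openSquare_subset hq
      refine ⟨fun h => absurd (tile_mem_openSquare d hq) h, fun _ => ?_⟩
      rw [add_sub_cancel, pre_tile η h0 d q ho]
      exact punch_mem_unitSquare (tile_mem_unitSquare d ((hη q).2 ho))
    · have : pre η x = x := by simp only [pre, hz, smul_zero, add_zero]
      rw [this]
      refine ⟨fun h => by rw [punch_of_notMem h, sub_self], fun h => ?_⟩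
      rw [add_sub_cancel]
      exact punch_mem_unitSquare h
  have hcontr : ContractingWith (1 / 2) (hmaps.restrict Φ K K) := by
    refine ⟨by rw [← NNReal.coe_lt_coe]; norm_num, LipschitzWith.of_dist_le_mul ?_⟩
    rintro ⟨η, hη⟩ ⟨θ, hθ⟩
    change dist (Φ η) (Φ θ) ≤ ((1 / 2 : NNReal) : ℝ) * dist η θ
    refine (BoundedContinuousFunction.dist_le (by positivity)).2 fun x => ?_
    rw [Φ_apply, Φ_apply, dist_sub_right]
    refine (dist_punch_le _ _).trans ?_
    have : dist (pre η x) (pre θ x) ≤ 1 / 3 * dist η θ := by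
      simp only [pre, dist_add_left, dist_smul₀]
      norm_num
      rcases copies_cases (fun x => (hη x).1) x with ⟨d, q, hq, rfl, hc⟩ | ⟨hx, hz⟩
      · rw [hc, copies_tile (fun x => (hθ x).1) d (openSquare_subset hq)]
        exact BoundedContinuousFunction.dist_coe_le_dist q
      · rw [hz, copies_eq_zero (fun x => (hθ x).1) hx, dist_self]
        exact dist_nonneg
    norm_num
    linarith
  have h0K : (0 : E) ∈ K := fun x =>
    ⟨fun _ => rfl, fun h => by simpa [show (0 : E) x = 0 from rfl] using h⟩
  obtain ⟨η, hηK, hfix, -⟩ := hcontr.exists_fixedPoint' hKc.isComplete hmaps h0K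
    (edist_ne_top _ _)
  have h0 := fun x => (hηK x).1
  refine ⟨fun x => x + η x, pre η, continuous_id.add η.continuous, pre_cont η η.continuous,
    fun x => ?_, fun x hx => by rw [h0 x hx, add_zero], fun x hx => (hηK x).2 hx,
    fun d q hq => pre_tile η h0 d q hq, fun x hx => ?_⟩
  · have : Φ η x = η x := by rw [hfix]
    rw [← this, Φ_apply, add_sub_cancel]
  · simp only [pre, copies_eq_zero h0 (untile_notMem_of_hole hx), smul_zero, add_zero]

/-- The closed hole of the carpet with address `w`. -/
noncomputable def hole : List Digit → Set Plane
  | [] => Metric.closedBall centre (1 / 6)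
  | i :: w => image (tile i) (hole w)

/-- The point onto which the hole with address `w` is collapsed. -/
noncomputable def holePoint : List Digit → Plane
  | [] => centre
  | i :: w => punch (tile i (holePoint w))

theorem holePoint_mem (w : List Digit) : holePoint w ∈ openSquare := by
  induction w with
  | nil => exact centre_mem
  | cons i w ih => exact punch_mem_openSquare (tile_mem_openSquare i ih)

theorem hole_subset (w : List Digit) : hole w ⊆ openSquare := by
  induction w with
  | nil =>
    intro x hx
    rw [hole, mem_closedBall_iff_norm] at hx
    exact norm_sub_centre_lt.1 (by linarith)
  | cons i w ih =>
    rintro _ ⟨q, hq, rfl⟩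
    exact tile_mem_openSquare i (ih hq)

theorem tile_outside_hole (i : Digit) {q : Plane} (hq : q ∈ openSquare) :
    1 / 6 < ‖tile i q - centre‖ := by
  by_contra! h
  exact untile_notMem_of_hole h i (by rwa [untile_tile])

theorem tile_eq_tile {d e : Digit} {p q : Plane} (h : tile d p = tile e q) (hp : p ∈ unitSquare)
    (hq : q ∈ openSquare) : d = e ∧ p = q := by
  have hde : d = e := by
    by_contra hne
    refine untile_tile_notMem hne hp ?_
    rwa [h, untile_tile]
  subst hde
  exact ⟨rfl, tile_injective _ h⟩

theorem mem_carpet_of_tile {d : Digit} {q : Plane} (h : tile d q ∈ sierpinskiCarpet)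
    (hq : q ∈ openSquare) : q ∈ sierpinskiCarpet := by
  obtain ⟨e, p, hp, hep⟩ := exists_tile_of_mem_carpet h
  obtain ⟨-, rfl⟩ := tile_eq_tile hep.symm (carpet_subset_unitSquare hp) hq
  exact hp

theorem norm_sub_centre_ge {x : Plane} (hx : x ∈ sierpinskiCarpet) : 1 / 6 ≤ ‖x - centre‖ := by
  obtain ⟨d, q, hq, rfl⟩ := exists_tile_of_mem_carpet hx
  have hq := carpet_subset_unitSquare hq
  by_contra! h
  simp only [Prod.norm_def, max_lt_iff, centre, tile, Prod.fst_sub, Prod.snd_sub,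
    Real.norm_eq_abs, abs_lt] at h
  obtain ⟨⟨a1, a2⟩, a3, a4⟩ := h
  refine d.2 (Prod.ext (fin_eq_of_cast_lt (j := 1) hq.1 ?_) (fin_eq_of_cast_lt (j := 1) hq.2 ?_))
  · constructor <;> simp <;> linarith
  · constructor <;> simp <;> linarith

theorem injOn_punch_tile (i : Digit) : InjOn (fun q => punch (tile i q)) openSquare :=
  fun _ hp _ _ h => tile_injective i (eq_of_punch_eq h (tile_outside_hole i hp))

theorem exists_punch_tile {z : Plane} (hz : z ∈ unitSquare) (hc : z ≠ centre) :
    ∃ i, ∃ q ∈ unitSquare, z = punch (tile i q) := by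
  obtain ⟨y, ⟨hy1, hy2⟩, hyz⟩ := exists_shrink_eq (norm_sub_centre_le.2 hz)
  have hz' : z = punch (y + centre) := by rw [punch, add_sub_cancel_right, hyz, add_sub_cancel]
  have hy : y + centre ∈ unitSquare := norm_sub_centre_le.1 (by rwa [add_sub_cancel_right])
  have hy6 : 1 / 6 < ‖y‖ := by
    by_contra! h
    rw [shrink_of_le h] at hyz
    exact hc (sub_eq_zero.1 hyz.symm)
  obtain ⟨i, s, hs, hsi⟩ := exists_ternary_digit hy.1
  obtain ⟨j, t, ht, htj⟩ := exists_ternary_digit hy.2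
  refine ⟨⟨(i, j), ?_⟩, (s, t), ⟨hs, ht⟩, ?_⟩
  · intro hij
    obtain ⟨rfl, rfl⟩ := Prod.mk.inj hij
    refine hy6.not_ge ?_
    simp only [centre, Prod.fst_add, Prod.snd_add, Fin.val_one, Nat.cast_one] at hsi htj
    simp only [Prod.norm_def, max_le_iff, Real.norm_eq_abs, abs_le]
    refine ⟨⟨?_, ?_⟩, ?_, ?_⟩ <;> linarith [hs.1, hs.2, ht.1, ht.2]
  · rw [hz']
    exact congrArg punch (Prod.ext hsi htj)

theorem dist_punch_tile_le (i : Digit) (p q : Plane) :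
    dist (punch (tile i p)) (punch (tile i q)) ≤ 1 / 2 * dist p q := by
  have := dist_punch_le (tile i p) (tile i q)
  rw [dist_tile] at this
  linarith

theorem dist_le_one {p q : Plane} (hp : p ∈ unitSquare) (hq : q ∈ unitSquare) : dist p q ≤ 1 := by
  rw [← norm_sub_centre_le] at hp hq
  rw [← dist_eq_norm] at hp hq
  linarith [dist_triangle_right p q centre]

/-- A set containing the centre and invariant under the maps `punch ∘ tile i` is dense in the
unit square. -/
theorem unitSquare_subset_closure {B : Set Plane} (hB : B ⊆ unitSquare) (hc : centre ∈ B)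
    (h : ∀ i, ∀ q ∈ B, punch (tile i q) ∈ B) : unitSquare ⊆ closure B := by
  have key : ∀ n : ℕ, ∀ z ∈ unitSquare, ∃ b ∈ B, dist z b ≤ (1 / 2) ^ n := by
    intro n
    induction n with
    | zero => exact fun z hz => ⟨centre, hc, by simpa using dist_le_one hz (hB hc)⟩
    | succ n ih =>
      intro z hz
      rcases eq_or_ne z centre with rfl | hne
      · exact ⟨_, hc, by rw [dist_self]; positivity⟩
      obtain ⟨i, q, hq, rfl⟩ := exists_punch_tile hz hne
      obtain ⟨b, hb, hqb⟩ := ih q hq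
      refine ⟨_, h i b hb, (dist_punch_tile_le i q b).trans ?_⟩
      rw [pow_succ]
      linarith
  intro z hz
  rw [Metric.mem_closure_iff]
  intro ε hε
  obtain ⟨n, hn⟩ := exists_pow_lt_of_lt_one hε (by norm_num : (1 / 2 : ℝ) < 1)
  obtain ⟨b, hb, hzb⟩ := key n z hz
  exact ⟨b, hb, hzb.trans_lt hn⟩

theorem unitSquare_subset_closure_holePoint : unitSquare ⊆ closure (range holePoint) := by
  refine unitSquare_subset_closure ?_ ⟨[], rfl⟩ ?_
  · rintro _ ⟨w, rfl⟩
    exact openSquare_subset (holePoint_mem w)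
  · rintro i _ ⟨w, rfl⟩
    exact ⟨i :: w, rfl⟩

theorem dirAt_tile (i : Digit) (a : Plane) : DirAt (tile i) a := by
  have h : HasFDerivAt (tile i) ((3⁻¹ : ℝ) • ContinuousLinearMap.id ℝ Plane) a := by
    have h1 : tile i = fun q => (3⁻¹ : ℝ) • (q + ((i.1.1 : ℝ), (i.1.2 : ℝ))) := by
      ext q <;> simp [tile] <;> ring
    rw [h1]
    exact ((hasFDerivAt_id (𝕜 := ℝ) a).add_const _).const_smul (3⁻¹ : ℝ)
  refine dirAt_of_hasFDerivAt h fun v w hvw => ?_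
  simpa using hvw

theorem dirAt_add_const (b a : Plane) : DirAt (fun z => z + b) a :=
  dirAt_of_hasFDerivAt ((hasFDerivAt_id a).add_const b) fun _ _ h => h

theorem dirAt_punch {a : Plane} (h1 : 1 / 6 < ‖a - centre‖) (h2 : a ∈ openSquare) :
    DirAt punch a := by
  have h : punch = (fun z => z + centre) ∘ shrink ∘ fun z => z + (-centre) := by
    ext z <;> simp [punch, add_comm, sub_eq_add_neg]
  rw [h]
  refine (dirAt_add_const _ _).comp (DirAt.comp (dirAt_shrink ?_) (dirAt_add_const _ _))
  rw [← sub_eq_add_neg]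
  exact ⟨h1, norm_sub_centre_lt.2 h2⟩

theorem dirAt_punch_tile (i : Digit) {a : Plane} (ha : a ∈ openSquare) :
    DirAt (fun q => punch (tile i q)) a :=
  DirAt.comp (g := punch) (f := tile i)
    (dirAt_punch (tile_outside_hole i ha) (tile_mem_openSquare i ha)) (dirAt_tile i a)

namespace IsCollapse

variable {ψ ψ₁ : Plane → Plane}

theorem tile_eq (hψ : IsCollapse ψ ψ₁) (d : Digit) {q : Plane} (hq : q ∈ unitSquare) :
    ψ (tile d q) = punch (tile d (ψ q)) := by
  rw [hψ.eq_punch, hψ.apply_tile d q hq]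

theorem eq_self_of_notMem (hψ : IsCollapse ψ ψ₁) {x : Plane} (hx : x ∈ sierpinskiCarpet)
    (h : ψ x ∉ openSquare) : ψ x = x := by
  have key : ∀ n : ℕ, ∀ x ∈ sierpinskiCarpet, ψ x ∉ openSquare → dist (ψ x) x ≤ (1 / 3) ^ n := by
    intro n
    induction n with
    | zero =>
      intro x hx _
      have hx := carpet_subset_unitSquare hx
      simpa using dist_le_one (hψ.mapsTo hx) hx
    | succ n ih =>
      intro x hx h
      obtain ⟨d, q, hq, rfl⟩ := exists_tile_of_mem_carpet hx
      rw [hψ.tile_eq d (carpet_subset_unitSquare hq)] at h ⊢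
      have h1 : tile d (ψ q) ∉ openSquare := fun h' => h (punch_mem_openSquare h')
      rw [punch_of_notMem h1, dist_tile, pow_succ]
      linarith [ih q hq fun h' => h1 (tile_mem_openSquare d h')]
  refine dist_le_zero.1 (ge_of_tendsto' (tendsto_pow_atTop_nhds_zero_of_lt_one (by norm_num)
    (by norm_num : (1 / 3 : ℝ) < 1)) fun n => key n x hx h)

theorem eq_holePoint_of_mem (hψ : IsCollapse ψ ψ₁) (w : List Digit) :
    ∀ x ∈ hole w, ψ x = holePoint w := by
  induction w with
  | nil =>
    intro x hx
    rw [hole, mem_closedBall_iff_norm] at hx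
    rw [hψ.eq_punch, hψ.eq_of_hole x hx, punch_of_le hx, holePoint]
  | cons i w ih =>
    rintro _ ⟨q, hq, rfl⟩
    rw [hψ.tile_eq i (openSquare_subset (hole_subset w hq)), ih q hq, holePoint]

theorem mem_hole_of_eq (hψ : IsCollapse ψ ψ₁) (w : List Digit) :
    ∀ x ∈ sierpinskiCarpet, ψ x = holePoint w → x ∈ hole w := by
  induction w with
  | nil =>
    intro x hx h
    rw [hψ.eq_punch, holePoint] at h
    have h1 := norm_le_of_punch_eq h
    obtain ⟨d, q, hq, rfl⟩ := exists_tile_of_mem_carpet hx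
    rw [hψ.apply_tile d q (carpet_subset_unitSquare hq)] at h1
    have h2 := untile_notMem_of_hole h1 d
    rw [untile_tile] at h2
    rw [hψ.eq_self_of_notMem hq h2] at h1
    rwa [hole, mem_closedBall_iff_norm]
  | cons i w ih =>
    intro x hx h
    obtain ⟨d, q, hq, rfl⟩ := exists_tile_of_mem_carpet hx
    have hq' := carpet_subset_unitSquare hq
    rw [hψ.tile_eq d hq', holePoint] at h
    have h1 := eq_of_punch_eq h.symm (tile_outside_hole i (holePoint_mem w))
    obtain ⟨rfl, h2⟩ := tile_eq_tile h1.symm (hψ.mapsTo hq') (holePoint_mem w)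
    exact ⟨q, ih q hq h2, rfl⟩

theorem injOn (hψ : IsCollapse ψ ψ₁) {x y : Plane} (hx : x ∈ sierpinskiCarpet)
    (hy : y ∈ sierpinskiCarpet) (hxy : ψ x = ψ y) (h : ψ x ∉ range holePoint) : x = y := by
  have key : ∀ n : ℕ, ∀ x ∈ sierpinskiCarpet, ∀ y ∈ sierpinskiCarpet, ψ x = ψ y →
      ψ x ∉ range holePoint → dist x y ≤ (1 / 3) ^ n := by
    intro n
    induction n with
    | zero =>
      intro x hx y hy _ _
      simpa using dist_le_one (carpet_subset_unitSquare hx) (carpet_subset_unitSquare hy)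
    | succ n ih =>
      intro x hx y hy hxy h
      obtain ⟨d, p, hp, rfl⟩ := exists_tile_of_mem_carpet hx
      obtain ⟨e, q, hq, rfl⟩ := exists_tile_of_mem_carpet hy
      have hp' := carpet_subset_unitSquare hp
      have hq' := carpet_subset_unitSquare hq
      rw [hψ.tile_eq d hp', hψ.tile_eq e hq'] at hxy
      rw [hψ.tile_eq d hp'] at h
      have h1 : tile d (ψ p) = tile e (ψ q) := by
        refine eq_of_punch_eq hxy ?_
        by_contra! h'
        exact h ⟨[], (punch_of_le h').symm⟩
      have h2 : ψ p ∉ range holePoint := by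
        rintro ⟨w, hw⟩
        exact h ⟨d :: w, by rw [holePoint, hw]⟩
      by_cases hop : d = e ∧ ψ p = ψ q
      · obtain ⟨rfl, h3⟩ := hop
        rw [dist_tile, pow_succ]
        linarith [ih p hp q hq h3 h2]
      · have h4 : ψ q ∉ openSquare := fun h' => hop (tile_eq_tile h1 (hψ.mapsTo hp') h')
        have h5 : ψ p ∉ openSquare := fun h' => hop
          ((tile_eq_tile h1.symm (hψ.mapsTo hq') h').imp Eq.symm Eq.symm)
        rw [hψ.eq_self_of_notMem hp h5, hψ.eq_self_of_notMem hq h4] at h1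
        rw [h1, dist_self]
        positivity
  refine dist_le_zero.1 (ge_of_tendsto' (tendsto_pow_atTop_nhds_zero_of_lt_one (by norm_num)
    (by norm_num : (1 / 3 : ℝ) < 1)) fun n => key n x hx y hy hxy h)

theorem surjOn (hψ : IsCollapse ψ ψ₁) : SurjOn ψ sierpinskiCarpet unitSquare := by
  have hc : IsClosed (ψ '' sierpinskiCarpet) := (isCompact_carpet.image hψ.cont).isClosed
  rw [SurjOn, ← hc.closure_eq]
  refine unitSquare_subset_closure ?_ ?_ ?_
  · rintro _ ⟨x, hx, rfl⟩
    exact hψ.mapsTo (carpet_subset_unitSquare hx)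
  · have h1 : ((1 : ℝ), (1 : ℝ)) ∈ sierpinskiCarpet := by
      refine boundary_subset_carpet ⟨?_, ?_⟩ <;> simp [unitSquare, openSquare]
    refine ⟨tile default (1, 1), tile_mem_carpet _ h1, ?_⟩
    refine hψ.eq_holePoint_of_mem [] _ ?_
    rw [hole, mem_closedBall_iff_norm]
    simp only [centre, tile, default, Prod.norm_def]
    norm_num
  · rintro i _ ⟨x, hx, rfl⟩
    exact ⟨tile i x, tile_mem_carpet i hx, hψ.tile_eq i (carpet_subset_unitSquare hx)⟩

theorem exists_near (hψ : IsCollapse ψ ψ₁) (n : ℕ) : ∀ x ∈ sierpinskiCarpet, ∀ Q : Set Plane,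
    Q.Countable → ∃ y ∈ sierpinskiCarpet, dist x y ≤ (1 / 3) ^ n ∧ ψ y ∈ openSquare \ Q := by
  induction n with
  | zero =>
    intro x hx Q hQ
    have hne : (openSquare \ Q).Nonempty := by
      by_contra h
      rw [not_nonempty_iff_eq_empty, sdiff_eq_empty] at h
      have h1 : (openSquare : Set Plane).Countable := hQ.mono h
      have h2 : (Ioo (0 : ℝ) 1).Countable := by
        have : Ioo (0 : ℝ) 1 = Prod.fst '' openSquare := by
          rw [openSquare, fst_image_prod]
          exact ⟨1 / 2, by norm_num⟩
        rw [this]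
        exact h1.image _
      rw [← Cardinal.le_aleph0_iff_set_countable, Cardinal.mk_Ioo_real one_pos] at h2
      exact Cardinal.aleph0_lt_continuum.not_ge h2
    obtain ⟨z, hz⟩ := hne
    obtain ⟨y, hy, rfl⟩ := hψ.surjOn (openSquare_subset hz.1)
    refine ⟨y, hy, ?_, hz⟩
    simpa using dist_le_one (carpet_subset_unitSquare hx) (carpet_subset_unitSquare hy)
  | succ n ih =>
    intro x hx Q hQ
    obtain ⟨i, p, hp, rfl⟩ := exists_tile_of_mem_carpet hx
    have hQ' : (openSquare ∩ (fun q => punch (tile i q)) ⁻¹' Q).Countable := by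
      refine MapsTo.countable_of_injOn (f := fun q => punch (tile i q)) (t := Q)
        (fun q hq => hq.2) ((injOn_punch_tile i).mono inter_subset_left) hQ
    obtain ⟨y, hy, hd, hy1, hy2⟩ := ih p hp _ hQ'
    refine ⟨tile i y, tile_mem_carpet i hy, ?_, ?_⟩
    · rw [dist_tile, pow_succ]
      linarith
    · rw [hψ.tile_eq i (carpet_subset_unitSquare hy)]
      exact ⟨punch_mem_openSquare (tile_mem_openSquare i hy1), fun h => hy2 ⟨hy1, h⟩⟩

/-- Points of the carpet whose image avoids a given countable set are dense. -/
theorem carpet_subset_closure (hψ : IsCollapse ψ ψ₁) {Q : Set Plane} (hQ : Q.Countable) :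
    sierpinskiCarpet ⊆ closure {x ∈ sierpinskiCarpet | ψ x ∈ openSquare \ Q} := by
  intro x hx
  rw [Metric.mem_closure_iff]
  intro ε hε
  obtain ⟨n, hn⟩ := exists_pow_lt_of_lt_one hε (by norm_num : (1 / 3 : ℝ) < 1)
  obtain ⟨y, hy, hd, h⟩ := hψ.exists_near n x hx Q hQ
  exact ⟨y, ⟨hy, h⟩, hd.trans_lt hn⟩

/-- The points of a collapsed hole are distinguished by the directions in which their images
approach the collapsed point. -/
theorem exists_direction (hψ : IsCollapse ψ ψ₁) (w : List Digit) : ∃ Λ : Plane → Plane,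
    InjOn Λ (sierpinskiCarpet ∩ hole w) ∧
    ∀ x ∈ sierpinskiCarpet ∩ hole w, Λ x ∈ Metric.sphere (0 : Plane) 1 ∧
      Tendsto ψ (𝓝[sierpinskiCarpet \ ψ ⁻¹' {holePoint w}] x) (approach (holePoint w) (Λ x)) := by
  induction w with
  | nil =>
    have hn : ∀ x ∈ sierpinskiCarpet ∩ hole [], ‖x - centre‖ = 1 / 6 := by
      rintro x ⟨hx, hx'⟩
      rw [hole, mem_closedBall_iff_norm] at hx'
      exact le_antisymm hx' (norm_sub_centre_ge hx)
    have hne : ∀ x ∈ sierpinskiCarpet ∩ hole [], x - centre ≠ 0 := by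
      intro x hx h
      have := hn x hx
      rw [h, norm_zero] at this
      norm_num at this
    refine ⟨fun x => dir (x - centre), ?_, ?_⟩
    · intro x hx y hy h
      have h1 := norm_smul_dir (x - centre)
      rw [show dir (x - centre) = dir (y - centre) from h, hn x hx, ← hn y hy, norm_smul_dir] at h1
      exact (sub_left_injective h1).symm
    · intro x hx
      refine ⟨mem_sphere_zero_iff_norm.2 (norm_dir (hne x hx)), tendsto_approach.2 ⟨?_, ?_, ?_⟩⟩
      · have := hψ.cont.tendsto x
        rw [hψ.eq_holePoint_of_mem [] x hx.2] at this
        exact this.mono_left nhdsWithin_le_nhds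
      · filter_upwards [self_mem_nhdsWithin] with y hy
        exact hy.2
      · have hx1 : ψ₁ x = x := hψ.eq_of_hole x (hn x hx).le
        have h1 : Tendsto (fun y => dir (ψ₁ y - centre)) (𝓝 x) (𝓝 (dir (x - centre))) := by
          have h2 : ContinuousAt (fun y => ψ₁ y - centre) x :=
            (hψ.cont₁.sub continuous_const).continuousAt
          have h3 := continuousAt_dir (hne x hx)
          rw [ContinuousAt, hx1] at h2
          exact h3.tendsto.comp h2
        refine (h1.mono_left nhdsWithin_le_nhds).congr' ?_
        filter_upwards [self_mem_nhdsWithin] with y hy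
        have h4 : 1 / 6 < ‖ψ₁ y - centre‖ := by
          by_contra! h5
          exact hy.2 (by
            rw [mem_preimage, hψ.eq_punch, punch_of_le h5, holePoint]
            rfl)
        rw [hψ.eq_punch, holePoint, punch, add_sub_cancel_left, dir_shrink h4]
  | cons i w ih =>
    obtain ⟨Λ, hinj, hΛ⟩ := ih
    obtain ⟨l, hl, hlm, hlt⟩ := dirAt_punch_tile i (holePoint_mem w)
    have hback : ∀ x ∈ sierpinskiCarpet ∩ hole (i :: w),
        untile i x ∈ sierpinskiCarpet ∩ hole w := by
      rintro _ ⟨hx, q, hq, rfl⟩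
      rw [untile_tile]
      exact ⟨mem_carpet_of_tile hx (hole_subset w hq), hq⟩
    refine ⟨fun x => l (Λ (untile i x)), ?_, ?_⟩
    · intro x hx y hy h
      have h1 := hinj (hback x hx) (hback y hy)
        (hl (hΛ _ (hback x hx)).1 (hΛ _ (hback y hy)).1 h)
      rw [← tile_untile i x, h1, tile_untile]
    · intro x hx
      obtain ⟨hs, ht⟩ := hΛ _ (hback x hx)
      refine ⟨hlm hs, ?_⟩
      have hev : ∀ᶠ y in 𝓝[sierpinskiCarpet \ ψ ⁻¹' {holePoint (i :: w)}] x,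
          untile i y ∈ openSquare := nhdsWithin_le_nhds
        ((continuous_untile i).continuousAt (isOpen_openSquare.mem_nhds
          (hole_subset w (hback x hx).2)))
      have hun : Tendsto (untile i) (𝓝[sierpinskiCarpet \ ψ ⁻¹' {holePoint (i :: w)}] x)
          (𝓝[sierpinskiCarpet \ ψ ⁻¹' {holePoint w}] (untile i x)) := by
        refine tendsto_nhdsWithin_iff.2 ⟨((continuous_untile i).tendsto x).mono_left
          nhdsWithin_le_nhds, ?_⟩
        filter_upwards [hev, self_mem_nhdsWithin] with y hy hyS
        refine ⟨mem_carpet_of_tile (d := i) (by rw [tile_untile]; exact hyS.1) hy, fun h => ?_⟩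
        refine hyS.2 ?_
        have h := mem_singleton_iff.1 h
        rw [mem_preimage, mem_singleton_iff, ← tile_untile i y, hψ.tile_eq i (openSquare_subset hy),
          h, holePoint]
      refine ((hlt _ hs).comp (ht.comp hun)).congr' ?_
      filter_upwards [hev] with y hy
      rw [Function.comp_apply, Function.comp_apply, ← hψ.tile_eq i (openSquare_subset hy),
        tile_untile]

end IsCollapse

/-- A differentiable vector field that is small in the `C¹` norm and vanishes outside `W`. -/
structure SmallField (ε : ℝ) (W : Set Plane) (v : Plane → Plane) : Prop where
  diff : Differentiable ℝ v
  norm_fderiv_le : ∀ x, ‖fderiv ℝ v x‖ ≤ ε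
  norm_le : ∀ x, ‖v x‖ ≤ ε
  eq_zero : ∀ x, x ∉ W → v x = 0

theorem SmallField.mono {ε : ℝ} {W W' : Set Plane} {v : Plane → Plane} (h : SmallField ε W v)
    (hW : W ⊆ W') : SmallField ε W' v :=
  ⟨h.diff, h.norm_fderiv_le, h.norm_le, fun x hx => h.eq_zero x fun h' => hx (hW h')⟩

theorem SmallField.zero {ε : ℝ} (hε : 0 ≤ ε) (W : Set Plane) : SmallField ε W 0 :=
  ⟨differentiable_const 0, fun x => by simpa using hε, fun x => by simpa using hε, fun _ _ => rfl⟩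

theorem SmallField.add {ε δ : ℝ} {W : Set Plane} {v w : Plane → Plane} (hv : SmallField ε W v)
    (hw : SmallField δ W w) : SmallField (ε + δ) W (v + w) := by
  refine ⟨hv.diff.add hw.diff, fun x => ?_, fun x => ?_, fun x hx => ?_⟩
  · rw [fderiv_add (hv.diff x) (hw.diff x)]
    exact norm_add_le_of_le (hv.norm_fderiv_le x) (hw.norm_fderiv_le x)
  · exact norm_add_le_of_le (hv.norm_le x) (hw.norm_le x)
  · rw [Pi.add_apply, hv.eq_zero x hx, hw.eq_zero x hx, add_zero]

theorem SmallField.norm_sub_le {ε : ℝ} {W : Set Plane} {v : Plane → Plane}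
    (hv : SmallField ε W v) (x y : Plane) : ‖v x - v y‖ ≤ ε * ‖x - y‖ :=
  convex_univ.norm_image_sub_le_of_norm_fderiv_le (fun z _ => hv.diff z)
    (fun z _ => hv.norm_fderiv_le z) (mem_univ y) (mem_univ x)

/-- Every sufficiently small vector is the local value of a small field. -/
theorem exists_smallField {W : Set Plane} (hW : IsOpen W) {a : Plane} (ha : a ∈ W) {ε : ℝ}
    (hε : 0 < ε) : ∃ δ > 0, ∀ c : Plane, ‖c‖ < δ → ∃ v, SmallField ε W v ∧
      ∀ x ∈ Metric.ball a δ, v x = c := by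
  obtain ⟨r, hr, hrW⟩ := Metric.isOpen_iff.1 hW a ha
  let b : ContDiffBump a := ⟨r / 2, r, by positivity, by linarith⟩
  have hb : ContDiff ℝ 1 b := b.contDiff
  obtain ⟨B, hB⟩ := (hb.continuous_fderiv one_ne_zero).bounded_above_of_compact_support
    (b.hasCompactSupport.fderiv ℝ)
  have hB0 : 0 ≤ B := (norm_nonneg _).trans (hB a)
  have hbd : Differentiable ℝ b := hb.differentiable one_ne_zero
  refine ⟨min (r / 2) (ε / (B + 1)), by positivity, fun c hc => ⟨fun x => b x • c, ?_, ?_⟩⟩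
  · have hc' : ‖c‖ * (B + 1) ≤ ε := by
      rw [← le_div_iff₀ (by positivity)]
      exact (hc.trans_le (min_le_right _ _)).le
    refine ⟨hbd.smul_const c, fun x => ?_, fun x => ?_, fun x hx => ?_⟩
    · rw [fderiv_smul_const (hbd x)]
      calc ‖(fderiv ℝ b x).smulRight c‖ = ‖fderiv ℝ b x‖ * ‖c‖ :=
            ContinuousLinearMap.norm_smulRight_apply _ _
        _ ≤ B * ‖c‖ := by gcongr; exact hB x
        _ ≤ ε := by nlinarith [norm_nonneg c]
    · rw [norm_smul, Real.norm_of_nonneg b.nonneg]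
      nlinarith [b.le_one (x := x), b.nonneg (x := x), norm_nonneg c]
    · have : r ≤ dist x a := by
        by_contra! h
        exact hx (hrW h)
      rw [b.zero_of_le_dist this, zero_smul]
  · intro x hx
    have : x ∈ Metric.closedBall a b.rIn :=
      Metric.ball_subset_closedBall (Metric.ball_subset_ball (min_le_left _ _) hx)
    simp only [b.one_of_mem_closedBall this, one_smul]

/-- A perturbation of the identity by a contraction is a homeomorphism. -/
theorem exists_homeomorph_id_add {u : Plane → Plane} {K : ℝ} (hK : K < 1)
    (hu : ∀ x y, ‖u x - u y‖ ≤ K * ‖x - y‖) : ∃ φ : Plane ≃ₜ Plane, ∀ x, φ x = x + u x := by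
  have hK0 : 0 ≤ K := by
    have := (norm_nonneg _).trans (hu (1, 0) 0)
    have h1 : ‖((1, 0) : Plane) - 0‖ = 1 := by simp [Prod.norm_def]
    rwa [h1, mul_one] at this
  have happ : ApproximatesLinearOn (fun x => x + u x)
      ((ContinuousLinearEquiv.refl ℝ Plane : Plane ≃L[ℝ] Plane) : Plane →L[ℝ] Plane) univ
      K.toNNReal := by
    intro x _ y _
    have : x + u x - (y + u y) - (x - y) = u x - u y := by abel
    simpa [this, Real.coe_toNNReal K hK0] using hu x y
  refine ⟨happ.toHomeomorph _ (Or.inr ?_), fun x => rfl⟩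
  have : ‖((ContinuousLinearEquiv.refl ℝ Plane).symm : Plane →L[ℝ] Plane)‖₊ = 1 := by
    rw [← NNReal.coe_inj, coe_nnnorm]
    exact ContinuousLinearMap.norm_id
  rw [this, inv_one]
  exact Real.toNNReal_lt_one.2 hK

/-- A stage of the back-and-forth construction: the pairs in `P` are already matched. -/
structure Stage (U D E : Set Plane) (K : ℝ) (u : Plane → Plane) (P : Set (Plane × Plane)) :
    Prop where
  finite : P.Finite
  subset : P ⊆ D ×ˢ E
  eq : ∀ p ∈ P, p.1 + u p.1 = p.2
  eq_zero : ∀ x, x ∉ U → u x = 0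
  norm_sub_le : ∀ x y, ‖u x - u y‖ ≤ K * ‖x - y‖

section Stage

variable {U D E : Set Plane} {K : ℝ} {u : Plane → Plane} {P : Set (Plane × Plane)}

theorem Stage.extend (h : Stage U D E K u P) {ε : ℝ} {v : Plane → Plane} {d e : Plane}
    (hv : SmallField ε (U \ Prod.fst '' P) v) (hd : d ∈ D) (he : e ∈ E)
    (hde : d + u d + v d = e) : Stage U D E (K + ε) (u + v) (insert (d, e) P) := by
  refine ⟨h.finite.insert _, insert_subset ⟨hd, he⟩ h.subset, ?_, fun x hx => ?_, fun x y => ?_⟩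
  · rintro p (rfl | hp)
    · rw [Pi.add_apply, ← add_assoc]
      exact hde
    · rw [Pi.add_apply, hv.eq_zero _ (fun h' => h'.2 ⟨p, hp, rfl⟩), add_zero]
      exact h.eq p hp
  · rw [Pi.add_apply, h.eq_zero x hx, hv.eq_zero x (fun h' => hx h'.1), add_zero]
  · have : (u + v) x - (u + v) y = (u x - u y) + (v x - v y) := by
      simp only [Pi.add_apply]; abel
    rw [this, add_mul]
    exact norm_add_le_of_le (h.norm_sub_le x y) (hv.norm_sub_le x y)

theorem Stage.mono (h : Stage U D E K u P) {K' : ℝ} (hK : K ≤ K') : Stage U D E K' u P :=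
  ⟨h.finite, h.subset, h.eq, h.eq_zero, fun x y => (h.norm_sub_le x y).trans (by gcongr)⟩

theorem Stage.isOpen (h : Stage U D E K u P) (hU : IsOpen U) : IsOpen (U \ Prod.fst '' P) :=
  hU.sdiff (h.finite.image _).isClosed

theorem Stage.mem_iff (h : Stage U D E K u P) (hK : K < 1) (x : Plane) :
    x + u x ∈ U ↔ x ∈ U := by
  obtain ⟨φ, hφ⟩ := exists_homeomorph_id_add hK h.norm_sub_le
  constructor
  · intro hx
    by_contra h'
    rw [h.eq_zero x h', add_zero] at hx
    exact h' hx
  · intro hx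
    by_contra h'
    have : φ (x + u x) = φ x := by rw [hφ, hφ, h.eq_zero _ h', add_zero]
    rw [φ.injective this] at h'
    exact h' hx

theorem Stage.continuous (h : Stage U D E K u P) (hK : K < 1) : Continuous u := by
  obtain ⟨φ, hφ⟩ := exists_homeomorph_id_add hK h.norm_sub_le
  have : u = fun x => φ x - x := by ext x <;> simp [hφ]
  rw [this]
  exact φ.continuous.sub continuous_id

theorem Stage.forth (h : Stage U D E K u P) (hU : IsOpen U) (hK : K < 1) (hD : D ⊆ U)
    (hEd : U ⊆ closure E) {ε : ℝ} (hε : 0 < ε) {d : Plane} (hd : d ∈ D) :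
    ∃ v P', SmallField ε U v ∧ P ⊆ P' ∧ Stage U D E (K + ε) (u + v) P' ∧ d ∈ Prod.fst '' P' := by
  by_cases hdP : d ∈ Prod.fst '' P
  · refine ⟨0, P, SmallField.zero hε.le U, subset_rfl, ?_, hdP⟩
    rw [add_zero]
    exact h.mono (by linarith)
  · obtain ⟨δ, hδ, hv⟩ := exists_smallField (h.isOpen hU) ⟨hD hd, hdP⟩ hε
    obtain ⟨e, he, hde⟩ := Metric.mem_closure_iff.1 (hEd ((h.mem_iff hK d).2 (hD hd))) δ hδ
    rw [dist_comm, dist_eq_norm] at hde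
    obtain ⟨v, hvs, hvc⟩ := hv _ hde
    refine ⟨v, insert (d, e) P, hvs.mono sdiff_subset, subset_insert _ _, h.extend hvs hd he ?_,
      ⟨(d, e), mem_insert _ _, rfl⟩⟩
    rw [hvc d (Metric.mem_ball_self hδ), add_sub_cancel]

theorem Stage.back (h : Stage U D E K u P) (hU : IsOpen U) (hK : K < 1) (hE : E ⊆ U)
    (hDd : U ⊆ closure D) {ε : ℝ} (hε : 0 < ε) {e : Plane} (he : e ∈ E) :
    ∃ v P', SmallField ε U v ∧ P ⊆ P' ∧ Stage U D E (K + ε) (u + v) P' ∧ e ∈ Prod.snd '' P' := by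
  by_cases heP : e ∈ Prod.snd '' P
  · refine ⟨0, P, SmallField.zero hε.le U, subset_rfl, ?_, heP⟩
    rw [add_zero]
    exact h.mono (by linarith)
  · obtain ⟨φ, hφ⟩ := exists_homeomorph_id_add hK h.norm_sub_le
    obtain ⟨a, ha⟩ := φ.surjective e
    rw [hφ] at ha
    have haU : a ∈ U := by
      rw [← h.mem_iff hK, ha]
      exact hE he
    have haP : a ∉ Prod.fst '' P := by
      rintro ⟨p, hp, rfl⟩
      exact heP ⟨p, hp, (h.eq p hp).symm.trans ha⟩
    obtain ⟨δ, hδ, hv⟩ := exists_smallField (h.isOpen hU) ⟨haU, haP⟩ hε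
    have hc : ContinuousAt (fun x => e - (x + u x)) a :=
      (continuous_const.sub (continuous_id.add (h.continuous hK))).continuousAt
    have hnear : ∀ᶠ x in 𝓝 a, ‖e - (x + u x)‖ < δ := by
      have := hc.norm
      simp only [ContinuousAt, ha, sub_self, norm_zero] at this
      exact this.eventually (gt_mem_nhds hδ)
    obtain ⟨d, ⟨hd1, hd2⟩, hd⟩ := mem_closure_iff_nhds.1 (hDd haU) _
      (inter_mem hnear (Metric.ball_mem_nhds a hδ))
    obtain ⟨v, hvs, hvc⟩ := hv _ hd1
    refine ⟨v, insert (d, e) P, hvs.mono sdiff_subset, subset_insert _ _, h.extend hvs hd he ?_,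
      ⟨(d, e), mem_insert _ _, rfl⟩⟩
    rw [hvc d hd2, add_sub_cancel]

theorem Stage.both (h : Stage U D E K u P) (hU : IsOpen U) {ε : ℝ} (hε : 0 < ε) (hK : K + ε < 1)
    (hD : D ⊆ U) (hE : E ⊆ U) (hDd : U ⊆ closure D) (hEd : U ⊆ closure E)
    {d e : Plane} (hd : d ∈ D) (he : e ∈ E) :
    ∃ v P', SmallField ε U v ∧ P ⊆ P' ∧ Stage U D E (K + ε) (u + v) P' ∧
      d ∈ Prod.fst '' P' ∧ e ∈ Prod.snd '' P' := by
  obtain ⟨v, P₁, hv, hP₁, h₁, hd₁⟩ := h.forth hU (by linarith) hD hEd (half_pos hε) hd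
  obtain ⟨w, P₂, hw, hP₂, h₂, he₂⟩ := h₁.back hU (by linarith) hE hDd (half_pos hε) he
  refine ⟨v + w, P₂, ?_, hP₁.trans hP₂, ?_, image_mono hP₂ hd₁, he₂⟩
  · simpa using hv.add hw
  · rw [← add_assoc]
    convert h₂ using 1
    ring

end Stage

theorem injective_id_add {L : Plane →L[ℝ] Plane} (hL : ‖L‖ < 1) :
    Function.Injective (ContinuousLinearMap.id ℝ Plane + L) := by
  refine (injective_iff_map_eq_zero _).2 fun v hv => ?_
  have h1 : v = -L v := eq_neg_of_add_eq_zero_left hv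
  have h2 : ‖v‖ ≤ ‖L‖ * ‖v‖ := by
    conv_lhs => rw [h1, norm_neg]
    exact L.le_opNorm v
  by_contra h0
  nlinarith [norm_pos_iff.2 h0]

/-- Any two countable dense subsets of an open set are matched by a homeomorphism of the plane
that acts injectively on directions and is the identity outside the open set. -/
theorem exists_homeomorph_matching {U D E : Set Plane} (hU : IsOpen U) (hUn : U.Nonempty)
    (hDc : D.Countable) (hEc : E.Countable) (hD : D ⊆ U) (hE : E ⊆ U)
    (hDd : U ⊆ closure D) (hEd : U ⊆ closure E) :
    ∃ φ : Plane ≃ₜ Plane, (∀ x, x ∉ U → φ x = x) ∧ φ '' D = E ∧ ∀ a, DirAt φ a := by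
  obtain ⟨a, ha⟩ := hUn
  obtain ⟨ds, hds⟩ := hDc.exists_eq_range (closure_nonempty_iff.1 ⟨a, hDd ha⟩)
  obtain ⟨es, hes⟩ := hEc.exists_eq_range (closure_nonempty_iff.1 ⟨a, hEd ha⟩)
  let K : ℕ → ℝ := fun n => 1 / 2 - (1 / 2) ^ (n + 1)
  let ε : ℕ → ℝ := fun n => (1 / 2) ^ n / 4
  have hε : ∀ n, 0 < ε n := fun n => by positivity
  have hKε : ∀ n, K n + ε n = K (n + 1) := fun n => by simp only [K, ε]; ring
  have hK1 : ∀ n, K n < 1 / 2 := fun n => by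
    simp only [K]
    linarith [pow_pos (one_half_pos (α := ℝ)) (n + 1)]
  have hεs : HasSum ε (1 / 2) := by
    have := (hasSum_geometric_of_lt_one (by norm_num) (by norm_num : (1 / 2 : ℝ) < 1)).div_const 4
    norm_num at this ⊢
    convert this using 2
  let S : ℕ → Type := fun n =>
    {s : (Plane → Plane) × Set (Plane × Plane) // Stage U D E (K n) s.1 s.2}
  have step : ∀ n (s : S n), ∃ s' : S (n + 1), SmallField (ε n) U (s'.1.1 - s.1.1) ∧
      s.1.2 ⊆ s'.1.2 ∧ ds n ∈ Prod.fst '' s'.1.2 ∧ es n ∈ Prod.snd '' s'.1.2 := by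
    intro n s
    obtain ⟨v, P', hv, hP, hs, h1, h2⟩ := s.2.both hU (hε n) (by linarith [hKε n, hK1 (n + 1)])
      hD hE hDd hEd (hds ▸ mem_range_self n) (hes ▸ mem_range_self n)
    refine ⟨⟨(s.1.1 + v, P'), ?_⟩, ?_, hP, h1, h2⟩
    · rw [← hKε]; exact hs
    · simpa using hv
  choose nxt hsm hsub hdn hen using step
  have h0 : Stage U D E (K 0) 0 ∅ := by
    refine ⟨finite_empty, empty_subset _, by simp, fun _ _ => rfl, fun x y => ?_⟩
    simp [K]
  let s : ∀ n, S n := fun n => Nat.rec ⟨(0, ∅), h0⟩ nxt n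
  have hs : ∀ n, s (n + 1) = nxt n (s n) := fun n => rfl
  let u : ℕ → Plane → Plane := fun n => (s n).1.1
  let v : ℕ → Plane → Plane := fun n => u (n + 1) - u n
  have hv : ∀ n, SmallField (ε n) U (v n) := fun n => hsm n (s n)
  have hsum : ∀ x, Summable fun n => v n x := fun x =>
    Summable.of_norm_bounded hεs.summable fun n => (hv n).norm_le x
  have hpart : ∀ N x, ∑ n ∈ Finset.range N, v n x = u N x := by
    intro N x
    simp only [v, Pi.sub_apply]
    rw [Finset.sum_range_sub (fun n => u n x)]
    exact sub_zero _
  let w : Plane → Plane := fun x => ∑' n, v n x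
  have hlim : ∀ x, Tendsto (fun N => u N x) atTop (𝓝 (w x)) := by
    intro x
    have := (hsum x).hasSum.tendsto_sum_nat
    simpa only [hpart] using this
  have hlip : ∀ x y, ‖w x - w y‖ ≤ 1 / 2 * ‖x - y‖ := by
    intro x y
    refine le_of_tendsto' ((hlim x).sub (hlim y)).norm fun N => ?_
    exact ((s N).2.norm_sub_le x y).trans (by gcongr; exact (hK1 N).le)
  obtain ⟨φ, hφ⟩ := exists_homeomorph_id_add (by norm_num) hlip
  have hmono : Monotone fun n => (s n).1.2 := monotone_nat_of_le_succ fun n => hsub n (s n)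
  have hpair : ∀ n, ∀ p ∈ (s n).1.2, φ p.1 = p.2 := by
    intro n p hp
    rw [hφ]
    refine tendsto_nhds_unique ((hlim p.1).const_add p.1) ?_
    refine tendsto_const_nhds.congr' ?_
    filter_upwards [eventually_ge_atTop n] with m hm
    exact ((s m).2.eq p (hmono hm hp)).symm
  refine ⟨φ, fun x hx => ?_, ?_, fun a => ?_⟩
  · have : w x = 0 := by
      simp only [w, fun n => (hv n).eq_zero x hx, tsum_zero]
    rw [hφ, this, add_zero]
  · apply Subset.antisymm
    · rintro _ ⟨d, hd, rfl⟩
      rw [hds] at hd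
      obtain ⟨n, rfl⟩ := hd
      obtain ⟨p, hp, hpd⟩ := hdn n (s n)
      rw [← hpd, hpair (n + 1) p hp]
      exact ((s (n + 1)).2.subset hp).2
    · intro e he
      rw [hes] at he
      obtain ⟨n, rfl⟩ := he
      obtain ⟨p, hp, hpe⟩ := hen n (s n)
      exact ⟨p.1, ((s (n + 1)).2.subset hp).1, (hpair (n + 1) p hp).trans hpe⟩
  · have hder : HasFDerivAt w (∑' n, fderiv ℝ (v n) a) a :=
      hasFDerivAt_tsum hεs.summable (fun n x => ((hv n).diff x).hasFDerivAt)
        (fun n x => (hv n).norm_fderiv_le x) (hsum a) a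
    have hnorm : ‖∑' n, fderiv ℝ (v n) a‖ ≤ 1 / 2 :=
      tsum_of_norm_bounded hεs fun n => (hv n).norm_fderiv_le a
    have hφ' : (φ : Plane → Plane) = fun x => x + w x := funext hφ
    rw [hφ']
    exact dirAt_of_hasFDerivAt ((hasFDerivAt_id a).add hder)
      (injective_id_add (hnorm.trans_lt (by norm_num)))

/-- Invariants separating the orbits of the group generated by integer translations and the
central symmetry. -/
noncomputable def pillowMap (z : Plane) : ℝ × ℝ × ℝ :=
  (Real.cos (2 * Real.pi * z.1), Real.cos (2 * Real.pi * z.2),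
    Real.sin (2 * Real.pi * z.1) * Real.sin (2 * Real.pi * z.2))

theorem continuous_pillowMap : Continuous pillowMap := by
  unfold pillowMap; fun_prop

/-- The pillowcase: the quotient of the torus by the central symmetry. -/
def Pillow : Type := Quotient (Setoid.ker pillowMap)

instance : TopologicalSpace Pillow :=
  inferInstanceAs (TopologicalSpace (Quotient (Setoid.ker pillowMap)))

/-- The projection of the plane onto the pillowcase. -/
noncomputable def proj (z : Plane) : Pillow := Quotient.mk (Setoid.ker pillowMap) z

theorem continuous_proj : Continuous proj := continuous_quot_mk

theorem proj_surjective : Function.Surjective proj := Quotient.mk_surjective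

theorem proj_eq_iff_pillowMap {z z' : Plane} : proj z = proj z' ↔ pillowMap z = pillowMap z' :=
  Quotient.eq

instance : T2Space Pillow := by
  have hc : Continuous (Quotient.lift pillowMap fun _ _ h => h : Pillow → ℝ × ℝ × ℝ) :=
    continuous_pillowMap.quotient_lift _
  refine T2Space.of_injective_continuous (f := (Quotient.lift pillowMap fun _ _ h => h)) ?_ hc
  intro a b
  obtain ⟨z, rfl⟩ := proj_surjective a
  obtain ⟨z', rfl⟩ := proj_surjective b
  exact proj_eq_iff_pillowMap.2

theorem two_pi_mul_inj {x y : ℝ} (h : 2 * Real.pi * x = 2 * Real.pi * y) : x = y :=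
  mul_left_cancel₀ Real.two_pi_pos.ne' h

theorem sin_two_pi_eq_zero {x : ℝ} (h : Real.sin (2 * Real.pi * x) = 0) : ∃ k : ℤ, 2 * x = k := by
  obtain ⟨k, hk⟩ := Real.sin_eq_zero_iff.1 h
  refine ⟨k, mul_right_cancel₀ Real.pi_pos.ne' ?_⟩
  linarith

theorem cos_two_pi_eq {x y : ℝ} (h : Real.cos (2 * Real.pi * x) = Real.cos (2 * Real.pi * y)) :
    ∃ n : ℤ, y = x + n ∨ y = n - x := by
  obtain ⟨k, hk | hk⟩ := Real.cos_eq_cos_iff.1 h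
  · exact ⟨k, Or.inl (two_pi_mul_inj (by linarith))⟩
  · exact ⟨k, Or.inr (two_pi_mul_inj (by linarith))⟩

theorem cos_two_pi_add (x : ℝ) (n : ℤ) :
    Real.cos (2 * Real.pi * (x + n)) = Real.cos (2 * Real.pi * x) := by
  rw [← Real.cos_add_int_mul_two_pi (2 * Real.pi * x) n]; ring_nf

theorem sin_two_pi_add (x : ℝ) (n : ℤ) :
    Real.sin (2 * Real.pi * (x + n)) = Real.sin (2 * Real.pi * x) := by
  rw [← Real.sin_add_int_mul_two_pi (2 * Real.pi * x) n]; ring_nf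

theorem cos_two_pi_sub (x : ℝ) (n : ℤ) :
    Real.cos (2 * Real.pi * (n - x)) = Real.cos (2 * Real.pi * x) := by
  rw [← Real.cos_neg (2 * Real.pi * x),
    ← Real.cos_add_int_mul_two_pi (-(2 * Real.pi * x)) n]
  ring_nf

theorem sin_two_pi_sub (x : ℝ) (n : ℤ) :
    Real.sin (2 * Real.pi * (n - x)) = -Real.sin (2 * Real.pi * x) := by
  rw [← Real.sin_neg (2 * Real.pi * x),
    ← Real.sin_add_int_mul_two_pi (-(2 * Real.pi * x)) n]
  ring_nf

theorem proj_eq_iff {z z' : Plane} : proj z = proj z' ↔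
    ∃ n m : ℤ, z' = (z.1 + n, z.2 + m) ∨ z' = (n - z.1, m - z.2) := by
  rw [proj_eq_iff_pillowMap]
  constructor
  · intro h
    simp only [pillowMap, Prod.mk.injEq] at h
    obtain ⟨h1, h2, h3⟩ := h
    obtain ⟨n, hn⟩ := cos_two_pi_eq h1
    obtain ⟨m, hm⟩ := cos_two_pi_eq h2
    rcases hn with hn | hn <;> rcases hm with hm | hm
    · exact ⟨n, m, Or.inl (Prod.ext hn hm)⟩
    · rw [hn, hm, sin_two_pi_add, sin_two_pi_sub] at h3
      have h4 : Real.sin (2 * Real.pi * z.1) * Real.sin (2 * Real.pi * z.2) = 0 := by linarith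
      rcases mul_eq_zero.1 h4 with h5 | h5 <;> obtain ⟨k, hk⟩ := sin_two_pi_eq_zero h5
      · exact ⟨n + k, m, Or.inr (Prod.ext (by push_cast; linarith) hm)⟩
      · exact ⟨n, m - k, Or.inl (Prod.ext hn (by push_cast; linarith))⟩
    · rw [hn, hm, sin_two_pi_add, sin_two_pi_sub] at h3
      have h4 : Real.sin (2 * Real.pi * z.1) * Real.sin (2 * Real.pi * z.2) = 0 := by linarith
      rcases mul_eq_zero.1 h4 with h5 | h5 <;> obtain ⟨k, hk⟩ := sin_two_pi_eq_zero h5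
      · exact ⟨n - k, m, Or.inl (Prod.ext (by push_cast; linarith) hm)⟩
      · exact ⟨n, m + k, Or.inr (Prod.ext hn (by push_cast; linarith))⟩
    · exact ⟨n, m, Or.inr (Prod.ext hn hm)⟩
  · rintro ⟨n, m, rfl | rfl⟩
    · simp only [pillowMap, cos_two_pi_add, sin_two_pi_add]
    · simp only [pillowMap, cos_two_pi_sub, sin_two_pi_sub, neg_mul_neg]

theorem proj_add (z : Plane) (n m : ℤ) : proj (z.1 + n, z.2 + m) = proj z :=
  (proj_eq_iff.2 ⟨n, m, Or.inl rfl⟩).symm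

theorem proj_sub (z : Plane) (n m : ℤ) : proj (n - z.1, m - z.2) = proj z :=
  (proj_eq_iff.2 ⟨n, m, Or.inr rfl⟩).symm

/-- The projection is locally injective away from the lines where the first coordinate is a
half-integer. -/
theorem eventually_eq_of_proj_eq {a : Plane} (ha : ∀ n : ℤ, 2 * a.1 ≠ n) :
    ∀ᶠ z in 𝓝 a ×ˢ 𝓝 a, proj z.1 = proj z.2 → z.1 = z.2 := by
  have hc : IsClosed (range ((↑) : ℤ → ℝ)) := Int.isClosedEmbedding_coe_real.isClosed_range
  have hsum : ∀ᶠ z : Plane × Plane in 𝓝 (a, a), z.1.1 + z.2.1 ∉ range ((↑) : ℤ → ℝ) := by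
    have : Continuous fun z : Plane × Plane => z.1.1 + z.2.1 := by fun_prop
    refine this.continuousAt.eventually (hc.isOpen_compl.mem_nhds ?_)
    rintro ⟨n, hn⟩
    exact ha n (by rw [hn]; ring)
  have hdist : ∀ᶠ z : Plane × Plane in 𝓝 (a, a), ‖z.2 - z.1‖ < 1 := by
    have : Continuous fun z : Plane × Plane => ‖z.2 - z.1‖ := by fun_prop
    refine this.continuousAt.eventually (gt_mem_nhds ?_)
    simp
  rw [← nhds_prod_eq]
  filter_upwards [hsum, hdist] with z h1 h2 h
  obtain ⟨n, m, h3 | h3⟩ := proj_eq_iff.1 h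
  · have e1 : z.2.1 - z.1.1 = n := by rw [h3]; ring
    have e2 : z.2.2 - z.1.2 = m := by rw [h3]; ring
    rw [Prod.norm_def, max_lt_iff, Prod.fst_sub, Prod.snd_sub, e1, e2, Real.norm_eq_abs,
      Real.norm_eq_abs] at h2
    have hn : n = 0 := Int.abs_lt_one_iff.1 (by exact_mod_cast h2.1)
    have hm : m = 0 := Int.abs_lt_one_iff.1 (by exact_mod_cast h2.2)
    rw [h3, hn, hm]
    simp
  · exact absurd ⟨n, by rw [h3]; ring⟩ h1

/-- A hyperbolic unimodular matrix. -/
noncomputable def catEquiv : Plane ≃L[ℝ] Plane :=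
  ContinuousLinearEquiv.equivOfInverse
    ((ContinuousLinearMap.fst ℝ ℝ ℝ + (4 : ℝ) • ContinuousLinearMap.snd ℝ ℝ ℝ).prod
      ((4 : ℝ) • ContinuousLinearMap.fst ℝ ℝ ℝ + (17 : ℝ) • ContinuousLinearMap.snd ℝ ℝ ℝ))
    (((17 : ℝ) • ContinuousLinearMap.fst ℝ ℝ ℝ - (4 : ℝ) • ContinuousLinearMap.snd ℝ ℝ ℝ).prod
      (ContinuousLinearMap.snd ℝ ℝ ℝ - (4 : ℝ) • ContinuousLinearMap.fst ℝ ℝ ℝ))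
    (fun z => by ext <;> simp <;> ring) (fun z => by ext <;> simp <;> ring)

theorem catEquiv_apply (z : Plane) : catEquiv z = (z.1 + 4 * z.2, 4 * z.1 + 17 * z.2) := rfl

theorem catEquiv_symm_apply (z : Plane) :
    catEquiv.symm z = (17 * z.1 - 4 * z.2, z.2 - 4 * z.1) := rfl

theorem proj_catEquiv {z z' : Plane} (h : proj z = proj z') :
    proj (catEquiv z) = proj (catEquiv z') := by
  obtain ⟨n, m, rfl | rfl⟩ := proj_eq_iff.1 h
  · refine proj_eq_iff.2 ⟨n + 4 * m, 4 * n + 17 * m, Or.inl ?_⟩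
    ext <;> simp [catEquiv_apply] <;> ring
  · refine proj_eq_iff.2 ⟨n + 4 * m, 4 * n + 17 * m, Or.inr ?_⟩
    ext <;> simp [catEquiv_apply] <;> ring

theorem proj_catEquiv_symm {z z' : Plane} (h : proj z = proj z') :
    proj (catEquiv.symm z) = proj (catEquiv.symm z') := by
  obtain ⟨n, m, rfl | rfl⟩ := proj_eq_iff.1 h
  · refine proj_eq_iff.2 ⟨17 * n - 4 * m, m - 4 * n, Or.inl ?_⟩
    ext <;> simp [catEquiv_symm_apply] <;> ring
  · refine proj_eq_iff.2 ⟨17 * n - 4 * m, m - 4 * n, Or.inr ?_⟩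
    ext <;> simp [catEquiv_symm_apply] <;> ring

/-- The homeomorphism of the pillowcase induced by the hyperbolic matrix. -/
noncomputable def catMap : Pillow ≃ₜ Pillow where
  toFun := Quotient.map catEquiv fun _ _ h =>
    proj_eq_iff_pillowMap.1 (proj_catEquiv (proj_eq_iff_pillowMap.2 h))
  invFun := Quotient.map catEquiv.symm fun _ _ h =>
    proj_eq_iff_pillowMap.1 (proj_catEquiv_symm (proj_eq_iff_pillowMap.2 h))
  left_inv := by
    intro a
    obtain ⟨z, rfl⟩ := proj_surjective a
    exact congrArg proj (catEquiv.symm_apply_apply z)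
  right_inv := by
    intro a
    obtain ⟨z, rfl⟩ := proj_surjective a
    exact congrArg proj (catEquiv.apply_symm_apply z)
  continuous_toFun := catEquiv.continuous.quotient_map' _
  continuous_invFun := catEquiv.symm.continuous.quotient_map' _

theorem catMap_proj (z : Plane) : catMap (proj z) = proj (catEquiv z) := rfl

/-- Bounded multiples of an irrational number are uniformly dense modulo one. -/
theorem exists_bound_nat_mul_near {s : ℝ} (hs : Irrational s) {δ : ℝ} (hδ : 0 < δ) :
    ∃ L : ℝ, ∀ w : ℝ, ∃ k : ℕ, (k : ℝ) ≤ L ∧ ∃ m : ℤ, |w + k * s - m| < δ := by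
  obtain ⟨N, hN⟩ := exists_nat_gt (1 / δ)
  have hN0 : 0 < N := by
    have : (0 : ℝ) < N := (by positivity : 0 < 1 / δ).trans hN
    exact_mod_cast this
  obtain ⟨j, k, hk0, -, hjk⟩ := Real.exists_int_int_abs_mul_sub_le s hN0
  lift k to ℕ using hk0.le
  set η := (k : ℝ) * s - j with hη
  have hηδ : |η| < δ := by
    refine lt_of_le_of_lt (by exact_mod_cast hjk) ?_
    rw [div_lt_iff₀ (by positivity)]
    rw [div_lt_iff₀ hδ] at hN
    push_cast
    nlinarith
  have hη0 : η ≠ 0 := by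
    intro h
    refine (irrational_iff_ne_rational s).1 hs j k (by exact_mod_cast hk0.ne') ?_
    have : (k : ℝ) ≠ 0 := by exact_mod_cast hk0.ne'
    field_simp
    push_cast
    linarith
  have key : ∀ w : ℝ, ∃ i : ℕ, (i : ℝ) ≤ 1 / |η| ∧ ∃ m : ℤ, |w + i * η - m| < δ := by
    intro w
    have hpos : 0 < |η| := abs_pos.2 hη0
    have aux : ∀ r : ℝ, 0 ≤ r → r < 1 → ∃ i : ℕ, (i : ℝ) ≤ 1 / |η| ∧ |r - i * (|η|)| < δ := by
      intro r hr0 hr1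
      have h0 : 0 ≤ r / |η| := by positivity
      have h1 := Nat.floor_le h0
      have h2 := Nat.lt_floor_add_one (r / |η|)
      rw [le_div_iff₀ hpos] at h1
      rw [div_lt_iff₀ hpos] at h2
      refine ⟨⌊r / |η|⌋₊, ?_, ?_⟩
      · rw [le_div_iff₀ hpos]; linarith
      · rw [abs_lt]; constructor <;> linarith
    rcases lt_or_gt_of_ne hη0 with hneg | hp
    · obtain ⟨i, hi, hr⟩ := aux (Int.fract w) (Int.fract_nonneg w) (Int.fract_lt_one w)
      refine ⟨i, hi, ⌊w⌋, ?_⟩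
      convert hr using 2
      rw [abs_of_neg hneg, Int.fract]
      ring
    · obtain ⟨i, hi, hr⟩ := aux (Int.fract (-w)) (Int.fract_nonneg _) (Int.fract_lt_one _)
      refine ⟨i, hi, -⌊-w⌋, ?_⟩
      rw [← abs_neg] at hr
      convert hr using 2
      rw [abs_of_pos hp, Int.fract]
      push_cast
      ring
  refine ⟨k * (1 / |η|), fun w => ?_⟩
  obtain ⟨i, hi, m, hm⟩ := key w
  refine ⟨k * i, by push_cast; gcongr, m + i * j, ?_⟩
  convert hm using 2
  push_cast
  rw [hη]
  ring

/-- Slope of the expanding direction. -/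
noncomputable def slope : ℝ := 2 + √5

/-- The expanding eigenvalue. -/
noncomputable def expansion : ℝ := 9 + 4 * √5

theorem catEquiv_eigen (t : ℝ) :
    catEquiv (t, t * slope) = (expansion * t, expansion * t * slope) := by
  have h5 : √5 * √5 = 5 := Real.mul_self_sqrt (by norm_num)
  rw [catEquiv_apply]
  refine Prod.ext ?_ ?_
  · simp only [slope, expansion]; ring
  · simp only [slope, expansion]; linear_combination (-4 * t) * h5

theorem irrational_slope : Irrational slope := by
  have : Irrational √5 := by
    have := (show Nat.Prime 5 by norm_num).irrational_sqrt
    exact_mod_cast this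
  exact_mod_cast this.natCast_add 2

theorem one_lt_expansion : 1 < expansion := by
  have := Real.sqrt_nonneg 5
  rw [expansion]; linarith

theorem exists_bound_line_near {δ : ℝ} (hδ : 0 < δ) : ∃ L : ℝ, 0 ≤ L ∧ ∀ z : Plane, ∃ t : ℝ,
    |t| ≤ L ∧ ∃ n m : ℤ, ‖z + (t, t * slope) - ((n : ℝ), (m : ℝ))‖ < δ := by
  obtain ⟨L, hL⟩ := exists_bound_nat_mul_near irrational_slope hδ
  have hL0 : 0 ≤ L := by
    obtain ⟨k, hk, -⟩ := hL 0
    exact (Nat.cast_nonneg k).trans hk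
  refine ⟨L + 1, by linarith, fun z => ?_⟩
  obtain ⟨k, hk, m, hm⟩ := hL (z.2 - Int.fract z.1 * slope)
  refine ⟨k - Int.fract z.1, ?_, ⌊z.1⌋ + k, m, ?_⟩
  · have := Int.fract_nonneg z.1
    have := Int.fract_lt_one z.1
    have : (0 : ℝ) ≤ k := Nat.cast_nonneg k
    rw [abs_le]
    constructor <;> linarith
  · rw [Prod.norm_def, max_lt_iff]
    constructor
    · have h0 : (z + ((k : ℝ) - Int.fract z.1, ((k : ℝ) - Int.fract z.1) * slope)
          - (((⌊z.1⌋ + k : ℤ) : ℝ), (m : ℝ))).1 = 0 := by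
        simp only [Prod.fst_sub, Prod.fst_add]
        push_cast
        linarith [Int.floor_add_fract z.1]
      rw [h0, norm_zero]
      exact hδ
    · rw [Real.norm_eq_abs]
      refine lt_of_eq_of_lt (congrArg abs ?_) hm
      simp only [Prod.snd_sub, Prod.snd_add]
      ring

theorem catMap_iterate_proj (n : ℕ) (z : Plane) : catMap^[n] (proj z) = proj (catEquiv^[n] z) := by
  induction n generalizing z with
  | zero => rfl
  | succ n ih => rw [Function.iterate_succ_apply, catMap_proj, ih, Function.iterate_succ_apply]

theorem catEquiv_iterate_add (n : ℕ) (a : Plane) (t : ℝ) :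
    catEquiv^[n] (a + (t, t * slope)) =
      catEquiv^[n] a + (expansion ^ n * t, expansion ^ n * t * slope) := by
  induction n generalizing a t with
  | zero => simp
  | succ n ih =>
    rw [Function.iterate_succ_apply, map_add, catEquiv_eigen, ih, Function.iterate_succ_apply,
      pow_succ]
    ring_nf

theorem catMap_mixing : TopologicallyMixing catMap := by
  rintro U V hU hV ⟨a, ha⟩ ⟨b, hb⟩
  obtain ⟨a, rfl⟩ := proj_surjective a
  obtain ⟨b, rfl⟩ := proj_surjective b
  obtain ⟨δ, hδ, hbV⟩ := Metric.isOpen_iff.1 (hV.preimage continuous_proj) b hb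
  have hline : Continuous fun t : ℝ => a + (t, t * slope) := by fun_prop
  obtain ⟨τ, hτ, haU⟩ := Metric.isOpen_iff.1 ((hU.preimage continuous_proj).preimage hline) 0
    (by
      change proj (a + (0, 0 * slope)) ∈ U
      rwa [zero_mul, show ((0 : ℝ), (0 : ℝ)) = (0 : Plane) from rfl, add_zero])
  obtain ⟨L, hL0, hL⟩ := exists_bound_line_near hδ
  obtain ⟨N, hN⟩ := pow_unbounded_of_one_lt ((L + 1) / τ) one_lt_expansion
  refine ⟨N, fun n hn => ?_⟩
  have hex : (L + 1) / τ < expansion ^ n :=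
    hN.trans_le (pow_le_pow_right₀ one_lt_expansion.le hn)
  have hex0 : 0 < expansion ^ n := pow_pos (by linarith [one_lt_expansion]) n
  obtain ⟨t, ht, i, j, hij⟩ := hL (catEquiv^[n] a - b)
  have htau : t / expansion ^ n ∈ Metric.ball (0 : ℝ) τ := by
    rw [mem_ball_zero_iff, Real.norm_eq_abs, abs_div, abs_of_pos hex0, div_lt_iff₀ hex0]
    rw [div_lt_iff₀ hτ] at hex
    linarith
  refine ⟨_, ⟨_, haU htau, rfl⟩, ?_⟩
  rw [catMap_iterate_proj, catEquiv_iterate_add, mul_div_cancel₀ _ hex0.ne']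
  set y := catEquiv^[n] a + (t, t * slope)
  have hy : proj (y.1 + ((-i : ℤ) : ℝ), y.2 + ((-j : ℤ) : ℝ)) ∈ V := by
    refine hbV ?_
    rw [mem_ball_iff_norm]
    refine lt_of_eq_of_lt (congrArg norm ?_) hij
    ext <;> simp [y] <;> ring
  rwa [proj_add] at hy

/-- The centre of the front face of the pillowcase. -/
noncomputable def quarter : Plane := (1 / 4, 1 / 4)

/-- The reflection exchanging the faces of the pillowcase. -/
noncomputable def mirror : Plane →L[ℝ] Plane :=
  (-ContinuousLinearMap.fst ℝ ℝ ℝ).prod (ContinuousLinearMap.snd ℝ ℝ ℝ)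

theorem mirror_apply (z : Plane) : mirror z = (-z.1, z.2) := rfl

theorem mirror_mirror (z : Plane) : mirror (mirror z) = z := by
  simp [mirror_apply]

theorem mirror_injective : Function.Injective mirror :=
  Function.LeftInverse.injective mirror_mirror

theorem norm_mirror (z : Plane) : ‖mirror z‖ = ‖z‖ := by
  rw [mirror_apply, Prod.norm_def, Prod.norm_def, norm_neg]

/-- Turning the punctured disc of radius `1/2` inside out. -/
noncomputable def invert (y : Plane) : Plane := ((1 / 2 - ‖y‖) / ‖y‖) • y

theorem norm_invert {y : Plane} (h0 : y ≠ 0) (h : ‖y‖ ≤ 1 / 2) : ‖invert y‖ = 1 / 2 - ‖y‖ := by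
  have := norm_pos_iff.2 h0
  rw [invert, norm_smul, Real.norm_of_nonneg (div_nonneg (by linarith) this.le),
    div_mul_cancel₀ _ this.ne']

theorem invert_invert {y : Plane} (h0 : y ≠ 0) (h : ‖y‖ < 1 / 2) : invert (invert y) = y := by
  have h1 := norm_pos_iff.2 h0
  have h2 : (1 / 2 : ℝ) - ‖y‖ ≠ 0 := by linarith
  rw [invert, norm_invert h0 h.le, invert, smul_smul]
  have h3 : (1 / 2 - (1 / 2 - ‖y‖)) / (1 / 2 - ‖y‖) * ((1 / 2 - ‖y‖) / ‖y‖) = 1 := by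
    rw [div_mul_div_cancel₀ h2, sub_sub_cancel, div_self h1.ne']
  rw [h3, one_smul]

theorem invert_of_norm_eq {y : Plane} (h : ‖y‖ = 1 / 4) : invert y = y := by
  rw [invert, h]; norm_num

theorem continuousAt_invert {y : Plane} (h0 : y ≠ 0) : ContinuousAt invert y := by
  have := norm_ne_zero_iff.2 h0
  unfold invert
  exact ((continuousAt_const.sub continuous_norm.continuousAt).div
    continuous_norm.continuousAt this).smul continuousAt_id

theorem dirAt_invert {a : Plane} (h0 : a ≠ 0) (h : ‖a‖ < 1 / 2) : DirAt invert a := by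
  have h1 := norm_pos_iff.2 h0
  have hk : HasDerivAt (fun t : ℝ => (1 / 2 - t) / t)
      (((-1) * ‖a‖ - (1 / 2 - ‖a‖) * 1) / ‖a‖ ^ 2) ‖a‖ :=
    ((hasDerivAt_id _).const_sub _).div (hasDerivAt_id _) h1.ne'
  refine dirAt_radial h0 hk (div_ne_zero (by linarith) h1.ne') ?_
  have : (1 / 2 - ‖a‖) / ‖a‖ + ((-1) * ‖a‖ - (1 / 2 - ‖a‖) * 1) / ‖a‖ ^ 2 * ‖a‖ = -1 := by
    field_simp
    ring
  rw [this]
  norm_num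

theorem dirAt_mirror (a : Plane) : DirAt mirror a :=
  dirAt_of_hasFDerivAt mirror.hasFDerivAt mirror_injective

open Classical in
/-- A lift to the plane of the map wrapping the unit square around the pillowcase; it collapses
the boundary to the centre of the back face. -/
noncomputable def fold (x : Plane) : Plane :=
  if ‖x - centre‖ ≤ 1 / 4 then quarter + (x - centre)
  else mirror (quarter + invert (x - centre))

/-- The centre of the back face of the pillowcase. -/
noncomputable def backCentre : Plane := mirror quarter

theorem fold_front {x : Plane} (h : ‖x - centre‖ ≤ 1 / 4) : fold x = quarter + (x - centre) :=
  if_pos h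

theorem fold_back {x : Plane} (h : 1 / 4 < ‖x - centre‖) :
    fold x = mirror (quarter + invert (x - centre)) :=
  if_neg h.not_ge

theorem fold_of_norm_eq {x : Plane} (h : ‖x - centre‖ = 1 / 2) : fold x = backCentre := by
  rw [fold_back (by rw [h]; norm_num), invert, h]
  simp [backCentre]

/-- On the seam some coordinate is a half-integer. -/
theorem seam_coord {y : Plane} (h : ‖y‖ = 1 / 4) :
    (∃ n : ℤ, 2 * (quarter + y).1 = n) ∨ ∃ n : ℤ, 2 * (quarter + y).2 = n := by
  have aux : ∀ r : ℝ, |r| = 1 / 4 → ∃ n : ℤ, 2 * (1 / 4 + r) = n := by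
    intro r hr
    rcases eq_or_eq_neg_of_abs_eq hr with rfl | rfl
    · exact ⟨1, by norm_num⟩
    · exact ⟨0, by norm_num⟩
  rw [Prod.norm_def] at h
  rcases max_choice ‖y.1‖ ‖y.2‖ with h' | h' <;> rw [h'] at h
  · exact Or.inl (aux _ h)
  · exact Or.inr (aux _ h)

theorem proj_mirror {z : Plane} (h : (∃ n : ℤ, 2 * z.1 = n) ∨ ∃ n : ℤ, 2 * z.2 = n) :
    proj (mirror z) = proj z := by
  rcases h with ⟨n, hn⟩ | ⟨n, hn⟩
  · rw [← proj_add z (-n) 0]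
    congr 1
    ext
    · simp only [mirror_apply]; push_cast; linarith
    · simp [mirror_apply]
  · rw [← proj_sub z 0 n]
    congr 1
    ext
    · simp [mirror_apply]
    · simp only [mirror_apply]; linarith

theorem proj_fold_of_ge {x : Plane} (h : 1 / 4 ≤ ‖x - centre‖) :
    proj (fold x) = proj (mirror (quarter + invert (x - centre))) := by
  rcases h.eq_or_lt with h | h
  · rw [fold_front h.ge, invert_of_norm_eq h.symm, proj_mirror (seam_coord h.symm)]
  · rw [fold_back h]

theorem continuous_proj_fold : Continuous (proj ∘ fold) := by
  have h : proj ∘ fold = fun x => open Classical in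
      if ‖x - centre‖ ≤ 1 / 4 then proj (quarter + (x - centre))
      else proj (mirror (quarter + invert (x - centre))) := by
    funext x
    simp only [Function.comp, fold]
    split_ifs <;> rfl
  rw [h]
  refine continuous_if_le (by fun_prop) continuous_const
    (continuous_proj.comp (by fun_prop)).continuousOn ?_ ?_
  · intro x hx
    have hx0 : x - centre ≠ 0 := by
      rw [← norm_pos_iff]
      exact lt_of_lt_of_le (by norm_num) hx
    have h1 : ContinuousAt (fun x => invert (x - centre)) x :=
      ContinuousAt.comp (f := fun x => x - centre) (continuousAt_invert hx0) (by fun_prop)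
    exact (continuous_proj.continuousAt.comp
      (mirror.continuous.continuousAt.comp (continuousAt_const.add h1))).continuousWithinAt
  · intro x hx
    rw [invert_of_norm_eq hx, proj_mirror (seam_coord hx)]

theorem quarter_add_mem {y : Plane} (h : ‖y‖ ≤ 1 / 4) :
    (quarter + y).1 ∈ Icc (0 : ℝ) (1 / 2) ∧ (quarter + y).2 ∈ Icc (0 : ℝ) (1 / 2) := by
  rw [Prod.norm_def, max_le_iff, Real.norm_eq_abs, Real.norm_eq_abs, abs_le, abs_le] at h
  simp only [quarter, Prod.fst_add, Prod.snd_add, mem_Icc]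
  refine ⟨⟨?_, ?_⟩, ?_, ?_⟩ <;> linarith [h.1.1, h.1.2, h.2.1, h.2.2]

theorem quarter_add_mem_Ioo {y : Plane} (h : ‖y‖ < 1 / 4) :
    (quarter + y).1 ∈ Ioo (0 : ℝ) (1 / 2) ∧ (quarter + y).2 ∈ Ioo (0 : ℝ) (1 / 2) := by
  rw [Prod.norm_def, max_lt_iff, Real.norm_eq_abs, Real.norm_eq_abs, abs_lt, abs_lt] at h
  simp only [quarter, Prod.fst_add, Prod.snd_add, mem_Ioo]
  refine ⟨⟨?_, ?_⟩, ?_, ?_⟩ <;> linarith [h.1.1, h.1.2, h.2.1, h.2.2]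

theorem cos_two_pi_inj {s t : ℝ} (hs : s ∈ Icc (0 : ℝ) (1 / 2)) (ht : t ∈ Icc (0 : ℝ) (1 / 2))
    (h : Real.cos (2 * Real.pi * s) = Real.cos (2 * Real.pi * t)) : s = t := by
  have aux : ∀ r ∈ Icc (0 : ℝ) (1 / 2), 2 * Real.pi * r ∈ Icc 0 Real.pi := fun r hr =>
    ⟨mul_nonneg Real.two_pi_pos.le hr.1, by nlinarith [Real.pi_pos, hr.2]⟩
  exact two_pi_mul_inj (Real.injOn_cos (aux s hs) (aux t ht) h)

theorem sin_two_pi_pos {s : ℝ} (hs : s ∈ Ioo (0 : ℝ) (1 / 2)) : 0 < Real.sin (2 * Real.pi * s) :=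
  Real.sin_pos_of_pos_of_lt_pi (mul_pos Real.two_pi_pos hs.1) (by nlinarith [Real.pi_pos, hs.2])

theorem pillowMap_mirror (z : Plane) : pillowMap (mirror z) =
    ((pillowMap z).1, (pillowMap z).2.1, -(pillowMap z).2.2) := by
  simp only [pillowMap, mirror_apply, mul_neg, Real.cos_neg, Real.sin_neg, neg_mul]

theorem eq_of_pillowMap_cos {y y' : Plane} (h : ‖y‖ ≤ 1 / 4) (h' : ‖y'‖ ≤ 1 / 4)
    (h1 : (pillowMap (quarter + y)).1 = (pillowMap (quarter + y')).1)
    (h2 : (pillowMap (quarter + y)).2.1 = (pillowMap (quarter + y')).2.1) : y = y' :=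
  add_left_cancel (Prod.ext
    (cos_two_pi_inj (quarter_add_mem h).1 (quarter_add_mem h').1 h1)
    (cos_two_pi_inj (quarter_add_mem h).2 (quarter_add_mem h').2 h2))

theorem proj_front_ne_back {y y' : Plane} (h : ‖y‖ ≤ 1 / 4) (h' : ‖y'‖ < 1 / 4) :
    proj (quarter + y) ≠ proj (mirror (quarter + y')) := by
  intro he
  rw [proj_eq_iff_pillowMap, pillowMap_mirror] at he
  have e1 := congrArg Prod.fst he
  have e2 := congrArg (fun p => p.2.1) he
  have e3 := congrArg (fun p => p.2.2) he
  obtain rfl := eq_of_pillowMap_cos h h'.le e1 e2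
  have := quarter_add_mem_Ioo h'
  have := mul_pos (sin_two_pi_pos this.1) (sin_two_pi_pos this.2)
  simp only [pillowMap] at e3
  linarith

theorem norm_invert_back {y : Plane} (h : 1 / 4 < ‖y‖) (h' : ‖y‖ ≤ 1 / 2) :
    ‖invert y‖ < 1 / 4 := by
  rw [norm_invert (norm_pos_iff.1 (by linarith)) h']
  linarith

theorem eq_of_proj_fold_eq {x x' : Plane} (hx : x ∈ unitSquare) (hx' : x' ∈ unitSquare)
    (h : proj (fold x) = proj (fold x')) : x = x' ∨ x ∉ openSquare ∧ x' ∉ openSquare := by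
  rw [← norm_sub_centre_le] at hx hx'
  rcases le_or_gt ‖x - centre‖ (1 / 4) with hf | hf <;>
    rcases le_or_gt ‖x' - centre‖ (1 / 4) with hf' | hf'
  · rw [fold_front hf, fold_front hf', proj_eq_iff_pillowMap] at h
    exact Or.inl (sub_left_injective (eq_of_pillowMap_cos hf hf' (by rw [h]) (by rw [h])))
  · rw [fold_front hf, fold_back hf'] at h
    exact absurd h (proj_front_ne_back hf (norm_invert_back hf' hx'))
  · rw [fold_front hf', fold_back hf] at h
    exact absurd h.symm (proj_front_ne_back hf' (norm_invert_back hf hx))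
  · rw [fold_back hf, fold_back hf', proj_eq_iff_pillowMap, pillowMap_mirror,
      pillowMap_mirror] at h
    have e1 := congrArg Prod.fst h
    have e2 := congrArg (fun p => p.2.1) h
    have e := eq_of_pillowMap_cos (norm_invert_back hf hx).le (norm_invert_back hf' hx').le e1 e2
    have h0 : x - centre ≠ 0 := norm_pos_iff.1 (by linarith)
    have h0' : x' - centre ≠ 0 := norm_pos_iff.1 (by linarith)
    have hn := congrArg norm e
    rw [norm_invert h0 hx, norm_invert h0' hx'] at hn
    rcases hx.eq_or_lt with hb | hb
    · right
      rw [← norm_sub_centre_lt, ← norm_sub_centre_lt]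
      constructor <;> linarith
    · left
      have := congrArg invert e
      rw [invert_invert h0 hb, invert_invert h0' (by linarith)] at this
      exact sub_left_injective this

theorem exists_proj_fold_eq (d : Pillow) : ∃ x ∈ unitSquare, proj (fold x) = d := by
  have hnorm : ∀ s t : ℝ, 0 ≤ s → s ≤ 1 / 2 → 0 ≤ t → t ≤ 1 / 2 →
      ‖((s, t) : Plane) - quarter‖ ≤ 1 / 4 := by
    intro s t h1 h2 h3 h4
    rw [Prod.norm_def, max_le_iff, Real.norm_eq_abs, Real.norm_eq_abs, abs_le, abs_le]
    simp only [quarter, Prod.fst_sub, Prod.snd_sub]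
    refine ⟨⟨?_, ?_⟩, ?_, ?_⟩ <;> linarith
  have key : ∀ s t : ℝ, |s| ≤ 1 / 2 → 0 ≤ t → t ≤ 1 / 2 →
      ∃ x ∈ unitSquare, proj (fold x) = proj (s, t) := by
    intro s t hs ht0 ht
    rw [abs_le] at hs
    rcases le_or_gt 0 s with h0 | h0
    · have hq := hnorm s t h0 hs.2 ht0 ht
      have e : centre + ((s, t) - quarter) - centre = (s, t) - quarter := by abel
      refine ⟨centre + ((s, t) - quarter), ?_, ?_⟩
      · rw [← norm_sub_centre_le, e]; linarith
      · rw [fold_front (by rwa [e]), e]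
        congr 1
        abel
    · have hq := hnorm (-s) t (by linarith) (by linarith) ht0 ht
      have hst : ((s, t) : Plane) = mirror (quarter + ((-s, t) - quarter)) := by
        rw [add_sub_cancel]; simp [mirror_apply]
      rcases eq_or_ne ((-s, t) - quarter : Plane) 0 with hz | hz
      · refine ⟨0, by simp [unitSquare, Prod.le_def], ?_⟩
        rw [fold_of_norm_eq, hst, hz, add_zero, backCentre]
        simp [centre, Prod.norm_def]
      · have e : centre + invert ((-s, t) - quarter) - centre = invert ((-s, t) - quarter) := by
          abel
        refine ⟨centre + invert ((-s, t) - quarter), ?_, ?_⟩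
        · rw [← norm_sub_centre_le, e, norm_invert hz (by linarith)]
          linarith [norm_nonneg ((-s, t) - quarter : Plane)]
        · rw [proj_fold_of_ge, e, invert_invert hz (by linarith), hst]
          rw [e, norm_invert hz (by linarith)]
          linarith
  obtain ⟨z, rfl⟩ := proj_surjective d
  have h1 := abs_sub_round z.1
  have h2 := abs_sub_round z.2
  rcases le_total 0 (z.2 - round z.2) with h | h
  · obtain ⟨x, hx, he⟩ := key _ _ h1 h ((le_abs_self _).trans h2)
    refine ⟨x, hx, ?_⟩
    rw [he, ← proj_add z (-round z.1) (-round z.2)]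
    push_cast
    rfl
  · rw [← abs_neg] at h1 h2
    obtain ⟨x, hx, he⟩ := key _ _ h1 (neg_nonneg.2 h) ((le_abs_self _).trans h2)
    refine ⟨x, hx, ?_⟩
    rw [he, ← proj_sub z (round z.1) (round z.2), neg_sub, neg_sub]

theorem dirAt_fold {a : Plane} (ha : a ∈ openSquare) (h : ‖a - centre‖ ≠ 1 / 4) :
    DirAt fold a := by
  have hc : Continuous fun x : Plane => ‖x - centre‖ := by fun_prop
  rw [← norm_sub_centre_lt] at ha
  rcases lt_or_gt_of_ne h with h | h
  · refine (dirAt_add_const (quarter - centre) a).congr ?_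
    filter_upwards [hc.continuousAt.eventually (gt_mem_nhds h)] with x hx
    rw [fold_front hx.le]
    abel
  · have h0 : a - centre ≠ 0 := norm_pos_iff.1 (by linarith)
    have h1 : DirAt (fun x => x + (-centre)) a := dirAt_add_const _ a
    have h2 : DirAt invert (a + (-centre)) := by
      rw [← sub_eq_add_neg]; exact dirAt_invert h0 ha
    refine ((dirAt_mirror _).comp ((dirAt_add_const quarter _).comp
      (h2.comp (f := fun x => x + (-centre)) h1))).congr ?_
    filter_upwards [hc.continuousAt.eventually (lt_mem_nhds h)] with x hx
    rw [fold_back hx, sub_eq_add_neg, add_comm]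
    rfl

theorem tendsto_fold_boundary {b : Plane} (hb : ‖b - centre‖ = 1 / 2) :
    Tendsto fold (𝓝[openSquare] b) (approach backCentre (dir (mirror (b - centre)))) := by
  have hc : Continuous fun x : Plane => ‖x - centre‖ := by fun_prop
  have hb0 : b - centre ≠ 0 := norm_pos_iff.1 (by rw [hb]; norm_num)
  have hev : ∀ᶠ x in 𝓝[openSquare] b, 1 / 4 < ‖x - centre‖ ∧ ‖x - centre‖ < 1 / 2 := by
    refine (Filter.Eventually.filter_mono nhdsWithin_le_nhds (hc.continuousAt.eventually
      (lt_mem_nhds (a := 1 / 4) (by simp only [hb]; norm_num)))).and ?_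
    filter_upwards [self_mem_nhdsWithin] with x hx
    exact norm_sub_centre_lt.2 hx
  have hpos : ∀ {x : Plane}, 1 / 4 < ‖x - centre‖ → ‖x - centre‖ < 1 / 2 →
      0 < (1 / 2 - ‖x - centre‖) / ‖x - centre‖ := fun h h' =>
    div_pos (by linarith) (by linarith)
  have hdiff : ∀ {x : Plane}, 1 / 4 < ‖x - centre‖ → fold x - backCentre =
      ((1 / 2 - ‖x - centre‖) / ‖x - centre‖) • mirror (x - centre) := by
    intro x h
    rw [fold_back h, backCentre, map_add, add_sub_cancel_left, invert, map_smul]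
  refine tendsto_approach.2 ⟨?_, ?_, ?_⟩
  · have h1 : ContinuousAt (fun x => invert (x - centre)) b :=
      ContinuousAt.comp (f := fun x => x - centre) (continuousAt_invert hb0) (by fun_prop)
    have h2 := (mirror.continuous.continuousAt.comp ((continuousAt_const (y := quarter)).add
      h1)).tendsto.mono_left (nhdsWithin_le_nhds (s := openSquare))
    rw [← fold_of_norm_eq hb, fold_back (by rw [hb]; norm_num)]
    refine h2.congr' ?_
    filter_upwards [hev] with x hx
    exact (fold_back hx.1).symm
  · filter_upwards [hev] with x hx he
    have := hdiff hx.1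
    rw [he, sub_self] at this
    rcases smul_eq_zero.1 this.symm with h | h
    · exact (hpos hx.1 hx.2).ne' h
    · rw [← norm_eq_zero, norm_mirror] at h
      linarith [hx.1]
  · have h1 : mirror (b - centre) ≠ 0 := by
      rw [← norm_ne_zero_iff, norm_mirror, hb]; norm_num
    have h2 : ContinuousAt (fun x => dir (mirror (x - centre))) b :=
      ContinuousAt.comp (f := fun x => mirror (x - centre)) (continuousAt_dir h1) (by fun_prop)
    refine (h2.tendsto.mono_left nhdsWithin_le_nhds).congr' ?_
    filter_upwards [hev] with x hx
    rw [hdiff hx.1, dir_smul (hpos hx.1 hx.2)]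

theorem isAlgebraic_ofNat_real (n : ℕ) [n.AtLeastTwo] : IsAlgebraic ℤ (ofNat(n) : ℝ) :=
  isAlgebraic_natCast n

theorem isAlgebraic_sqrt_five : IsAlgebraic ℤ √5 := by
  refine IsAlgebraic.of_pow (n := 2) two_pos ?_
  rw [Real.sq_sqrt (by norm_num)]
  exact isAlgebraic_ofNat_real 5

theorem isAlgebraic_slope : IsAlgebraic ℤ slope :=
  (isAlgebraic_ofNat_real 2).add isAlgebraic_sqrt_five

theorem isAlgebraic_expansion : IsAlgebraic ℤ expansion :=
  (isAlgebraic_ofNat_real 9).add ((isAlgebraic_ofNat_real 4).mul isAlgebraic_sqrt_five)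

theorem isAlgebraic_expansion_zpow (k : ℤ) : IsAlgebraic ℤ (expansion ^ k) := by
  cases k with
  | ofNat k => simpa using isAlgebraic_expansion.pow k
  | negSucc k => simpa using (isAlgebraic_expansion.pow (k + 1)).inv

theorem expansion_ne_zero : expansion ≠ 0 := by linarith [one_lt_expansion]

theorem slope_ne_zero : slope ≠ 0 := by
  have := Real.sqrt_nonneg 5
  rw [slope]
  positivity

/-- Parameters on the expanding line: the orbit of a transcendental number. -/
def seeds : Set ℝ := {τ | ∃ k : ℤ, τ = expansion ^ k * liouvilleNumber 2 ∨
  τ = -(expansion ^ k * liouvilleNumber 2)}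

theorem countable_seeds : seeds.Countable := by
  refine ((countable_range fun k : ℤ => expansion ^ k * liouvilleNumber 2).union
    (countable_range fun k : ℤ => -(expansion ^ k * liouvilleNumber 2))).mono ?_
  rintro τ ⟨k, h | h⟩
  · exact Or.inl ⟨k, h.symm⟩
  · exact Or.inr ⟨k, h.symm⟩

theorem not_isAlgebraic_of_mem_seeds {τ : ℝ} (h : τ ∈ seeds) : ¬ IsAlgebraic ℤ τ := by
  intro ha
  refine transcendental_liouvilleNumber (m := 2) le_rfl ?_
  obtain ⟨k, h⟩ := h
  have hk : expansion ^ k ≠ 0 := zpow_ne_zero k expansion_ne_zero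
  have hi := (isAlgebraic_expansion_zpow k).inv
  rcases h with h | h
  · have := hi.mul ha
    rwa [h, inv_mul_cancel_left₀ hk] at this
  · have := hi.mul ha.neg
    rwa [h, neg_neg, inv_mul_cancel_left₀ hk] at this

theorem irrational_of_not_isAlgebraic {x : ℝ} (h : ¬ IsAlgebraic ℤ x) : Irrational x := by
  rintro ⟨q, rfl⟩
  refine h ?_
  rw [Rat.cast_def, div_eq_mul_inv]
  exact (isAlgebraic_intCast q.num).mul (isAlgebraic_natCast q.den).inv

theorem neg_mem_seeds {τ : ℝ} (h : τ ∈ seeds) : -τ ∈ seeds := by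
  obtain ⟨k, rfl | rfl⟩ := h
  · exact ⟨k, Or.inr rfl⟩
  · exact ⟨k, Or.inl (neg_neg _)⟩

theorem mul_mem_seeds {τ : ℝ} (h : τ ∈ seeds) (j : ℤ) : expansion ^ j * τ ∈ seeds := by
  obtain ⟨k, rfl | rfl⟩ := h
  · exact ⟨j + k, Or.inl (by rw [zpow_add₀ expansion_ne_zero, mul_assoc])⟩
  · exact ⟨j + k, Or.inr (by rw [zpow_add₀ expansion_ne_zero, mul_assoc, mul_neg])⟩

/-- A countable dense set of points with irrational coordinates, invariant under the hyperbolic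
matrix, integer translations and the central symmetry. -/
def marked : Set Plane := {z | ∃ τ ∈ seeds, ∃ a b : ℚ, z = (τ + a, τ * slope + b)}

theorem countable_marked : marked.Countable := by
  have : marked ⊆ (fun p : ℝ × ℚ × ℚ => ((p.1 + p.2.1, p.1 * slope + p.2.2) : Plane)) ''
      (seeds ×ˢ univ) := by
    rintro z ⟨τ, hτ, a, b, rfl⟩
    exact ⟨(τ, a, b), ⟨hτ, mem_univ _⟩, rfl⟩
  exact ((countable_seeds.prod countable_univ).image _).mono this

theorem dense_marked : Dense marked := by
  have h1 : DenseRange (Prod.map ((↑) : ℚ → ℝ) ((↑) : ℚ → ℝ)) :=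
    Rat.denseRange_cast.prodMap Rat.denseRange_cast
  set τ := liouvilleNumber 2
  have h2 : DenseRange ((Homeomorph.addLeft ((τ, τ * slope) : Plane)) ∘
      (Prod.map ((↑) : ℚ → ℝ) ((↑) : ℚ → ℝ))) :=
    (Homeomorph.addLeft _).surjective.denseRange.comp h1 (Homeomorph.addLeft _).continuous
  refine Dense.mono ?_ h2
  rintro _ ⟨⟨a, b⟩, rfl⟩
  exact ⟨τ, ⟨0, Or.inl (by simp [τ])⟩, a, b, rfl⟩

theorem irrational_fst_of_mem_marked {z : Plane} (h : z ∈ marked) : Irrational z.1 := by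
  obtain ⟨τ, hτ, a, b, rfl⟩ := h
  exact (irrational_of_not_isAlgebraic (not_isAlgebraic_of_mem_seeds hτ)).add_ratCast a

theorem irrational_snd_of_mem_marked {z : Plane} (h : z ∈ marked) : Irrational z.2 := by
  obtain ⟨τ, hτ, a, b, rfl⟩ := h
  refine (irrational_of_not_isAlgebraic fun ha => ?_).add_ratCast b
  refine not_isAlgebraic_of_mem_seeds hτ ?_
  have := ha.mul isAlgebraic_slope.inv
  rwa [mul_inv_cancel_right₀ slope_ne_zero] at this

theorem mem_marked_of_proj_eq {z z' : Plane} (h : proj z = proj z') (hz : z ∈ marked) :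
    z' ∈ marked := by
  obtain ⟨τ, hτ, a, b, rfl⟩ := hz
  obtain ⟨n, m, rfl | rfl⟩ := proj_eq_iff.1 h
  · exact ⟨τ, hτ, a + n, b + m, by push_cast; ring_nf⟩
  · exact ⟨-τ, neg_mem_seeds hτ, n - a, m - b, by push_cast; ring_nf⟩

theorem catEquiv_mem_marked {z : Plane} (hz : z ∈ marked) : catEquiv z ∈ marked := by
  obtain ⟨τ, hτ, a, b, rfl⟩ := hz
  refine ⟨expansion * τ, by simpa using mul_mem_seeds hτ 1, a + 4 * b, 4 * a + 17 * b, ?_⟩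
  have : ((τ + a, τ * slope + b) : Plane) = (τ, τ * slope) + ((a : ℝ), (b : ℝ)) := rfl
  rw [this, map_add, catEquiv_eigen, catEquiv_apply]
  ext <;> simp

theorem catEquiv_symm_mem_marked {z : Plane} (hz : z ∈ marked) : catEquiv.symm z ∈ marked := by
  obtain ⟨τ, hτ, a, b, rfl⟩ := hz
  refine ⟨expansion⁻¹ * τ, by simpa using mul_mem_seeds hτ (-1), 17 * a - 4 * b, b - 4 * a, ?_⟩
  rw [ContinuousLinearEquiv.symm_apply_eq]
  have h := catEquiv_eigen (expansion⁻¹ * τ)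
  rw [mul_inv_cancel_left₀ expansion_ne_zero] at h
  have : ((expansion⁻¹ * τ + (17 * a - 4 * b : ℚ), expansion⁻¹ * τ * slope + (b - 4 * a : ℚ)) :
      Plane) = (expansion⁻¹ * τ, expansion⁻¹ * τ * slope) +
        (((17 * a - 4 * b : ℚ) : ℝ), ((b - 4 * a : ℚ) : ℝ)) := rfl
  rw [this, map_add, h, catEquiv_apply]
  ext <;> simp <;> ring

/-- The points of the square whose image in the pillowcase is marked. -/
def markedSquare : Set Plane := openSquare ∩ fold ⁻¹' marked

theorem countable_markedSquare : markedSquare.Countable := by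
  refine MapsTo.countable_of_injOn (f := fold) (t := marked) (fun x hx => hx.2) ?_
    countable_marked
  intro x hx y hy h
  exact (eq_of_proj_fold_eq (openSquare_subset hx.1) (openSquare_subset hy.1)
    (congrArg proj h)).resolve_right fun h' => h'.1 hx.1

theorem norm_ne_of_fold_mem_marked {x : Plane} (h : fold x ∈ marked) : ‖x - centre‖ ≠ 1 / 4 := by
  intro hx
  rw [fold_front hx.le] at h
  rcases seam_coord hx with ⟨n, hn⟩ | ⟨n, hn⟩
  · exact (irrational_fst_of_mem_marked h).ne_rat (n / 2) (by push_cast; linarith)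
  · exact (irrational_snd_of_mem_marked h).ne_rat (n / 2) (by push_cast; linarith)

theorem mem_closure_markedSquare_aux {g : Plane → Plane} {x z : Plane} (hg : ContinuousAt g z)
    (hz : g z = x) (h : ∀ᶠ w in 𝓝 z, g w ∈ openSquare ∧ fold (g w) = w) :
    x ∈ closure markedSquare := by
  rw [← hz]
  have h1 : ∃ᶠ w in 𝓝 z, w ∈ marked := mem_closure_iff_frequently.1 (dense_marked z)
  have h2 : ∃ᶠ w in 𝓝 z, g w ∈ markedSquare := by
    refine (h1.and_eventually h).mono fun w hw => ⟨hw.2.1, ?_⟩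
    rw [mem_preimage, hw.2.2]
    exact hw.1
  exact mem_closure_iff_frequently.2 (hg.frequently h2)

theorem openSquare_subset_closure_markedSquare : openSquare ⊆ closure markedSquare := by
  have hfront : ∀ x : Plane, ‖x - centre‖ < 1 / 4 → x ∈ closure markedSquare := by
    intro x hx
    have hg : Continuous fun w : Plane => centre + (w - quarter) := by fun_prop
    refine mem_closure_markedSquare_aux (z := quarter + (x - centre)) hg.continuousAt (by abel) ?_
    have hn : Continuous fun w : Plane => ‖w - quarter‖ := by fun_prop
    have hx' : ‖quarter + (x - centre) - quarter‖ < 1 / 4 := by rwa [add_sub_cancel_left]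
    filter_upwards [hn.continuousAt.eventually (gt_mem_nhds hx')] with w hw
    have e : centre + (w - quarter) - centre = w - quarter := by abel
    constructor
    · rw [← norm_sub_centre_lt, e]; linarith
    · rw [fold_front (by rw [e]; exact hw.le), e]; abel
  intro x hx
  rw [← norm_sub_centre_lt] at hx
  rcases lt_trichotomy ‖x - centre‖ (1 / 4) with h | h | h
  · exact hfront x h
  · have h1 : x ∈ closure (Metric.ball centre (1 / 4)) := by
      rw [closure_ball _ (by norm_num), mem_closedBall_iff_norm]
      exact h.le
    refine closure_minimal (fun y hy => hfront y ?_) isClosed_closure h1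
    rwa [mem_ball_iff_norm] at hy
  · have h0 : x - centre ≠ 0 := norm_pos_iff.1 (by linarith)
    have hz : mirror (mirror (quarter + invert (x - centre))) - quarter = invert (x - centre) := by
      rw [mirror_mirror, add_sub_cancel_left]
    have hn0 := norm_invert h0 hx.le
    have hne : invert (x - centre) ≠ 0 := norm_pos_iff.1 (by linarith)
    have hm : Continuous fun w : Plane => mirror w - quarter := by fun_prop
    have hg : ContinuousAt (fun w : Plane => centre + invert (mirror w - quarter))
        (mirror (quarter + invert (x - centre))) := by
      refine continuousAt_const.add (ContinuousAt.comp (f := fun w : Plane => mirror w - quarter)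
        (continuousAt_invert ?_) hm.continuousAt)
      rwa [hz]
    refine mem_closure_markedSquare_aux hg (by rw [hz, invert_invert h0 hx]; abel) ?_
    have e1 : ‖mirror (mirror (quarter + invert (x - centre))) - quarter‖ < 1 / 4 := by
      rw [hz]; linarith
    have e2 : 0 < ‖mirror (mirror (quarter + invert (x - centre))) - quarter‖ := by
      rw [hz]; linarith
    filter_upwards [hm.norm.continuousAt.eventually (gt_mem_nhds e1),
      hm.norm.continuousAt.eventually (lt_mem_nhds e2)] with w hw1 hw2
    have hw0 : mirror w - quarter ≠ 0 := norm_pos_iff.1 hw2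
    have e : centre + invert (mirror w - quarter) - centre = invert (mirror w - quarter) := by
      abel
    constructor
    · rw [← norm_sub_centre_lt, e, norm_invert hw0 (by linarith)]; linarith
    · rw [fold_back, e, invert_invert hw0 (by linarith), add_sub_cancel, mirror_mirror]
      rw [e, norm_invert hw0 (by linarith)]
      linarith

theorem proj_eq_backCentre {z : Plane} (h : proj z = proj backCentre) :
    ∃ q : ℚ, z.1 = q ∧ ∀ n : ℤ, 2 * q ≠ n := by
  have aux : ∀ k n : ℤ, 2 * ((4 * k + 1) / 4 : ℚ) ≠ n := by
    intro k n hn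
    have : (4 * k + 1 : ℚ) = 2 * n := by linarith
    have : 4 * k + 1 = 2 * n := by exact_mod_cast this
    omega
  have aux' : ∀ k n : ℤ, 2 * ((4 * k - 1) / 4 : ℚ) ≠ n := by
    intro k n hn
    have : (4 * k - 1 : ℚ) = 2 * n := by linarith
    have : 4 * k - 1 = 2 * n := by exact_mod_cast this
    omega
  obtain ⟨n, m, rfl | rfl⟩ := proj_eq_iff.1 h.symm
  · refine ⟨(4 * n - 1) / 4, ?_, aux' n⟩
    simp only [backCentre, mirror_apply, quarter]
    push_cast
    ring
  · refine ⟨(4 * n + 1) / 4, ?_, aux n⟩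
    simp only [backCentre, mirror_apply, quarter]
    push_cast
    ring

theorem notMem_marked_of_proj_eq_backCentre {z : Plane} (h : proj z = proj backCentre) :
    z ∉ marked := by
  intro hz
  obtain ⟨q, hq, -⟩ := proj_eq_backCentre h
  exact (irrational_fst_of_mem_marked hz).ne_rat q hq

theorem catMap_backCentre : catMap (proj backCentre) = proj backCentre := by
  rw [catMap_proj, proj_eq_iff]
  refine ⟨-1, -3, Or.inl ?_⟩
  rw [catEquiv_apply]
  simp only [backCentre, mirror_apply, quarter]
  norm_num

/-- Lifts of the points of the pillowcase to be blown up. -/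
def blown : Set Plane := {z | z ∈ marked ∨ proj z = proj backCentre}

theorem two_mul_fst_ne_of_mem_blown {z : Plane} (h : z ∈ blown) (n : ℤ) : 2 * z.1 ≠ n := by
  intro hn
  rcases h with h | h
  · exact (irrational_fst_of_mem_marked h).ne_rat (n / 2) (by push_cast; linarith)
  · obtain ⟨q, hq, hq'⟩ := proj_eq_backCentre h
    rw [hq] at hn
    exact hq' n (by exact_mod_cast hn)

theorem mem_blown_of_proj_eq {z z' : Plane} (h : proj z = proj z') (hz : z ∈ blown) :
    z' ∈ blown :=
  hz.imp (mem_marked_of_proj_eq h) fun h' => h.symm.trans h'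

theorem catEquiv_mem_blown_iff {z : Plane} : catEquiv z ∈ blown ↔ z ∈ blown := by
  refine or_congr ⟨fun h => ?_, catEquiv_mem_marked⟩ ?_
  · simpa using catEquiv_symm_mem_marked h
  · rw [← catMap_proj]
    conv_lhs => rw [← catMap_backCentre]
    exact catMap.injective.eq_iff

theorem dirAt_catEquiv (a : Plane) : DirAt catEquiv a :=
  dirAt_of_hasFDerivAt catEquiv.hasFDerivAt catEquiv.injective

/-- Any two lifts of a point differ by a deck transformation. -/
theorem exists_deck {z z' : Plane} (h : proj z = proj z') :
    ∃ γ : Plane → Plane, γ z = z' ∧ (∀ x, proj (γ x) = proj x) ∧ DirAt γ z := by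
  obtain ⟨n, m, rfl | rfl⟩ := proj_eq_iff.1 h
  · exact ⟨fun x => x + ((n : ℝ), (m : ℝ)), rfl, fun x => proj_add x n m, dirAt_add_const _ _⟩
  · refine ⟨fun x => ((n : ℝ) - x.1, (m : ℝ) - x.2), rfl, fun x => proj_sub x n m, ?_⟩
    have h1 : HasFDerivAt (fun x : Plane => ((n : ℝ), (m : ℝ)) - x)
        (-ContinuousLinearMap.id ℝ Plane) z := (hasFDerivAt_id z).const_sub _
    exact dirAt_of_hasFDerivAt h1 neg_injective

/-- A closed relation on a compact Hausdorff space which is a bijection is a homeomorphism. -/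
theorem exists_homeomorph_of_isClosed_relation {X : Type*} [TopologicalSpace X] [CompactSpace X]
    [T2Space X] {R : Set (X × X)} (hR : IsClosed R) (h₁ : ∀ x, ∃ y, (x, y) ∈ R)
    (h₂ : ∀ y, ∃ x, (x, y) ∈ R) (hu₁ : ∀ x y y', (x, y) ∈ R → (x, y') ∈ R → y = y')
    (hu₂ : ∀ x x' y, (x, y) ∈ R → (x', y) ∈ R → x = x') :
    ∃ H : X ≃ₜ X, ∀ x, (x, H x) ∈ R := by
  have : CompactSpace R := isCompact_iff_compactSpace.1 hR.isCompact
  have b₁ : Function.Bijective fun r : R => r.1.1 := by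
    constructor
    · rintro ⟨⟨x, y⟩, h⟩ ⟨⟨x', y'⟩, h'⟩ (rfl : x = x')
      simp [hu₁ x y y' h h']
    · intro x
      obtain ⟨y, h⟩ := h₁ x
      exact ⟨⟨(x, y), h⟩, rfl⟩
  have b₂ : Function.Bijective fun r : R => r.1.2 := by
    constructor
    · rintro ⟨⟨x, y⟩, h⟩ ⟨⟨x', y'⟩, h'⟩ (rfl : y = y')
      simp [hu₂ x x' y h h']
    · intro y
      obtain ⟨x, h⟩ := h₂ y
      exact ⟨⟨(x, y), h⟩, rfl⟩
  let e₁ : R ≃ₜ X := Continuous.homeoOfEquivCompactToT2 (f := Equiv.ofBijective _ b₁)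
    (continuous_fst.comp continuous_subtype_val)
  let e₂ : R ≃ₜ X := Continuous.homeoOfEquivCompactToT2 (f := Equiv.ofBijective _ b₂)
    (continuous_snd.comp continuous_subtype_val)
  refine ⟨e₁.symm.trans e₂, fun x => ?_⟩
  have h : (x, (e₁.symm.trans e₂) x) = (e₁.symm x).1 :=
    Prod.ext (e₁.apply_symm_apply x).symm rfl
  rw [h]
  exact (e₁.symm x).2

/-- Mixing lifts through a factor map which is injective over a dense set. -/
theorem mixing_of_semiconj {X Y : Type*} [TopologicalSpace X] [CompactSpace X]
    [TopologicalSpace Y] [T2Space Y] {F : X → Y} (hF : Continuous F) (hs : Function.Surjective F)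
    {B : Set Y} (hinj : ∀ x y, F x = F y → F x ∉ B → x = y) (hd : Dense {x | F x ∉ B})
    {H : X → X} {g : Y → Y} (hH : Function.Semiconj F H g) (hg : TopologicallyMixing g) :
    TopologicallyMixing H := by
  have key : ∀ U : Set X, IsOpen U → U.Nonempty →
      ∃ W : Set Y, IsOpen W ∧ W.Nonempty ∧ F ⁻¹' W ⊆ U := by
    intro U hU hne
    obtain ⟨x, hxU, hx⟩ := hd.inter_open_nonempty U hU hne
    refine ⟨(F '' Uᶜ)ᶜ, (hF.isClosedMap _ hU.isClosed_compl).isOpen_compl, ⟨F x, ?_⟩, ?_⟩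
    · rintro ⟨y, hy, he⟩
      exact hy (hinj x y he.symm hx ▸ hxU)
    · intro y hy
      by_contra h
      exact hy ⟨y, h, rfl⟩
  intro U V hU hV hUn hVn
  obtain ⟨U', hU', hUn', hUs⟩ := key U hU hUn
  obtain ⟨V', hV', hVn', hVs⟩ := key V hV hVn
  obtain ⟨N, hN⟩ := hg U' V' hU' hV' hUn' hVn'
  refine ⟨N, fun n hn => ?_⟩
  obtain ⟨_, ⟨d, hd, rfl⟩, hdV⟩ := hN n hn
  obtain ⟨u, rfl⟩ := hs d
  refine ⟨H^[n] u, ⟨u, hUs hd, rfl⟩, hVs ?_⟩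
  rw [mem_preimage, (hH.iterate_right n).eq]
  exact hdV

/-- A factor map onto the pillowcase blowing up the marked points to circles of directions. -/
structure IsBlowup {X : Type*} [TopologicalSpace X] (F : X → Pillow) : Prop where
  cont : Continuous F
  surj : Function.Surjective F
  inj : ∀ x y, F x = F y → F x ∉ proj '' blown → x = y
  dense : Dense {x | F x ∉ proj '' blown}
  lift : ∀ z ∈ blown, ∃ G Λ : X → Plane, (∀ x, proj (G x) = F x) ∧
    InjOn Λ {x | F x = proj z} ∧ ∀ x, F x = proj z → Λ x ∈ Metric.sphere (0 : Plane) 1 ∧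
      Tendsto G (𝓝[{x' | F x' ≠ proj z}] x) (approach z (Λ x))

theorem proj_mem_blown_iff {z : Plane} : proj z ∈ proj '' blown ↔ z ∈ blown :=
  ⟨fun ⟨_, h, he⟩ => mem_blown_of_proj_eq he h, fun h => ⟨z, h, rfl⟩⟩

theorem catMap_mem_blown_iff {d : Pillow} : catMap d ∈ proj '' blown ↔ d ∈ proj '' blown := by
  obtain ⟨z, rfl⟩ := proj_surjective d
  rw [catMap_proj, proj_mem_blown_iff, proj_mem_blown_iff, catEquiv_mem_blown_iff]

/-- The lift of the hyperbolic homeomorphism where it is determined by its values. -/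
def liftRel {X : Type*} (F : X → Pillow) : Set (X × X) :=
  {p | F p.1 ∉ proj '' blown ∧ F p.2 = catMap (F p.1)}

namespace IsBlowup

variable {X : Type*} [TopologicalSpace X] {F : X → Pillow}

theorem eq_of_mem_closure (hF : IsBlowup F) {x y : X} (h : (x, y) ∈ closure (liftRel F)) :
    F y = catMap (F x) := by
  have hc : IsClosed {p : X × X | F p.2 = catMap (F p.1)} :=
    isClosed_eq (hF.cont.comp continuous_snd)
      (catMap.continuous.comp (hF.cont.comp continuous_fst))
  exact closure_minimal (fun p hp => hp.2) hc h

theorem exists_direction (hF : IsBlowup F) {z : Plane} (hz : z ∈ blown) :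
    ∃ Λ Λ' : X → Plane, InjOn Λ {x | F x = proj z} ∧ InjOn Λ' {x | F x = proj (catEquiv z)} ∧
      ∀ x y, F x = proj z → (x, y) ∈ closure (liftRel F) → Λ' y = Λ x := by
  have hz' : catEquiv z ∈ blown := catEquiv_mem_blown_iff.2 hz
  obtain ⟨G, Λ, hG, hΛ, hx⟩ := hF.lift z hz
  obtain ⟨G', Λ', hG', hΛ', hx'⟩ := hF.lift _ hz'
  obtain ⟨l, hl, -, ht⟩ := dirAt_catEquiv z
  refine ⟨l ∘ Λ, Λ', hl.comp hΛ fun x h => (hx x h).1, hΛ', fun x y hFx h => ?_⟩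
  have hFy : F y = proj (catEquiv z) := by rw [hF.eq_of_mem_closure h, hFx, catMap_proj]
  have := mem_closure_iff_nhdsWithin_neBot.1 h
  have t1 : Tendsto (fun p : X × X => p.1) (𝓝[liftRel F] (x, y)) (𝓝[{x' | F x' ≠ proj z}] x) := by
    refine tendsto_nhdsWithin_iff.2
      ⟨continuous_fst.continuousAt.tendsto.mono_left nhdsWithin_le_nhds, ?_⟩
    filter_upwards [self_mem_nhdsWithin] with p hp he
    exact hp.1 ⟨z, hz, he.symm⟩
  have t2 : Tendsto (fun p : X × X => p.2) (𝓝[liftRel F] (x, y))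
      (𝓝[{x' | F x' ≠ proj (catEquiv z)}] y) := by
    refine tendsto_nhdsWithin_iff.2
      ⟨continuous_snd.continuousAt.tendsto.mono_left nhdsWithin_le_nhds, ?_⟩
    filter_upwards [self_mem_nhdsWithin] with p hp he
    rw [hp.2, ← catMap_proj] at he
    exact hp.1 ⟨z, hz, (catMap.injective he).symm⟩
  have s1 := (ht _ (hx x hFx).1).comp ((hx x hFx).2.comp t1)
  have s2 := (hx' y hFy).2.comp t2
  have hev := ((s1.mono_right (approach_le_nhds _ _)).prodMk
    (s2.mono_right (approach_le_nhds _ _))).eventually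
    (eventually_eq_of_proj_eq (two_mul_fst_ne_of_mem_blown hz'))
  have heq : ∀ᶠ p in 𝓝[liftRel F] (x, y),
      dir (catEquiv (G p.1) - catEquiv z) = dir (G' p.2 - catEquiv z) := by
    filter_upwards [hev, self_mem_nhdsWithin] with p hp hpR
    have := hp (by
      change proj (catEquiv (G p.1)) = proj (G' p.2)
      rw [← catMap_proj, hG, hG', hpR.2])
    exact congrArg (fun w => dir (w - catEquiv z)) this
  have d1 := (tendsto_dir_approach _ _).comp s1
  have d2 := (tendsto_dir_approach _ _).comp s2
  exact (tendsto_nhds_unique (d1.congr' heq) d2).symm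

theorem eq_right (hF : IsBlowup F) {x y y' : X} (h : (x, y) ∈ closure (liftRel F))
    (h' : (x, y') ∈ closure (liftRel F)) : y = y' := by
  have e := hF.eq_of_mem_closure h
  have e' := hF.eq_of_mem_closure h'
  by_cases hx : F x ∈ proj '' blown
  · obtain ⟨z, hz, hzx⟩ := hx
    obtain ⟨Λ, Λ', -, hΛ', hd⟩ := hF.exists_direction hz
    refine hΛ' ?_ ?_ ((hd x y hzx.symm h).trans (hd x y' hzx.symm h').symm)
    · rw [mem_ofPred_eq, e, ← hzx, catMap_proj]
    · rw [mem_ofPred_eq, e', ← hzx, catMap_proj]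
  · exact hF.inj y y' (e.trans e'.symm) (by rwa [e, catMap_mem_blown_iff])

theorem eq_left (hF : IsBlowup F) {x x' y : X} (h : (x, y) ∈ closure (liftRel F))
    (h' : (x', y) ∈ closure (liftRel F)) : x = x' := by
  have e : F x = F x' :=
    catMap.injective ((hF.eq_of_mem_closure h).symm.trans (hF.eq_of_mem_closure h'))
  by_cases hx : F x ∈ proj '' blown
  · obtain ⟨z, hz, hzx⟩ := hx
    obtain ⟨Λ, Λ', hΛ, -, hd⟩ := hF.exists_direction hz
    exact hΛ hzx.symm (e.symm.trans hzx.symm)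
      ((hd x y hzx.symm h).symm.trans (hd x' y (e.symm.trans hzx.symm) h'))
  · exact hF.inj _ _ e hx

/-- A blow-up of the pillowcase admits a mixing homeomorphism. -/
theorem exists_mixing [CompactSpace X] [T2Space X] (hF : IsBlowup F) :
    ∃ H : X ≃ₜ X, TopologicallyMixing H := by
  have hcl : IsClosed (closure (liftRel F)) := isClosed_closure
  have hfst : IsClosed (Prod.fst '' closure (liftRel F)) :=
    (hcl.isCompact.image continuous_fst).isClosed
  have hsnd : IsClosed (Prod.snd '' closure (liftRel F)) :=
    (hcl.isCompact.image continuous_snd).isClosed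
  have h₁ : ∀ x, ∃ y, (x, y) ∈ closure (liftRel F) := by
    intro x
    have : x ∈ Prod.fst '' closure (liftRel F) := by
      refine closure_minimal (fun x' hx' => ?_) hfst (hF.dense x)
      obtain ⟨y, hy⟩ := hF.surj (catMap (F x'))
      exact ⟨(x', y), subset_closure ⟨hx', hy⟩, rfl⟩
    obtain ⟨⟨_, y⟩, h, rfl⟩ := this
    exact ⟨y, h⟩
  have h₂ : ∀ y, ∃ x, (x, y) ∈ closure (liftRel F) := by
    intro y
    have : y ∈ Prod.snd '' closure (liftRel F) := by
      refine closure_minimal (fun y' hy' => ?_) hsnd (hF.dense y)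
      obtain ⟨x, hx⟩ := hF.surj (catMap.symm (F y'))
      have hxy : F y' = catMap (F x) := by rw [hx, catMap.apply_symm_apply]
      refine ⟨(x, y'), subset_closure ⟨?_, hxy⟩, rfl⟩
      rw [mem_ofPred_eq, hxy, catMap_mem_blown_iff] at hy'
      exact hy'
    obtain ⟨⟨x, _⟩, h, rfl⟩ := this
    exact ⟨x, h⟩
  obtain ⟨H, hH⟩ := exists_homeomorph_of_isClosed_relation hcl h₁ h₂
    (fun _ _ _ => hF.eq_right) (fun _ _ _ => hF.eq_left)
  exact ⟨H, mixing_of_semiconj hF.cont hF.surj hF.inj hF.dense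
    (fun x => hF.eq_of_mem_closure (hH x)) catMap_mixing⟩

end IsBlowup

theorem mem_openSquare_iff_of_fix {φ : Plane ≃ₜ Plane} (hφ : ∀ x, x ∉ openSquare → φ x = x)
    {x : Plane} : φ x ∈ openSquare ↔ x ∈ openSquare := by
  constructor
  · intro h
    by_contra h'
    rw [hφ x h'] at h
    exact h' h
  · intro h
    by_contra h'
    rw [φ.injective (hφ _ h')] at h'
    exact h' h

theorem norm_eq_of_notMem {x : Plane} (h : x ∈ unitSquare) (h' : x ∉ openSquare) :
    ‖x - centre‖ = 1 / 2 :=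
  le_antisymm (norm_sub_centre_le.2 h) (not_lt.1 fun h'' => h' (norm_sub_centre_lt.1 h''))

theorem proj_fold_eq_backCentre_iff {x : Plane} (hx : x ∈ unitSquare) :
    proj (fold x) = proj backCentre ↔ x ∉ openSquare := by
  constructor
  · intro h hxo
    have h0 : (0 : Plane) ∈ unitSquare := by simp [unitSquare, Prod.le_def]
    have h0' : (0 : Plane) ∉ openSquare := by simp [openSquare]
    rw [← fold_of_norm_eq (norm_eq_of_notMem h0 h0')] at h
    rcases eq_of_proj_fold_eq hx h0 h with rfl | h
    · exact h0' hxo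
    · exact h.1 hxo
  · intro h
    rw [fold_of_norm_eq (norm_eq_of_notMem hx h)]

/-- The carpet is a blow-up of the pillowcase. -/
theorem exists_isBlowup : ∃ F : sierpinskiCarpet → Pillow, IsBlowup F := by
  obtain ⟨ψ, ψ₁, hψ⟩ := exists_isCollapse
  have hDc : (range holePoint).Countable := countable_range _
  obtain ⟨φ, hφ, himg, hdir⟩ := exists_homeomorph_matching isOpen_openSquare ⟨centre, centre_mem⟩
    hDc countable_markedSquare (range_subset_iff.2 holePoint_mem)
    inter_subset_left (openSquare_subset.trans unitSquare_subset_closure_holePoint)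
    openSquare_subset_closure_markedSquare
  have hφo : ∀ {x}, φ x ∈ openSquare ↔ x ∈ openSquare := mem_openSquare_iff_of_fix hφ
  have hφu : ∀ {x}, x ∈ unitSquare → φ x ∈ unitSquare := by
    intro x hx
    by_cases h : x ∈ openSquare
    · exact openSquare_subset (hφo.2 h)
    · rwa [hφ x h]
  have hψu : ∀ x : sierpinskiCarpet, φ (ψ x) ∈ unitSquare := fun x =>
    hφu (hψ.mapsTo (carpet_subset_unitSquare x.2))
  have hmark : ∀ {y}, φ y ∈ markedSquare ↔ y ∈ range holePoint := by
    intro y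
    rw [← himg, φ.injective.mem_set_image]
  set F : sierpinskiCarpet → Pillow := fun x => proj (fold (φ (ψ x))) with hFdef
  have hcont : Continuous fun x : sierpinskiCarpet => φ (ψ x) :=
    φ.continuous.comp (hψ.cont.comp continuous_subtype_val)
  have hnot : ∀ {y}, y ∈ openSquare → y ∉ range holePoint → fold (φ y) ∉ blown := by
    rintro y hy hyr (h | h)
    · exact hyr (hmark.1 ⟨hφo.2 hy, h⟩)
    · exact (proj_fold_eq_backCentre_iff (openSquare_subset (hφo.2 hy))).1 h (hφo.2 hy)
  refine ⟨F, continuous_proj_fold.comp hcont, ?_, ?_, ?_, ?_⟩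
  · intro d
    obtain ⟨y, hy, rfl⟩ := exists_proj_fold_eq d
    have hy' : φ.symm y ∈ unitSquare := by
      by_cases h : φ.symm y ∈ openSquare
      · exact openSquare_subset h
      · have := hφ _ h
        rw [φ.apply_symm_apply] at this
        rwa [← this]
    obtain ⟨x, hx, he⟩ := hψ.surjOn hy'
    refine ⟨⟨x, hx⟩, ?_⟩
    simp only [hFdef]
    rw [he, φ.apply_symm_apply]
  · intro x y h hx
    rw [hFdef, proj_mem_blown_iff] at hx
    have hxo : φ (ψ x) ∈ openSquare := by
      by_contra h'
      exact hx (Or.inr ((proj_fold_eq_backCentre_iff (hψu x)).2 h'))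
    have he := (eq_of_proj_fold_eq (hψu x) (hψu y) h).resolve_right fun h' => h'.1 hxo
    refine Subtype.ext (hψ.injOn x.2 y.2 (φ.injective he) fun hr => hx (Or.inl ?_))
    exact (hmark.2 hr).2
  · rw [Subtype.dense_iff]
    intro x hx
    refine closure_mono ?_ (hψ.carpet_subset_closure hDc hx)
    rintro x ⟨hx, hxo, hxr⟩
    exact ⟨⟨x, hx⟩, fun h => hnot hxo hxr (proj_mem_blown_iff.1 h), rfl⟩
  · rintro z (hz | hz)
    · obtain ⟨a, ha, haz⟩ := exists_proj_fold_eq (proj z)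
      have ham : fold a ∈ marked := mem_marked_of_proj_eq haz.symm hz
      have hao : a ∈ openSquare := by
        by_contra h'
        exact notMem_marked_of_proj_eq_backCentre ((proj_fold_eq_backCentre_iff ha).2 h') ham
      obtain ⟨_, ⟨w, rfl⟩, rfl⟩ : a ∈ φ '' range holePoint := by
        rw [himg]; exact ⟨hao, ham⟩
      obtain ⟨γ, hγz, hγ, hγd⟩ := exists_deck haz
      have hd : DirAt (γ ∘ fold ∘ φ) (holePoint w) :=
        DirAt.comp (f := fold ∘ φ) hγd (DirAt.comp (dirAt_fold hao
          (norm_ne_of_fold_mem_marked ham)) (hdir _))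
      obtain ⟨l, hl, hlm, hlt⟩ := hd
      obtain ⟨Λ, hΛ, hΛt⟩ := hψ.exists_direction w
      have hfib : ∀ x : sierpinskiCarpet, F x = proj z ↔ ψ x = holePoint w := by
        intro x
        rw [← haz]
        constructor
        · intro h
          exact φ.injective ((eq_of_proj_fold_eq (hψu x) ha h).resolve_right fun h' => h'.2 hao)
        · intro h
          simp only [hFdef, h]
      have hhole : ∀ x : sierpinskiCarpet, F x = proj z → (x : Plane) ∈ sierpinskiCarpet ∩ hole w :=
        fun x h => ⟨x.2, hψ.mem_hole_of_eq w x x.2 ((hfib x).1 h)⟩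
      refine ⟨fun x => γ (fold (φ (ψ x))), fun x => l (Λ x), fun x => hγ _, ?_, ?_⟩
      · intro x hx y hy h
        exact Subtype.ext (hΛ (hhole x hx) (hhole y hy)
          (hl (hΛt x (hhole x hx)).1 (hΛt y (hhole y hy)).1 h))
      · intro x hx
        obtain ⟨h1, h2⟩ := hΛt x (hhole x hx)
        refine ⟨hlm h1, ?_⟩
        have ht : Tendsto ((↑) : sierpinskiCarpet → Plane) (𝓝[{x' | F x' ≠ proj z}] x)
            (𝓝[sierpinskiCarpet \ ψ ⁻¹' {holePoint w}] x) := by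
          refine tendsto_nhdsWithin_iff.2
            ⟨continuous_subtype_val.continuousAt.tendsto.mono_left nhdsWithin_le_nhds, ?_⟩
          filter_upwards [self_mem_nhdsWithin] with x' hx'
          exact ⟨x'.2, fun h => hx' ((hfib x').2 h)⟩
        have := (hlt _ h1).comp (h2.comp ht)
        rw [show (γ ∘ fold ∘ φ) (holePoint w) = z from hγz] at this
        exact this
    · obtain ⟨γ, hγz, hγ, l, hl, hlm, hlt⟩ := exists_deck hz.symm
      have hfib : ∀ x : sierpinskiCarpet, F x = proj z ↔ φ (ψ x) ∉ openSquare := by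
        intro x
        rw [hz]
        exact proj_fold_eq_backCentre_iff (hψu x)
      have hself : ∀ x : sierpinskiCarpet, F x = proj z → φ (ψ x) = x := by
        intro x h
        have h1 : ψ x ∉ openSquare := fun h' => (hfib x).1 h (hφo.2 h')
        rw [hφ _ h1, hψ.eq_self_of_notMem x.2 h1]
      have hnorm : ∀ x : sierpinskiCarpet, F x = proj z → ‖(x : Plane) - centre‖ = 1 / 2 := by
        intro x h
        refine norm_eq_of_notMem (carpet_subset_unitSquare x.2) ?_
        rw [← hself x h]
        exact (hfib x).1 h
      have hsph : ∀ x : sierpinskiCarpet, F x = proj z →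
          dir (mirror (x - centre)) ∈ Metric.sphere (0 : Plane) 1 := by
        intro x h
        rw [mem_sphere_zero_iff_norm, norm_dir]
        rw [← norm_ne_zero_iff, norm_mirror, hnorm x h]
        norm_num
      refine ⟨fun x => γ (fold (φ (ψ x))), fun x => l (dir (mirror (x - centre))),
        fun x => hγ _, ?_, ?_⟩
      · intro x hx y hy h
        have h1 := hl (hsph x hx) (hsph y hy) h
        have h2 : mirror ((x : Plane) - centre) = mirror (y - centre) := by
          rw [← norm_smul_dir (mirror ((x : Plane) - centre)),
            ← norm_smul_dir (mirror ((y : Plane) - centre)), h1, norm_mirror, norm_mirror,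
            hnorm x hx, hnorm y hy]
        exact Subtype.ext (sub_left_injective (mirror_injective h2))
      · intro x hx
        refine ⟨hlm (hsph x hx), ?_⟩
        have ht : Tendsto (fun x' : sierpinskiCarpet => φ (ψ x')) (𝓝[{x' | F x' ≠ proj z}] x)
            (𝓝[openSquare] (x : Plane)) := by
          refine tendsto_nhdsWithin_iff.2 ⟨?_, ?_⟩
          · have := hcont.continuousAt (x := x)
            rw [ContinuousAt, hself x hx] at this
            exact this.mono_left nhdsWithin_le_nhds
          · filter_upwards [self_mem_nhdsWithin] with x' hx'
            exact not_not.1 fun h => hx' ((hfib x').2 h)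
        have := (hlt _ (hsph x hx)).comp ((tendsto_fold_boundary (hnorm x hx)).comp ht)
        rw [hγz] at this
        exact this

theorem isPreconnected_boundary : IsPreconnected (unitSquare \ openSquare) := by
  have hI : IsPreconnected (Icc (0 : ℝ) 1) := isPreconnected_Icc
  have h0 : (0 : ℝ) ∈ Icc (0 : ℝ) 1 := by simp
  have h1 : (1 : ℝ) ∈ Icc (0 : ℝ) 1 := by simp
  have h : unitSquare \ openSquare = ((Icc (0 : ℝ) 1 ×ˢ {0} ∪ {0} ×ˢ Icc (0 : ℝ) 1) ∪
      Icc (0 : ℝ) 1 ×ˢ {1}) ∪ {1} ×ˢ Icc (0 : ℝ) 1 := by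
    ext ⟨x, y⟩
    simp only [unitSquare, openSquare, Set.mem_sdiff, mem_prod, mem_Icc, mem_Ioo, mem_union,
      mem_singleton_iff]
    constructor
    · rintro ⟨⟨⟨hx, hx'⟩, hy, hy'⟩, hn⟩
      by_contra! hc
      obtain ⟨⟨⟨c1, c2⟩, c3⟩, c4⟩ := hc
      exact hn ⟨⟨lt_of_le_of_ne hx fun e => (c2 e.symm hy).not_ge hy',
        lt_of_le_of_ne hx' fun e => (c4 e hy).not_ge hy'⟩,
        lt_of_le_of_ne hy fun e => c1 ⟨hx, hx'⟩ e.symm, lt_of_le_of_ne hy' (c3 ⟨hx, hx'⟩)⟩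
    · rintro (((⟨⟨hx, hx'⟩, rfl⟩ | ⟨rfl, hy, hy'⟩) | ⟨⟨hx, hx'⟩, rfl⟩) | ⟨rfl, hy, hy'⟩) <;>
        simp [*]
  rw [h]
  have h2 : IsPreconnected (Icc (0 : ℝ) 1 ×ˢ {(0 : ℝ)} ∪ {(0 : ℝ)} ×ˢ Icc (0 : ℝ) 1) :=
    .union (0, 0) ⟨h0, rfl⟩ ⟨rfl, h0⟩ (hI.prod isPreconnected_singleton)
      (isPreconnected_singleton.prod hI)
  have h3 := h2.union (t := Icc (0 : ℝ) 1 ×ˢ {(1 : ℝ)}) (0, 1) (Or.inr ⟨rfl, h1⟩) ⟨h0, rfl⟩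
    (hI.prod isPreconnected_singleton)
  exact h3.union (1, 1) (Or.inr ⟨h1, rfl⟩) ⟨rfl, h1⟩
    (isPreconnected_singleton.prod hI)

/-- The union of the boundaries of the subsquares of generation at most `n`. -/
noncomputable def grid : ℕ → Set Plane
  | 0 => unitSquare \ openSquare
  | n + 1 => (unitSquare \ openSquare) ∪ ⋃ d, tile d '' grid n

theorem boundary_subset_grid (n : ℕ) : unitSquare \ openSquare ⊆ grid n := by
  cases n with
  | zero => exact Subset.rfl
  | succ n => exact subset_union_left

theorem grid_subset_carpet (n : ℕ) : grid n ⊆ sierpinskiCarpet := by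
  induction n with
  | zero => exact boundary_subset_carpet
  | succ n ih =>
    refine union_subset boundary_subset_carpet (iUnion_subset fun d => ?_)
    rintro _ ⟨q, hq, rfl⟩
    exact tile_mem_carpet d (ih hq)

theorem exists_tile_mem_boundary (d : Digit) :
    ∃ q ∈ unitSquare \ openSquare, tile d q ∈ unitSquare \ openSquare := by
  have key : ∀ q ∈ unitSquare \ openSquare, tile d q ∉ openSquare →
      ∃ q ∈ unitSquare \ openSquare, tile d q ∈ unitSquare \ openSquare := fun q hq h =>
    ⟨q, hq, tile_mem_unitSquare d hq.1, h⟩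
  obtain ⟨⟨a, b⟩, hd⟩ := d
  fin_cases a <;> fin_cases b <;> first
    | exact absurd rfl hd
    | (refine key (0, 0) ?_ ?_ <;> norm_num [unitSquare, openSquare, tile]; done)
    | (refine key (1, 1) ?_ ?_ <;> norm_num [unitSquare, openSquare, tile])

theorem isPreconnected_grid (n : ℕ) : IsPreconnected (grid n) := by
  induction n with
  | zero => exact isPreconnected_boundary
  | succ n ih =>
    have h : grid (n + 1) = ⋃ d, ((unitSquare \ openSquare) ∪ tile d '' grid n) := by
      rw [← union_iUnion, grid]
    rw [h]
    refine isPreconnected_iUnion ⟨(0, 0), mem_iInter.2 fun d => Or.inl ?_⟩ fun d => ?_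
    · simp [unitSquare, openSquare]
    · obtain ⟨q, hq, hq'⟩ := exists_tile_mem_boundary d
      exact isPreconnected_boundary.union _ hq' (mem_image_of_mem _ (boundary_subset_grid n hq))
        (ih.image _ (continuous_tile d).continuousOn)

theorem exists_mem_grid_dist_le (n : ℕ) {x : Plane} (hx : x ∈ sierpinskiCarpet) :
    ∃ y ∈ grid n, dist x y ≤ (1 / 3) ^ n := by
  induction n generalizing x with
  | zero =>
    have h : ((0, 0) : Plane) ∈ unitSquare \ openSquare := by simp [unitSquare, openSquare]
    exact ⟨(0, 0), h, by simpa using dist_le_one (carpet_subset_unitSquare hx) h.1⟩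
  | succ n ih =>
    obtain ⟨d, q, hq, rfl⟩ := exists_tile_of_mem_carpet hx
    obtain ⟨y, hy, hqy⟩ := ih hq
    refine ⟨tile d y, Or.inr (mem_iUnion.2 ⟨d, mem_image_of_mem _ hy⟩), ?_⟩
    rw [dist_tile, pow_succ]
    linarith

theorem isConnected_carpet : IsConnected sierpinskiCarpet := by
  have h0 : ((0, 0) : Plane) ∈ unitSquare \ openSquare := by simp [unitSquare, openSquare]
  refine ⟨⟨(0, 0), boundary_subset_carpet h0⟩, ?_⟩
  have h : IsPreconnected (⋃ n, grid n) :=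
    isPreconnected_iUnion ⟨(0, 0), mem_iInter.2 fun n => boundary_subset_grid n h0⟩
      isPreconnected_grid
  refine h.subset_closure (iUnion_subset grid_subset_carpet) fun x hx => ?_
  refine Metric.mem_closure_iff.2 fun ε hε => ?_
  obtain ⟨n, hn⟩ := exists_pow_lt_of_lt_one hε (by norm_num : (1 / 3 : ℝ) < 1)
  obtain ⟨y, hy, hxy⟩ := exists_mem_grid_dist_le n hx
  exact ⟨y, mem_iUnion.2 ⟨n, hy⟩, hxy.trans_lt hn⟩

/-- A compact connected subset of the carpet together with an open subset `U` of the open square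
which meets the carpet, and does so inside that subset. -/
structure IsFatSubcontinuum (A U : Set Plane) : Prop where
  isCompact : IsCompact A
  isConnected : IsConnected A
  subset : A ⊆ sierpinskiCarpet
  isOpen : IsOpen U
  subset_openSquare : U ⊆ openSquare
  inter_subset : U ∩ sierpinskiCarpet ⊆ A
  nonempty : (U ∩ sierpinskiCarpet).Nonempty

theorem isFatSubcontinuum_carpet : IsFatSubcontinuum sierpinskiCarpet openSquare where
  isCompact := isCompact_carpet
  isConnected := isConnected_carpet
  subset := Subset.rfl
  isOpen := isOpen_openSquare
  subset_openSquare := Subset.rfl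
  inter_subset := inter_subset_right
  nonempty := by
    refine ⟨tile default (1, 1), ?_, tile_mem_carpet _ (boundary_subset_carpet ?_)⟩
    · norm_num [openSquare, tile, default]
    · simp [unitSquare, openSquare]

theorem IsFatSubcontinuum.tile {A U : Set Plane} (h : IsFatSubcontinuum A U) (d : Digit) :
    IsFatSubcontinuum (tile d '' A) (tile d '' U) where
  isCompact := h.isCompact.image (continuous_tile d)
  isConnected := h.isConnected.image _ (continuous_tile d).continuousOn
  subset := by
    rintro _ ⟨q, hq, rfl⟩
    exact tile_mem_carpet d (h.subset hq)
  isOpen := by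
    rw [image_eq_preimage_of_inverse (untile_tile d) (tile_untile d)]
    exact h.isOpen.preimage (continuous_untile d)
  subset_openSquare := by
    rintro _ ⟨q, hq, rfl⟩
    exact tile_mem_openSquare d (h.subset_openSquare hq)
  inter_subset := by
    rintro _ ⟨⟨q, hq, rfl⟩, hS⟩
    exact mem_image_of_mem _
      (h.inter_subset ⟨hq, mem_carpet_of_tile hS (h.subset_openSquare hq)⟩)
  nonempty := by
    obtain ⟨q, hq, hS⟩ := h.nonempty
    exact ⟨Carpet.tile d q, mem_image_of_mem _ hq, tile_mem_carpet d hS⟩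

/-- The copies of the carpet on the bottom side accumulating at the origin. -/
noncomputable def bottomCopy : ℕ → Set Plane
  | 0 => tile ⟨(2, 0), by decide⟩ '' sierpinskiCarpet
  | n + 1 => tile ⟨(0, 0), by decide⟩ '' bottomCopy n

theorem exists_isFatSubcontinuum_bottomCopy (n : ℕ) : ∃ U, IsFatSubcontinuum (bottomCopy n) U := by
  induction n with
  | zero => exact ⟨_, isFatSubcontinuum_carpet.tile _⟩
  | succ n ih =>
    obtain ⟨U, hU⟩ := ih
    exact ⟨_, hU.tile _⟩

theorem fst_mem_of_mem_bottomCopy (n : ℕ) : ∀ z ∈ bottomCopy n,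
    z.1 ∈ Icc (2 * (1 / 3 : ℝ) ^ (n + 1)) ((1 / 3) ^ n) := by
  induction n with
  | zero =>
    rintro _ ⟨q, hq, rfl⟩
    obtain ⟨h1, h2⟩ := (carpet_subset_unitSquare hq).1
    constructor <;> norm_num [tile] <;> linarith
  | succ n ih =>
    rintro _ ⟨q, hq, rfl⟩
    obtain ⟨h1, h2⟩ := ih q hq
    rw [pow_succ] at h1
    constructor <;> simp only [tile, pow_succ] <;> norm_num <;> linarith

theorem disjoint_bottomCopy {m n : ℕ} (h : m < n) : Disjoint (bottomCopy m) (bottomCopy n) := by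
  refine disjoint_left.2 fun z hm hn => ?_
  have h1 := (fst_mem_of_mem_bottomCopy m z hm).1
  have h2 := (fst_mem_of_mem_bottomCopy n z hn).2
  have h3 : (1 / 3 : ℝ) ^ n ≤ (1 / 3) ^ (m + 1) :=
    pow_le_pow_of_le_one (by norm_num) (by norm_num) h
  have h4 : (0 : ℝ) < (1 / 3) ^ (m + 1) := by positivity
  linarith

theorem isClosed_isConnected_interior_nonempty {A U : Set Plane} (h : IsFatSubcontinuum A U) :
    IsClosed ((↑) ⁻¹' A : Set sierpinskiCarpet) ∧
      IsConnected ((↑) ⁻¹' A : Set sierpinskiCarpet) ∧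
      (interior ((↑) ⁻¹' A : Set sierpinskiCarpet)).Nonempty := by
  have hA : ((↑) : sierpinskiCarpet → Plane) '' ((↑) ⁻¹' A) = A := by
    rw [Subtype.image_preimage_coe, inter_eq_right]
    exact h.subset
  refine ⟨h.isCompact.isClosed.preimage continuous_subtype_val, ⟨?_, ?_⟩, ?_⟩
  · rw [← image_nonempty, hA]
    exact h.isConnected.nonempty
  · rw [← IsInducing.subtypeVal.isPreconnected_image, hA]
    exact h.isConnected.isPreconnected
  · obtain ⟨x, hxU, hxS⟩ := h.nonempty
    exact ⟨⟨x, hxS⟩, mem_interior.2 ⟨Subtype.val ⁻¹' U, fun y hy => h.inter_subset ⟨hy, y.2⟩,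
      h.isOpen.preimage continuous_subtype_val, hxU⟩⟩

end Carpet

/-- The Sierpiński carpet admits a topologically mixing homeomorphism, and yet it is
`1/n`-indecomposable for no `n`: for every `n` there are `n` pairwise disjoint subcontinua
each with nonempty interior. -/
theorem sierpinskiCarpet_mixing_not_indecomposable :
    (∃ H : ↥sierpinskiCarpet ≃ₜ ↥sierpinskiCarpet, TopologicallyMixing (⇑H)) ∧
    ∀ n : ℕ, ∃ C : Fin n → Set ↥sierpinskiCarpet,
      (∀ i j, i ≠ j → Disjoint (C i) (C j)) ∧
      ∀ i, IsClosed (C i) ∧ IsConnected (C i) ∧ (interior (C i)).Nonempty := by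
  refine ⟨?_, fun n => ⟨fun i => (↑) ⁻¹' Carpet.bottomCopy i, fun i j hij => ?_, fun i => ?_⟩⟩
  · obtain ⟨F, hF⟩ := Carpet.exists_isBlowup
    have := isCompact_iff_compactSpace.1 Carpet.isCompact_carpet
    exact hF.exists_mixing
  · rcases lt_or_gt_of_ne (Fin.val_ne_of_ne hij) with h | h
    · exact (Carpet.disjoint_bottomCopy h).preimage _
    · exact ((Carpet.disjoint_bottomCopy h).preimage _).symm
  · obtain ⟨U, hU⟩ := Carpet.exists_isFatSubcontinuum_bottomCopy i
    exact Carpet.isClosed_isConnected_interior_nonempty hU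
end

section
/- Let 0 < a < 1 < b be real numbers with a·b = 1, let ε > 0, and let p, q ∈ ℝ satisfy |q| ≤ |p| < ε and q ≠ 0. Let n be the least natural number with b^n·|q| > ε (such n exists since b > 1 and q ≠ 0). Then the set J = { j ∈ ℕ : a^j·|p| ≥ b^j·|q| } is finite and 2·|J| ≤ n + 1. In particular, no more than half of the iterates of (p, q) under the hyperbolic linear map f(x, y) = (a·x, b·y) that stay in the square [−ε, ε]² lie in the cone |x-coordinate| ≥ |y-coordinate|. -/
/-- For the hyperbolic map `f(x,y) = (ax, by)` with `0 < a < 1 < b`, `ab = 1`, a point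
`(p,q)` with `|q| ≤ |p| < ε`, `q ≠ 0`: if `n` is the least natural number with
`b^n * |q| > ε`, then the set `J` of iterates lying in the cone `|x| ≥ |y|` is finite and
`2 * |J| ≤ n + 1`. -/
theorem hyperbolic_cone_time_estimate (a b ε p q : ℝ) (ha : 0 < a) (ha1 : a < 1) (hb : 1 < b)
    (hab : a * b = 1) (hε : 0 < ε) (hqp : |q| ≤ |p|) (hpε : |p| < ε) (hq : q ≠ 0) (n : ℕ)
    (hn : ε < b ^ n * |q|) (hnmin : ∀ m : ℕ, m < n → ¬ ε < b ^ m * |q|) :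
    ∃ hJ : {j : ℕ | b ^ j * |q| ≤ a ^ j * |p|}.Finite, 2 * hJ.toFinset.card ≤ n + 1 := by
  have hsub : {j : ℕ | b ^ j * |q| ≤ a ^ j * |p|} ⊆ (Finset.range ((n + 1) / 2) : Set ℕ) := by
    intro j hj
    have hj : b ^ j * |q| ≤ a ^ j * |p| := hj
    have hb0 : 0 < b ^ j := by positivity
    have hinv : b ^ j * a ^ j = 1 := by rw [← mul_pow, mul_comm b a, hab, one_pow]
    have hp : b ^ (2 * j) * |q| ≤ |p| := calc
      b ^ (2 * j) * |q| = b ^ j * (b ^ j * |q|) := by ring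
      _ ≤ b ^ j * (a ^ j * |p|) := by gcongr
      _ = |p| := by rw [← mul_assoc, hinv, one_mul]
    have hlt : b ^ (2 * j) < b ^ n :=
      lt_of_mul_lt_mul_right ((hp.trans_lt hpε).trans hn) (abs_nonneg q)
    have hjn : 2 * j < n := (pow_lt_pow_iff_right₀ hb).mp hlt
    rw [Finset.mem_coe, Finset.mem_range]
    omega
  have hJ := (Finset.finite_toSet _).subset hsub
  refine ⟨hJ, ?_⟩
  have hcard : hJ.toFinset.card ≤ (Finset.range ((n + 1) / 2)).card :=
    Finset.card_le_card (hJ.toFinset_subset.mpr hsub)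
  rw [Finset.card_range] at hcard
  omega
end

section
/- Let T : X → X be a continuous surjection of a compact metric space with Bowen's specification property. Then for every integer k ≥ 1 the map T^k also has Bowen's specification property. -/
/-- Bowen's specification property passes to iterates `T^k`, `k ≥ 1`. -/
theorem bowenSpecification_iterate {X : Type*} [MetricSpace X] [CompactSpace X]
    (T : X → X) (hT : Continuous T) (hsurj : Function.Surjective T)
    (hspec : BowenSpecification T) (k : ℕ) (hk : 1 ≤ k) :
    BowenSpecification (T^[k]) := by
  intro ε hε
  obtain ⟨N, hN, h⟩ := hspec ε hε
  refine ⟨N, hN, fun s hs y a b ha hab hgap => ?_⟩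
  obtain ⟨x, hx⟩ := h s hs y (fun m => k * a m) (fun m => k * b m) (by simp [ha])
    (fun m hm => Nat.mul_le_mul_left k (hab m hm))
    (fun m hm => by
      obtain ⟨hlt, hle⟩ := hgap m hm
      refine ⟨Nat.mul_lt_mul_of_pos_left hlt hk, ?_⟩
      rw [← Nat.mul_sub]
      exact hle.trans (Nat.le_mul_of_pos_left _ hk))
  refine ⟨x, fun m hm i hai hib => ?_⟩
  simpa only [Function.iterate_mul] using
    hx m hm (k * i) (Nat.mul_le_mul_left k hai) (Nat.mul_le_mul_left k hib)
end
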